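/- arXiv:1601.03791 — 3 statements merged into one kernel-verified Lean document; each statement's English description precedes it below -/
import Mathlib

section
/- Let k ≥ 1 be an integer. Every finite simple graph G with |G| ≥ 3k vertices and minimum degree δ(G) ≥ 2k contains k pairwise vertex-disjoint cycles. -/
/-- `G` contains `n` pairwise vertex-disjoint cycles. -/
def SimpleGraph.HasNDisjointCycles {V : Type*} (G : SimpleGraph V) (n : ℕ) : Prop :=
  ∃ f : Fin n → Σ v : V, G.Walk v v,
    (∀ i, (f i).2.IsCycle) ∧
    ∀ i j, i ≠ j → ∀ v, v ∈ (f i).2.support → v ∉ (f j).2.support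


namespace CH
section
open scoped Classical

inductive Reach (M : ℕ → ℕ → Prop) (a : ℕ) : Finset ℕ → ℕ → Prop
  | base (P : Finset ℕ) : a ∈ P → Reach M a P a
  | step (P : Finset ℕ) (i j : ℕ) : i ∈ P → M i j → Reach M a (P.erase i) j → Reach M a P i

theorem Reach.mem {M : ℕ → ℕ → Prop} {a : ℕ} {P : Finset ℕ} {i : ℕ} (h : Reach M a P i) : i ∈ P := by
  cases h <;> assumption

theorem Reach.mono {M : ℕ → ℕ → Prop} {a : ℕ} {P : Finset ℕ} {i : ℕ} (h : Reach M a P i) :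
    ∀ Q : Finset ℕ, P ⊆ Q → Reach M a Q i := by
  induction h with
  | base P h => exact fun Q hQ => .base Q (hQ h)
  | step P i j hi hM _ ih =>
    exact fun Q hQ => .step Q i j (hQ hi) hM (ih _ (Finset.erase_subset_erase i hQ))

theorem Reach.split {M : ℕ → ℕ → Prop} {a : ℕ} {P : Finset ℕ} {j : ℕ} (h : Reach M a P j) :
    ∀ i ∈ P, Reach M a (P.erase i) j ∨ Reach M a P i := by
  induction h with
  | base P h =>
    intro i hi
    by_cases hia : i = a
    · subst hia; exact Or.inr (.base P h)
    · exact Or.inl (.base _ (by simp [h, Ne.symm hia]))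
  | step P j l hj hM hl ih =>
    intro i hi
    by_cases hij : i = j
    · subst hij; exact Or.inr (.step P i l hj hM hl)
    · rcases ih i (by simp [hi, hij]) with h | h
      · left
        refine .step _ j l (by simp [hj, Ne.symm hij]) hM ?_
        rwa [Finset.erase_right_comm]
      · exact Or.inr (h.mono _ (Finset.erase_subset _ _))

theorem Reach.cons {M : ℕ → ℕ → Prop} {a : ℕ} {P : Finset ℕ} {i j : ℕ} (h : Reach M a P j)
    (hi : i ∈ P) (hM : M i j) : Reach M a P i := by
  rcases h.split i hi with h | h
  · exact .step P i j hi hM h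
  · exact h

theorem Reach.split2 {M : ℕ → ℕ → Prop} {a : ℕ} {P : Finset ℕ} {i j : ℕ} (h : Reach M a P j)
    (hi : i ∈ P) (hij : i ≠ j) : Reach M a (P.erase i) j ∨ Reach M a (P.erase j) i := by
  cases h with
  | base _ h => exact Or.inl (.base _ (by simp [h, Ne.symm hij]))
  | step _ _ l hj hM hl =>
    rcases hl.split i (by simp [hi, hij]) with h | h
    · left
      refine .step _ j l (by simp [hj, Ne.symm hij]) hM ?_
      rwa [Finset.erase_right_comm]
    · exact Or.inr h

variable {V : Type*}

/-- colour class -/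
noncomputable def cl (U : Finset V) (f : V → ℕ) (i : ℕ) : Finset V := U.filter (fun v => f v = i)

/-- some vertex of class i can be moved to class j -/
def Mov (H : SimpleGraph V) (U : Finset V) (f : V → ℕ) (i j : ℕ) : Prop :=
  ∃ v ∈ U, f v = i ∧ ∀ w ∈ U, f w = j → ¬ H.Adj v w

def Proper (H : SimpleGraph V) (U : Finset V) (f : V → ℕ) : Prop :=
  ∀ v ∈ U, ∀ w ∈ U, H.Adj v w → f v ≠ f w

theorem card_cl_update (U : Finset V) (f : V → ℕ) (v : V) (hv : v ∈ U) (j l : ℕ) :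
    (cl U (Function.update f v j) l).card + (if l = f v then 1 else 0)
      = (cl U f l).card + (if l = j then 1 else 0) := by
  unfold cl
  rw [Finset.card_filter, Finset.card_filter, ← Finset.add_sum_erase _ _ hv,
    ← Finset.add_sum_erase U (fun w => if f w = l then 1 else 0) hv]
  have : ∑ x ∈ U.erase v, (if Function.update f v j x = l then 1 else 0)
      = ∑ x ∈ U.erase v, (if f x = l then 1 else 0) := by
    apply Finset.sum_congr rfl
    intro x hx
    rw [Function.update_of_ne (Finset.ne_of_mem_erase hx)]
  rw [this]
  simp only [Function.update_self, eq_comm (a := l)]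
  omega

theorem proper_update {H : SimpleGraph V} {U : Finset V} {f : V → ℕ} (v : V)
    (hf : Proper H (U.erase v) f) (j : ℕ) (h : ∀ w ∈ U, w ≠ v → f w = j → ¬ H.Adj v w) : Proper H U (Function.update f v j) := by
  intro x hx y hy hxy
  by_cases h1 : x = v
  · subst h1
    have : y ≠ x := hxy.ne'
    rw [Function.update_self, Function.update_of_ne this]
    intro h2
    exact h y hy this h2.symm hxy
  · by_cases h2 : y = v
    · subst h2
      rw [Function.update_self, Function.update_of_ne h1]
      intro h3
      exact h x hx h1 h3 hxy.symm
    · rw [Function.update_of_ne h1, Function.update_of_ne h2]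
      exact hf x (by simp [h1, hx]) y (by simp [h2, hy]) hxy

theorem shift {H : SimpleGraph V} {U : Finset V} {f : V → ℕ} (hf : Proper H U f) {a : ℕ}
    {P : Finset ℕ} {i : ℕ} (h : Reach (Mov H U f) a P i) :
    ∃ f' : V → ℕ, Proper H U f' ∧
      (∀ v, f' v = f v ∨ (Reach (Mov H U f) a P (f v) ∧ Reach (Mov H U f) a P (f' v))) ∧
      (∀ v, f' v = i → f v = i) ∧
      ∀ l, (cl U f' l).card + (if l = i then 1 else 0) = (cl U f l).card + (if l = a then 1 else 0) := by
  induction h with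
  | base P h => exact ⟨f, hf, fun v => Or.inl rfl, fun v h => h, fun l => rfl⟩
  | step P i j hi hM hj ih =>
    obtain ⟨f', hp, hR, hsub, hc⟩ := ih
    obtain ⟨v, hv, hvi, hvn⟩ := hM
    have hmono : ∀ {x}, Reach (Mov H U f) a (P.erase i) x → Reach (Mov H U f) a P x :=
      fun h => h.mono _ (Finset.erase_subset _ _)
    have hRi : Reach (Mov H U f) a P i := .step P i j hi ⟨v, hv, hvi, hvn⟩ hj
    have hf'v : f' v = i := by
      rcases hR v with h | h
      · rw [h, hvi]
      · have := h.1.mem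
        rw [hvi] at this
        simp at this
    have hji : j ≠ i := (Finset.mem_erase.1 hj.mem).1
    refine ⟨Function.update f' v j, proper_update v
      (fun x hx y hy => hp x (Finset.mem_of_mem_erase hx) y (Finset.mem_of_mem_erase hy)) j ?_, ?_, ?_, ?_⟩
    · intro w hw _ hwj
      exact hvn w hw (hsub w hwj)
    · intro w
      by_cases hwv : w = v
      · subst hwv
        right
        rw [Function.update_self, hvi]
        exact ⟨hRi, hmono hj⟩
      · rw [Function.update_of_ne hwv]
        rcases hR w with h | h
        · exact Or.inl h
        · exact Or.inr ⟨hmono h.1, hmono h.2⟩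
    · intro w hw
      by_cases hwv : w = v
      · subst hwv; exact hvi
      · rw [Function.update_of_ne hwv] at hw
        rcases hR w with h | h
        · rw [← h, hw]
        · have := h.2.mem
          rw [hw] at this
          simp at this
    · intro l
      have h1 := card_cl_update U f' v hv j l
      rw [hf'v] at h1
      have h2 := hc l
      omega

theorem Reach.root {M : ℕ → ℕ → Prop} {a : ℕ} {P : Finset ℕ} {i : ℕ} (h : Reach M a P i) :
    a ∈ P := by
  induction h with
  | base P h => exact h
  | step P i j hi hM _ ih => exact Finset.mem_of_mem_erase ih

/-- number of neighbours of v in U -/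
noncomputable def nbc (H : SimpleGraph V) (U : Finset V) (v : V) : ℕ := (U.filter (H.Adj v)).card

theorem nbc_mono (H : SimpleGraph V) {X Y : Finset V} (h : X ⊆ Y) (v : V) : nbc H X v ≤ nbc H Y v :=
  Finset.card_le_card (Finset.filter_subset_filter _ h)

theorem nbc_comm (H : SimpleGraph V) (X Y : Finset V) :
    ∑ y ∈ X, nbc H Y y = ∑ v ∈ Y, nbc H X v := by
  unfold nbc
  simp_rw [Finset.card_filter]
  rw [Finset.sum_comm]
  simp_rw [H.adj_comm]

theorem nbc_eq_zero {H : SimpleGraph V} {X : Finset V} {v : V} (h : nbc H X v = 0) :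
    ∀ w ∈ X, ¬ H.Adj v w := by
  intro w hw hvw
  unfold nbc at h
  rw [Finset.card_eq_zero, Finset.filter_eq_empty_iff] at h
  exact h hw hvw

theorem nbc_pos {H : SimpleGraph V} {X : Finset V} {v w : V} (hw : w ∈ X) (h : H.Adj v w) :
    1 ≤ nbc H X v := by
  by_contra h0
  exact nbc_eq_zero (by omega) w hw h

theorem countT (H : SimpleGraph V) (W B : Finset V) (q s t : ℕ) (hW : W.card = s)
    (hB : B.card = q * s + 1) (h1 : ∀ y ∈ B, 1 ≤ nbc H W y)
    (h2 : ∀ z ∈ W, ∀ y ∈ B, W.filter (H.Adj y) = {z} → nbc H B z ≤ q)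
    (h3 : ∀ z ∈ W, nbc H B z ≤ q + t) : q < t := by
  by_contra hcon
  let w : V → ℕ := fun z => if ∃ y ∈ B, W.filter (H.Adj y) = {z} then 2 else 1
  have hw1 : ∀ z, 1 ≤ w z := by
    intro z; simp only [w]; split_ifs <;> omega
  have hle : ∀ y ∈ B, 2 ≤ ∑ z ∈ W.filter (H.Adj y), w z := by
    intro y hy
    have hc : 1 ≤ (W.filter (H.Adj y)).card := h1 y hy
    by_cases h : (W.filter (H.Adj y)).card = 1
    · obtain ⟨z, hz⟩ := Finset.card_eq_one.1 h
      rw [hz, Finset.sum_singleton]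
      simp only [w]
      rw [if_pos ⟨y, hy, hz⟩]
    · calc 2 ≤ (W.filter (H.Adj y)).card := by omega
        _ = ∑ z ∈ W.filter (H.Adj y), 1 := by simp
        _ ≤ _ := Finset.sum_le_sum (fun z _ => hw1 z)
  have h4 : 2 * B.card ≤ ∑ y ∈ B, ∑ z ∈ W.filter (H.Adj y), w z := by
    calc 2 * B.card = ∑ y ∈ B, 2 := by simp [mul_comm]
      _ ≤ _ := Finset.sum_le_sum hle
  have h5 : ∑ y ∈ B, ∑ z ∈ W.filter (H.Adj y), w z = ∑ z ∈ W, w z * nbc H B z := by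
    simp_rw [Finset.sum_filter]
    rw [Finset.sum_comm]
    apply Finset.sum_congr rfl
    intro z _
    unfold nbc
    rw [Finset.card_filter, Finset.mul_sum]
    apply Finset.sum_congr rfl
    intro y _
    rw [H.adj_comm]
    simp
  have h6 : ∑ z ∈ W, w z * nbc H B z ≤ ∑ z ∈ W, 2 * q := by
    apply Finset.sum_le_sum
    intro z hz
    simp only [w]
    split_ifs with h
    · obtain ⟨y, hy, hyz⟩ := h
      have := h2 z hz y hy hyz
      omega
    · have := h3 z hz
      omega
  rw [h5] at h4
  rw [Finset.sum_const, smul_eq_mul, hW] at h6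
  nlinarith

theorem pigeon (H : SimpleGraph V) (U B : Finset V) (f : V → ℕ) (T : Finset ℕ) (q s t : ℕ)
    (hB : B.card = q * s + 1) (hqt : q < t) (hBq : ∀ y ∈ B, nbc H B y + 1 ≤ q)
    (hσ : ∀ y ∈ B, t + 1 + nbc H B y ≤ (T.filter (fun i => nbc H (cl U f i) y = 1)).card + q)
    (hT : (U.filter (fun v => f v ∈ T)).card = t * s) :
    ∃ y₁ ∈ B, ∃ y₂ ∈ B, y₁ ≠ y₂ ∧ ¬ H.Adj y₁ y₂ ∧ ∃ z ∈ U, f z ∈ T ∧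
      (cl U f (f z)).filter (H.Adj y₁) = {z} ∧ (cl U f (f z)).filter (H.Adj y₂) = {z} := by
  -- maximal independent set
  obtain ⟨I, hI, hmax⟩ := Finset.exists_max_image
    (B.powerset.filter (fun I => ∀ x ∈ I, ∀ y ∈ I, ¬ H.Adj x y)) Finset.card
    ⟨∅, by simp⟩
  simp only [Finset.mem_filter, Finset.mem_powerset] at hI hmax
  obtain ⟨hIB, hind⟩ := hI
  have hcov : B ⊆ I.biUnion (fun y => insert y (B.filter (H.Adj y))) := by
    intro x hx
    rw [Finset.mem_biUnion]
    by_contra hno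
    push Not at hno
    have hxI : x ∉ I := fun h => hno x h (by simp)
    have hxa : ∀ y ∈ I, ¬ H.Adj y x := fun y hy h => hno y hy (by simp [hx, h])
    have := hmax (insert x I) ⟨Finset.insert_subset hx hIB, by
      intro u hu v hv
      rw [Finset.mem_insert] at hu hv
      rcases hu with rfl | hu <;> rcases hv with rfl | hv
      · simp
      · exact fun h => hxa v hv h.symm
      · exact hxa u hu
      · exact hind u hu v hv⟩
    rw [Finset.card_insert_of_notMem hxI] at this
    omega
  have h1 : B.card ≤ ∑ y ∈ I, (nbc H B y + 1) := by
    refine (Finset.card_le_card hcov).trans (Finset.card_biUnion_le.trans ?_)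
    exact Finset.sum_le_sum (fun y _ => Finset.card_insert_le _ _)
  have h2 : ∑ y ∈ I, (nbc H B y + 1) ≤ I.card * q := by
    rw [← smul_eq_mul, ← Finset.sum_const]
    exact Finset.sum_le_sum (fun y hy => hBq y (hIB hy))
  have hIs : s < I.card := by
    by_contra h
    have : I.card * q ≤ s * q := Nat.mul_le_mul_right _ (by omega)
    nlinarith
  have h3 : ∑ y ∈ I, (t + (nbc H B y + 1)) ≤
      ∑ y ∈ I, ((T.filter (fun i => nbc H (cl U f i) y = 1)).card + q) :=
    Finset.sum_le_sum (fun y hy => by have := hσ y (hIB hy); omega)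
  simp only [Finset.sum_add_distrib, Finset.sum_const, smul_eq_mul] at h1 h2 h3
  have h4 : t * s < ∑ y ∈ I, (T.filter (fun i => nbc H (cl U f i) y = 1)).card := by
    obtain ⟨e, rfl⟩ := Nat.exists_eq_add_of_lt hqt
    have h5 : s * (e + 1) ≤ I.card * (e + 1) := Nat.mul_le_mul_right _ hIs.le
    nlinarith
  let Z : Finset (Σ _ : V, ℕ) := I.sigma (fun y => T.filter (fun i => nbc H (cl U f i) y = 1))
  have hZ : Z.card = ∑ y ∈ I, (T.filter (fun i => nbc H (cl U f i) y = 1)).card :=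
    Finset.card_sigma _ _
  have hex : ∀ p ∈ Z, ∃ z, (cl U f p.2).filter (H.Adj p.1) = {z} := by
    intro p hp
    simp only [Z, Finset.mem_sigma, Finset.mem_filter] at hp
    exact Finset.card_eq_one.1 hp.2.2
  let φ : (Σ _ : V, ℕ) → V := fun p =>
    if h : ∃ z, (cl U f p.2).filter (H.Adj p.1) = {z} then h.choose else p.1
  have hφ : ∀ p ∈ Z, (cl U f p.2).filter (H.Adj p.1) = {φ p} := by
    intro p hp
    have h := hex p hp
    have h' : φ p = h.choose := dif_pos h
    rw [h']
    exact h.choose_spec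
  have hφ2 : ∀ p ∈ Z, φ p ∈ U ∧ f (φ p) = p.2 ∧ H.Adj p.1 (φ p) := by
    intro p hp
    have : φ p ∈ (cl U f p.2).filter (H.Adj p.1) := by rw [hφ p hp]; simp
    simp only [cl, Finset.mem_filter] at this
    exact ⟨this.1.1, this.1.2, this.2⟩
  have hpT : ∀ p ∈ Z, p.1 ∈ I ∧ p.2 ∈ T := by
    intro p hp
    simp only [Z, Finset.mem_sigma, Finset.mem_filter] at hp
    exact ⟨hp.1, hp.2.1⟩
  obtain ⟨p, hp, p', hp', hne, heq⟩ := Finset.exists_ne_map_eq_of_card_lt_of_maps_to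
    (s := Z) (t := U.filter (fun v => f v ∈ T)) (by rw [hZ, hT]; exact h4) (f := φ) (by
      intro p hp
      have h := hφ2 p hp
      have := (hpT p hp).2
      simp only [Finset.coe_filter, Set.mem_ofPred_eq]
      exact ⟨h.1, by rw [h.2.1]; exact this⟩)
  have e1 := hφ2 p hp
  have e2 := hφ2 p' hp'
  have h22 : p.2 = p'.2 := by rw [← e1.2.1, ← e2.2.1, heq]
  have h11 : p.1 ≠ p'.1 := by
    intro h
    apply hne
    exact Sigma.ext h (heq_of_eq h22)
  refine ⟨p.1, hIB (hpT p hp).1, p'.1, hIB (hpT p' hp').1, h11,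
    hind _ (hpT p hp).1 _ (hpT p' hp').1, φ p, e1.1, by rw [e1.2.1]; exact (hpT p hp).2, ?_, ?_⟩
  · rw [e1.2.1]; exact hφ p hp
  · rw [e1.2.1, h22, heq]; exact hφ p' hp'

end
end CH

namespace CH
section
open scoped Classical
variable {V : Type*}

def Equit (H : SimpleGraph V) (U : Finset V) (K : Finset ℕ) (s : ℕ) (f : V → ℕ) : Prop :=
  (∀ v ∈ U, f v ∈ K) ∧ Proper H U f ∧ ∀ i ∈ K, (cl U f i).card = s

def NE (H : SimpleGraph V) (U : Finset V) (K : Finset ℕ) (s : ℕ) (f : V → ℕ) (a b : ℕ) : Prop :=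
  a ∈ K ∧ b ∈ K ∧ (∀ v ∈ U, f v ∈ K) ∧ Proper H U f ∧
    ∀ l ∈ K, (cl U f l).card + (if l = a then 1 else 0) = s + (if l = b then 1 else 0)

noncomputable def merge (B : Finset V) (g f : V → ℕ) : V → ℕ := fun v => if v ∈ B then g v else f v

theorem merge_proper {H : SimpleGraph V} {X B : Finset V} {f g : V → ℕ} {A : Finset ℕ}
    (hf : Proper H (X \ B) f) (hg : Proper H B g) (hfA : ∀ v ∈ X \ B, f v ∈ A)
    (hgA : ∀ v ∈ B, g v ∉ A) : Proper H X (merge B g f) := by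
  intro v hv w hw hvw
  unfold merge
  split_ifs with h1 h2 h2
  · exact hg v h1 w h2 hvw
  · intro h
    exact hgA v h1 (h ▸ hfA w (by simp [hw, h2]))
  · intro h
    exact hgA w h2 (h ▸ hfA v (by simp [hv, h1]))
  · exact hf v (by simp [hv, h1]) w (by simp [hw, h2]) hvw

theorem merge_cl_mem {U B : Finset V} {f g : V → ℕ} {A : Finset ℕ}
    (hfB : ∀ v ∈ B, f v ∉ A) (hgA : ∀ v ∈ B, g v ∉ A) {i : ℕ} (hi : i ∈ A) :
    cl U (merge B g f) i = cl U f i := by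
  unfold cl merge
  apply Finset.filter_congr
  intro v _
  split_ifs with h
  · constructor
    · intro h'; exact absurd (h' ▸ hi) (hgA v h)
    · intro h'; exact absurd (h' ▸ hi) (hfB v h)
  · rfl

theorem merge_cl_notMem {U B : Finset V} {f g : V → ℕ} {A : Finset ℕ} (hBU : B ⊆ U)
    (hfA : ∀ v ∈ U \ B, f v ∈ A) {i : ℕ} (hi : i ∉ A) :
    cl U (merge B g f) i = cl B g i := by
  unfold cl merge
  ext v
  simp only [Finset.mem_filter]
  constructor
  · rintro ⟨h1, h2⟩
    split_ifs at h2 with h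
    · exact ⟨h, h2⟩
    · exact absurd (h2 ▸ hfA v (by simp [h1, h])) hi
  · rintro ⟨h1, h2⟩
    exact ⟨hBU h1, by rw [if_pos h1]; exact h2⟩

theorem nbc_fiber (H : SimpleGraph V) (U : Finset V) (f : V → ℕ) (A : Finset ℕ) (v : V) :
    nbc H U v = nbc H (U.filter (fun v => f v ∉ A)) v + ∑ i ∈ A, nbc H (cl U f i) v := by
  have h1 : ∑ i ∈ A, nbc H (cl U f i) v = nbc H (U.filter (fun v => f v ∈ A)) v := by
    unfold nbc
    rw [Finset.card_eq_sum_card_fiberwise (f := f) (t := A)]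
    · apply Finset.sum_congr rfl
      intro i hi
      congr 1
      ext w
      simp only [cl, Finset.mem_filter]
      constructor
      · rintro ⟨⟨h1, h2⟩, h3⟩; exact ⟨⟨⟨h1, h2 ▸ hi⟩, h3⟩, h2⟩
      · rintro ⟨⟨⟨h1, h2⟩, h3⟩, h4⟩; exact ⟨⟨h1, h4⟩, h3⟩
    · intro w hw
      simp at hw
      exact hw.1.2
  rw [h1]
  unfold nbc
  rw [Finset.filter_comm, Finset.filter_comm (s := U) (p := fun v => f v ∈ A), add_comm]
  exact (Finset.card_filter_add_card_filter_not _).symm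

theorem card_fiber (U : Finset V) (f : V → ℕ) (A : Finset ℕ) :
    (U.filter (fun v => f v ∈ A)).card = ∑ i ∈ A, (cl U f i).card := by
  rw [Finset.card_eq_sum_card_fiberwise (f := f) (t := A)]
  · apply Finset.sum_congr rfl
    intro i hi
    congr 1
    ext w
    simp only [cl, Finset.mem_filter]
    constructor
    · rintro ⟨⟨h1, h2⟩, h3⟩; exact ⟨h1, h3⟩
    · rintro ⟨h1, h4⟩; exact ⟨⟨h1, h4 ▸ hi⟩, h4⟩
  · intro w hw
    simp at hw
    exact hw.2

noncomputable def acc (H : SimpleGraph V) (U : Finset V) (K : Finset ℕ) (f : V → ℕ) (a : ℕ) : Finset ℕ :=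
  K.filter (Reach (Mov H U f) a K)

/-- existence of the terminal family -/
theorem terminal (M : ℕ → ℕ → Prop) (a : ℕ) (K : Finset ℕ) (A : Finset ℕ)
    (hA : ∀ i, i ∈ A ↔ Reach M a K i) (haA : a ∈ A) (hne : (A.erase a).Nonempty) :
    ∃ u ∈ A, ∃ T ⊆ A, T.Nonempty ∧ a ∉ T ∧ u ∉ T ∧
      (∀ W ∈ T, ∀ i ∈ A, i ≠ W → Reach M a (K.erase W) i) ∧
      (∀ W ∈ T, ∀ i ∈ A, i ∉ T → i ≠ u → ¬ M W i) := by
  let N : ℕ → Finset ℕ := fun u => A.filter (fun i => i ≠ u ∧ ¬ Reach M a (K.erase u) i)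
  have hNa : (N a).Nonempty := by
    obtain ⟨i, hi⟩ := hne
    refine ⟨i, ?_⟩
    simp only [N, Finset.mem_filter]
    refine ⟨Finset.mem_of_mem_erase hi, (Finset.mem_erase.1 hi).1, fun h => ?_⟩
    have := h.root
    simp at this
  obtain ⟨u, hu, hmin⟩ := Finset.exists_min_image (A.filter (fun u => (N u).Nonempty))
    (fun u => (N u).card) ⟨a, by simp [haA, hNa]⟩
  simp only [Finset.mem_filter] at hu hmin
  have hmN : ∀ {x i}, i ∈ N x ↔ i ∈ A ∧ i ≠ x ∧ ¬ Reach M a (K.erase x) i := by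
    intro x i; simp [N]
  have hAK : ∀ {i}, i ∈ A → i ∈ K := fun h => ((hA _).1 h).mem
  refine ⟨u, hu.1, N u, Finset.filter_subset _ _, hu.2, ?_, ?_, ?_, ?_⟩
  · intro h
    obtain ⟨_, h1, h2⟩ := hmN.1 h
    exact h2 (.base _ (by simp [h1, hAK haA]))
  · intro h
    exact (hmN.1 h).2.1 rfl
  · intro W hW i hi hiW
    by_contra hcon
    obtain ⟨hWA, hWu, hWR⟩ := hmN.1 hW
    have hle := hmin W ⟨hWA, ⟨i, hmN.2 ⟨hi, hiW, hcon⟩⟩⟩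
    have hss : N W ⊂ N u := by
      rw [Finset.ssubset_iff_of_subset]
      · exact ⟨W, hW, fun h => (hmN.1 h).2.1 rfl⟩
      · intro l hl
        obtain ⟨hlA, hlW, hlR⟩ := hmN.1 hl
        refine hmN.2 ⟨hlA, ?_, ?_⟩
        · rintro rfl
          rcases ((hA l).1 hlA).split2 (hAK hWA) hWu with h | h
          · exact hlR h
          · exact hWR h
        · intro h
          rcases h.split W (by simp [hWu, hAK hWA]) with h' | h'
          · exact hlR (h'.mono _ (by rw [Finset.erase_right_comm]; exact Finset.erase_subset _ _))
          · exact hWR h'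
    have := Finset.card_lt_card hss
    omega
  · intro W hW i hi hiT hiu hM
    obtain ⟨hWA, hWu, hWR⟩ := hmN.1 hW
    have hiR : Reach M a (K.erase u) i := by
      by_contra h
      exact hiT (hmN.2 ⟨hi, hiu, h⟩)
    exact hWR (hiR.cons (by simp [hWu, hAK hWA]) hM)

end
end CH

namespace CH
section
open scoped Classical
variable {V : Type*}

theorem Reach.cases' {M : ℕ → ℕ → Prop} {a : ℕ} {P : Finset ℕ} {i : ℕ} (h : Reach M a P i)
    (hne : i ≠ a) : ∃ l, i ∈ P ∧ M i l ∧ Reach M a (P.erase i) l := by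
  cases h with
  | base _ h => exact absurd rfl hne
  | step _ _ l hi hM hl => exact ⟨l, hi, hM, hl⟩

theorem ne_main (H : SimpleGraph V) (U : Finset V) (K : Finset ℕ) (s : ℕ)
    (hdeg : ∀ v ∈ U, nbc H U v + 1 ≤ K.card)
    (IH : ∀ (K' : Finset ℕ) (U' : Finset V), K'.card < K.card → U'.card = K'.card * s →
      (∀ v ∈ U', nbc H U' v + 1 ≤ K'.card) → ∃ f, Equit H U' K' s f) :
    ∀ (d : ℕ) (f : V → ℕ) (a b : ℕ), NE H U K s f a b → K.card - (acc H U K f a).card = d →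
      ∃ f', Equit H U K s f' := by
  intro d
  induction d using Nat.strong_induction_on with
  | _ d ihd =>
  intro f a b hNE hd
  obtain ⟨haK, hbK, hfK, hfp, hfc⟩ := hNE
  set A := acc H U K f a with hAdef
  have hA : ∀ i, i ∈ A ↔ Reach (Mov H U f) a K i := by
    intro i
    simp only [hAdef, acc, Finset.mem_filter]
    exact ⟨fun h => h.2, fun h => ⟨h.mem, h⟩⟩
  have hAK : A ⊆ K := Finset.filter_subset _ _
  have haA : a ∈ A := (hA a).2 (.base _ haK)
  by_cases hb : b ∈ A
  · obtain ⟨f', hp, hR, -, hc⟩ := shift hfp ((hA b).1 hb)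
    refine ⟨f', ?_, hp, ?_⟩
    · intro v hv
      rcases hR v with h | h
      · rw [h]; exact hfK v hv
      · exact h.2.mem
    · intro i hi
      have h1 := hc i
      have h2 := hfc i hi
      omega
  set B := U.filter (fun v => f v ∉ A) with hBdef
  have hBU : B ⊆ U := Finset.filter_subset _ _
  have hmB : ∀ {v}, v ∈ B ↔ v ∈ U ∧ f v ∉ A := by intro v; simp [hBdef]
  have hBnb : ∀ y ∈ B, ∀ i ∈ A, 1 ≤ nbc H (cl U f i) y := by
    intro y hy i hi
    by_contra h
    have h0 := nbc_eq_zero (show nbc H (cl U f i) y = 0 by omega)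
    apply (hmB.1 hy).2
    rw [hA]
    refine ((hA i).1 hi).cons (hfK y (hBU hy)) ⟨y, hBU hy, rfl, ?_⟩
    intro w hw hwi
    exact h0 w (by simp [cl, hw, hwi])
  have hdec : ∀ v, nbc H U v = nbc H B v + ∑ i ∈ A, nbc H (cl U f i) v := nbc_fiber H U f A
  set q := (K \ A).card with hq
  set m := A.card with hm
  have hqm : q + m = K.card := by
    rw [hq, hm]; exact Finset.card_sdiff_add_card_eq_card hAK
  have hm1 : 1 ≤ m := Finset.card_pos.2 ⟨a, haA⟩
  have hbKA : b ∈ K \ A := by simp [hbK, hb]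
  have hclB : ∀ l ∈ K \ A, (cl U f l).card = s + (if l = b then 1 else 0) := by
    intro l hl
    rw [Finset.mem_sdiff] at hl
    have := hfc l hl.1
    rw [if_neg (fun h : l = a => hl.2 (h ▸ haA))] at this
    exact this
  have hclA : ∀ l ∈ A, (cl U f l).card + (if l = a then 1 else 0) = s := by
    intro l hl
    have := hfc l (hAK hl)
    rw [if_neg (fun h : l = b => hb (h ▸ hl))] at this
    exact this
  have hBcard : B.card = q * s + 1 := by
    have h1 : B = U.filter (fun v => f v ∈ K \ A) := by
      ext v
      simp only [hBdef, Finset.mem_filter, Finset.mem_sdiff]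
      exact ⟨fun h => ⟨h.1, hfK v h.1, h.2⟩, fun h => ⟨h.1, h.2.2⟩⟩
    rw [h1, card_fiber, Finset.sum_congr rfl hclB, Finset.sum_add_distrib, Finset.sum_const,
      Finset.sum_ite_eq' (K \ A) b, if_pos hbKA, smul_eq_mul]
  have hBsum : ∀ y ∈ B, ∀ A' ⊆ A, A'.card ≤ ∑ i ∈ A', nbc H (cl U f i) y := by
    intro y hy A' hA'
    rw [Finset.card_eq_sum_ones]
    exact Finset.sum_le_sum (fun i hi => hBnb y hy i (hA' hi))
  have hBq : ∀ y ∈ B, nbc H B y + 1 ≤ q := by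
    intro y hy
    have h1 := hdec y
    have h2 := hdeg y (hBU hy)
    have h3 := hBsum y hy A (Finset.Subset.refl _)
    omega
  -- recolouring of B minus a vertex
  have hrec : ∀ y ∈ B, ∃ g, Equit H (B.erase y) (K \ A) s g := by
    intro y hy
    apply IH
    · omega
    · rw [Finset.card_erase_of_mem hy, hBcard]; rfl
    · intro v hv
      have h1 := hBq v (Finset.mem_of_mem_erase hv)
      have h2 := nbc_mono H (Finset.erase_subset y B) v
      omega
  have hne : (A.erase a).Nonempty := by
    by_contra hcon
    rw [Finset.not_nonempty_iff_eq_empty] at hcon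
    have hAa : A = {a} := by
      rw [← Finset.insert_erase haA, hcon]; rfl
    have hm' : m = 1 := by rw [hm, hAa]; rfl
    have h1 : B.card ≤ ∑ y ∈ B, nbc H (cl U f a) y := by
      rw [Finset.card_eq_sum_ones]
      exact Finset.sum_le_sum (fun y hy => hBnb y hy a haA)
    rw [nbc_comm] at h1
    have h2 : ∑ v ∈ cl U f a, nbc H B v ≤ ∑ v ∈ cl U f a, q := by
      apply Finset.sum_le_sum
      intro v hv
      have h3 := hdeg v (Finset.filter_subset _ _ hv)
      have h4 := nbc_mono H hBU v
      omega
    rw [Finset.sum_const, smul_eq_mul] at h2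
    have h5 := hclA a haA
    rw [if_pos rfl] at h5
    rw [← h5] at hBcard
    nlinarith
  obtain ⟨u, huA, T, hTA, hTne, haT, huT, hterm, hTnm⟩ := terminal (Mov H U f) a K A hA haA hne
  set t := T.card with ht
  have hTsum : ∀ v ∈ U, f v ∈ T → nbc H B v ≤ q + t := by
    intro v hv hvT
    have h1 : ((A \ T).erase u).card ≤ ∑ i ∈ (A \ T).erase u, nbc H (cl U f i) v := by
      rw [Finset.card_eq_sum_ones]
      apply Finset.sum_le_sum
      intro i hi
      simp only [Finset.mem_erase, Finset.mem_sdiff] at hi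
      by_contra h
      have h0 := nbc_eq_zero (show nbc H (cl U f i) v = 0 by omega)
      exact hTnm (f v) hvT i hi.2.1 hi.2.2 hi.1
        ⟨v, hv, rfl, fun w hw hwi => h0 w (by simp [cl, hw, hwi])⟩
    have h2 : ∑ i ∈ (A \ T).erase u, nbc H (cl U f i) v ≤ ∑ i ∈ A, nbc H (cl U f i) v :=
      Finset.sum_le_sum_of_subset ((Finset.erase_subset _ _).trans Finset.sdiff_subset)
    have h3 : ((A \ T).erase u).card + 1 + t = m := by
      have h4 : (A \ T).card + T.card = A.card := Finset.card_sdiff_add_card_eq_card hTA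
      rw [Finset.card_erase_add_one (by simp [huA, huT])]
      omega
    have h5 := hdec v
    have h6 := hdeg v hv
    omega
  have hTcl : ∀ W ∈ T, (cl U f W).card = s := by
    intro W hW
    have := hclA W (hTA hW)
    rw [if_neg (fun h : W = a => haT (h ▸ hW))] at this
    exact this
  by_cases hcase : ∃ z ∈ U, f z ∈ T ∧ ∃ y ∈ B, (cl U f (f z)).filter (H.Adj y) = {z} ∧
      ∃ X ∈ A, X ≠ f z ∧ nbc H (cl U f X) z = 0
  · obtain ⟨z, hz, hzT, y, hy, hyz, X, hX, hXz, hX0⟩ := hcase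
    set W := f z with hW
    have hzA : W ∈ A := hTA hzT
    obtain ⟨f1, hp1, hR1, hsub1, hc1⟩ := shift hfp (hterm W hzT X hX hXz)
    obtain ⟨g, hgK, hgp, hgc⟩ := hrec y hy
    have hyU := hBU hy
    have hyA := (hmB.1 hy).2
    have hRA : ∀ {i}, Reach (Mov H U f) a (K.erase W) i → i ∈ A ∧ i ≠ W := by
      intro i h
      exact ⟨(hA i).2 (h.mono _ (Finset.erase_subset _ _)), (Finset.mem_erase.1 h.mem).1⟩
    have hf1B : ∀ v, f v ∉ A → f1 v = f v := by
      intro v hv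
      rcases hR1 v with h | h
      · exact h
      · exact absurd (hRA h.1).1 hv
    have hf1W : ∀ v, f1 v = W ↔ f v = W := by
      intro v
      rcases hR1 v with h | h
      · rw [h]
      · exact iff_of_false (hRA h.2).2 (hRA h.1).2
    have hf1A : ∀ v, f v ∈ A → f1 v ∈ A := by
      intro v hv
      rcases hR1 v with h | h
      · rw [h]; exact hv
      · exact (hRA h.2).1
    have hf1z : f1 z = W := (hf1W z).2 rfl
    have hyz' : y ≠ z := by
      rintro rfl; exact hyA hzA
    have hzadj := nbc_eq_zero hX0
    have hysolo : ∀ w ∈ U, f w = W → w ≠ z → ¬ H.Adj y w := by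
      intro w hw hwW hwz had
      have : w ∈ (cl U f W).filter (H.Adj y) := by simp [cl, hw, hwW, had]
      rw [hyz] at this
      exact hwz (by simpa using this)
    set f2 := Function.update (Function.update f1 z X) y W with hf2
    have hf2y : f2 y = W := by simp [hf2]
    have hf2z : f2 z = X := by simp [hf2, hyz'.symm]
    have hf2o : ∀ v, v ≠ y → v ≠ z → f2 v = f1 v := by
      intro v h1 h2; simp [hf2, h1, h2]
    have hp2 : Proper H (U \ B.erase y) f2 := by
      have hpz : Proper H (U \ B.erase y) (Function.update f1 z X) := by
        apply proper_update
        · intro v hv w hw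
          have h1 := Finset.mem_of_mem_erase hv
          have h2 := Finset.mem_of_mem_erase hw
          rw [Finset.mem_sdiff] at h1 h2
          exact hp1 v h1.1 w h2.1
        · intro w hw _ hwX
          rw [Finset.mem_sdiff] at hw
          exact hzadj w (by simp [cl, hw.1, hsub1 w hwX])
      apply proper_update
      · intro v hv w hw
        exact hpz v (Finset.mem_of_mem_erase hv) w (Finset.mem_of_mem_erase hw)
      · intro w hw hwy hwW
        rw [Finset.mem_sdiff] at hw
        by_cases hwz : w = z
        · subst hwz
          rw [Function.update_self] at hwW
          exact absurd hwW hXz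
        · rw [Function.update_of_ne hwz] at hwW
          exact hysolo w hw.1 ((hf1W w).1 hwW) hwz
    have hf2A : ∀ v ∈ U \ B.erase y, f2 v ∈ A := by
      intro v hv
      rw [Finset.mem_sdiff] at hv
      by_cases h1 : v = y
      · rw [h1, hf2y]; exact hzA
      · by_cases h2 : v = z
        · rw [h2, hf2z]; exact hX
        · rw [hf2o v h1 h2]
          apply hf1A
          by_contra h3
          exact hv.2 (by simp [h1, hmB, hv.1, h3])
    have hf2B : ∀ v ∈ B.erase y, f2 v ∉ A := by
      intro v hv
      rw [Finset.mem_erase, hmB] at hv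
      rw [hf2o v hv.1 (by rintro rfl; exact hv.2.2 hzA), hf1B v hv.2.2]
      exact hv.2.2
    have hgA : ∀ v ∈ B.erase y, g v ∉ A := fun v hv => (Finset.mem_sdiff.1 (hgK v hv)).2
    refine ⟨merge (B.erase y) g f2, ?_, merge_proper hp2 hgp hf2A hgA, ?_⟩
    · intro v hv
      unfold merge
      split_ifs with h
      · exact Finset.sdiff_subset (hgK v h)
      · exact hAK (hf2A v (by rw [Finset.mem_sdiff]; exact ⟨hv, h⟩))
    · intro i hi
      by_cases hiA : i ∈ A
      · rw [merge_cl_mem hf2B hgA hiA]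
        have h1 := card_cl_update U (Function.update f1 z X) y hyU W i
        have h2 := card_cl_update U f1 z hz X i
        rw [Function.update_of_ne hyz', hf1B y hyA] at h1
        rw [if_neg (fun h : i = f y => hyA (h ▸ hiA))] at h1
        rw [hf1z] at h2
        have h3 := hc1 i
        have h4 := hclA i hiA
        rw [← hf2] at h1
        omega
      · rw [merge_cl_notMem ((Finset.erase_subset _ _).trans hBU) hf2A hiA]
        exact hgc i (by simp [hi, hiA])
  -- no solo vertex is movable
  have hsol : ∀ z ∈ U, f z ∈ T → ∀ y ∈ B, (cl U f (f z)).filter (H.Adj y) = {z} →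
      ∀ X ∈ A, X ≠ f z → 1 ≤ nbc H (cl U f X) z := by
    intro z hz hzT y hy hyz X hX hXz
    by_contra h
    exact hcase ⟨z, hz, hzT, y, hy, hyz, X, hX, hXz, by omega⟩
  have hsolq : ∀ z ∈ U, f z ∈ T → ∀ y ∈ B, (cl U f (f z)).filter (H.Adj y) = {z} →
      nbc H B z ≤ q := by
    intro z hz hzT y hy hyz
    have h1 : (A.erase (f z)).card ≤ ∑ i ∈ A.erase (f z), nbc H (cl U f i) z := by
      rw [Finset.card_eq_sum_ones]
      apply Finset.sum_le_sum
      intro i hi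
      rw [Finset.mem_erase] at hi
      exact hsol z hz hzT y hy hyz i hi.2 hi.1
    have h2 : ∑ i ∈ A.erase (f z), nbc H (cl U f i) z ≤ ∑ i ∈ A, nbc H (cl U f i) z :=
      Finset.sum_le_sum_of_subset (Finset.erase_subset _ _)
    have h3 := Finset.card_erase_add_one (hTA hzT)
    have h5 := hdec z
    have h6 := hdeg z hz
    omega
  have hqt : q < t := by
    obtain ⟨W, hW⟩ := hTne
    apply countT H (cl U f W) B q s t (hTcl W hW) hBcard (fun y hy => hBnb y hy W (hTA hW))
    · intro z hz y hy hyz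
      simp only [cl, Finset.mem_filter] at hz
      obtain ⟨hz, rfl⟩ := hz
      exact hsolq z hz hW y hy hyz
    · intro z hz
      simp only [cl, Finset.mem_filter] at hz
      obtain ⟨hz, rfl⟩ := hz
      exact hTsum z hz hW
  obtain ⟨y₁, hy₁, y₂, hy₂, hyne, hynadj, z, hz, hzT, hs1, hs2⟩ :=
    pigeon H U B f T q s t hBcard hqt hBq (by
      intro y hy
      have h1 := hdec y
      have h2 := hdeg y (hBU hy)
      have h3 := hBsum y hy (A \ T) Finset.sdiff_subset
      have h4 := Finset.sum_sdiff (f := fun i => nbc H (cl U f i) y) hTA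
      have h5 : (A \ T).card + T.card = A.card := Finset.card_sdiff_add_card_eq_card hTA
      have h6 : 2 * t ≤ (T.filter (fun i => nbc H (cl U f i) y = 1)).card
          + ∑ i ∈ T, nbc H (cl U f i) y := by
        rw [Finset.card_filter, ← Finset.sum_add_distrib, ht, mul_comm, ← smul_eq_mul,
          ← Finset.sum_const]
        apply Finset.sum_le_sum
        intro i hi
        have := hBnb y hy i (hTA hi)
        split_ifs <;> omega
      omega) (by
      rw [card_fiber, Finset.sum_congr rfl hTcl, Finset.sum_const, smul_eq_mul])
  set W := f z with hW
  have hzA : W ∈ A := hTA hzT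
  obtain ⟨g, hgK, hgp, hgc⟩ := hrec y₁ hy₁
  have hgA : ∀ v ∈ B.erase y₁, g v ∉ A := fun v hv => (Finset.mem_sdiff.1 (hgK v hv)).2
  have hyU := hBU hy₁
  have hyA := (hmB.1 hy₁).2
  have hzB : z ∉ B := fun h => (hmB.1 h).2 hzA
  have hyz' : y₁ ≠ z := by rintro rfl; exact hyA hzA
  have hysolo : ∀ y, (cl U f W).filter (H.Adj y) = {z} → ∀ w ∈ U, f w = W → w ≠ z → ¬ H.Adj y w := by
    intro y hyz w hw hwW hwz had
    have : w ∈ (cl U f W).filter (H.Adj y) := by simp [cl, hw, hwW, had]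
    rw [hyz] at this
    exact hwz (by simpa using this)
  have hadj1 : H.Adj y₁ z := by
    have : z ∈ (cl U f W).filter (H.Adj y₁) := by rw [hs1]; simp
    exact (Finset.mem_filter.1 this).2
  -- a colour for z
  obtain ⟨j, hj, hj0⟩ : ∃ j ∈ K \ A, ∀ w ∈ B.erase y₁, g w = j → ¬ H.Adj z w := by
    by_contra hcon
    push Not at hcon
    have h1 : K \ A ⊆ ((B.erase y₁).filter (H.Adj z)).image g := by
      intro j hj
      obtain ⟨w, hw, hwj, hzw⟩ := hcon j hj
      rw [Finset.mem_image]
      exact ⟨w, by rw [Finset.mem_filter]; exact ⟨hw, hzw⟩, hwj⟩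
    have h2 := (Finset.card_le_card h1).trans Finset.card_image_le
    rw [Finset.filter_erase, Finset.card_erase_of_mem (by
      rw [Finset.mem_filter]; exact ⟨hy₁, hadj1.symm⟩)] at h2
    have h3 := hsolq z hz hzT y₁ hy₁ hs1
    have h4 : 1 ≤ nbc H B z := nbc_pos hy₁ hadj1.symm
    unfold nbc at h3 h4
    omega
  rw [Finset.mem_sdiff] at hj
  set f2 := Function.update f y₁ W with hf2
  have hf2y : f2 y₁ = W := by simp [hf2]
  have hf2o : ∀ v, v ≠ y₁ → f2 v = f v := by
    intro v h1; simp [hf2, h1]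
  have hf2A : ∀ v ∈ U \ B.erase y₁, f2 v ∈ A := by
    intro v hv
    rw [Finset.mem_sdiff] at hv
    by_cases h1 : v = y₁
    · rw [h1, hf2y]; exact hzA
    · rw [hf2o v h1]
      by_contra h3
      exact hv.2 (by simp [h1, hmB, hv.1, h3])
  have hf2B : ∀ v ∈ B.erase y₁, f2 v ∉ A := by
    intro v hv
    rw [Finset.mem_erase, hmB] at hv
    rw [hf2o v hv.1]
    exact hv.2.2
  set f3 := merge (B.erase y₁) g f2 with hf3
  have hf3p : Proper H (U.erase z) f3 := by
    apply merge_proper (A := A) _ hgp _ hgA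
    · apply proper_update
      · intro v hv w hw
        simp only [Finset.mem_erase, Finset.mem_sdiff] at hv hw
        exact hfp v hv.2.1.2 w hw.2.1.2
      · intro w hw hwy hwW
        simp only [Finset.mem_erase, Finset.mem_sdiff] at hw
        exact hysolo y₁ hs1 w hw.1.2 hwW hw.1.1
    · intro v hv
      apply hf2A
      simp only [Finset.mem_erase, Finset.mem_sdiff] at hv ⊢
      exact ⟨hv.1.2, hv.2⟩
  have hf3B : ∀ v ∈ B.erase y₁, f3 v = g v := by
    intro v hv; simp only [hf3, merge]; rw [if_pos hv]
  have hf3o : ∀ v, v ∉ B.erase y₁ → f3 v = f2 v := by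
    intro v hv; simp only [hf3, merge]; rw [if_neg hv]
  have hzB' : z ∉ B.erase y₁ := fun h => hzB (Finset.mem_of_mem_erase h)
  have hf3z : f3 z = W := by
    rw [hf3o z hzB', hf2o z hyz'.symm]
  set f4 := Function.update f3 z j with hf4
  have hf4z : f4 z = j := by simp [hf4]
  have hf4o : ∀ v, v ≠ z → f4 v = f3 v := by intro v h; simp [hf4, h]
  have hNE : NE H U K s f4 a j := by
    refine ⟨haK, hj.1, ?_, proper_update z hf3p j ?_, ?_⟩
    · intro v hv
      by_cases h1 : v = z
      · rw [h1, hf4z]; exact hj.1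
      · rw [hf4o v h1]
        by_cases h2 : v ∈ B.erase y₁
        · rw [hf3B v h2]; exact Finset.sdiff_subset (hgK v h2)
        · rw [hf3o v h2]; exact hAK (hf2A v (by rw [Finset.mem_sdiff]; exact ⟨hv, h2⟩))
    · intro w hw hwz hwj
      by_cases h2 : w ∈ B.erase y₁
      · exact hj0 w h2 (by rw [← hf3B w h2]; exact hwj)
      · exfalso
        rw [hf3o w h2] at hwj
        exact hj.2 (hwj ▸ hf2A w (by rw [Finset.mem_sdiff]; exact ⟨hw, h2⟩))
    · intro l hl
      have h1 := card_cl_update U f3 z hz j l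
      rw [hf3z, ← hf4] at h1
      by_cases hlA : l ∈ A
      · have h2 : (cl U f3 l).card = (cl U f2 l).card := by rw [hf3, merge_cl_mem hf2B hgA hlA]
        have h3 := card_cl_update U f y₁ hyU W l
        rw [if_neg (fun h : l = f y₁ => hyA (h ▸ hlA)), ← hf2] at h3
        have h4 := hclA l hlA
        rw [if_neg (fun h : l = j => hj.2 (h ▸ hlA))] at h1 ⊢
        omega
      · have h2 : (cl U f3 l).card = s := by
          rw [hf3, merge_cl_notMem ((Finset.erase_subset _ _).trans hBU) hf2A hlA]
          exact hgc l (by simp [hl, hlA])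
        rw [if_neg (fun h : l = W => hlA (h ▸ hzA))] at h1
        rw [if_neg (fun h : l = a => hlA (h ▸ haA))]
        omega
  have hsame : ∀ i ∈ A, i ≠ W → ∀ v ∈ U, (f4 v = i ↔ f v = i) := by
    intro i hi hiW v hv
    by_cases h1 : v = z
    · rw [h1, hf4z]
      exact iff_of_false (fun h => hj.2 (h ▸ hi)) (fun h => hiW h.symm)
    · rw [hf4o v h1]
      by_cases h2 : v ∈ B.erase y₁
      · rw [hf3B v h2]
        exact iff_of_false (fun h => hgA v h2 (h ▸ hi))
          (fun h => (hmB.1 (Finset.mem_of_mem_erase h2)).2 (h ▸ hi))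
      · rw [hf3o v h2]
        by_cases h3 : v = y₁
        · rw [h3, hf2y]
          exact iff_of_false (fun h => hiW h.symm) (fun h => hyA (h ▸ hi))
        · rw [hf2o v h3]
  have htrans : ∀ P i, Reach (Mov H U f) a P i → P ⊆ K.erase W → Reach (Mov H U f4) a P i := by
    intro P i h
    induction h with
    | base P h => exact fun _ => .base P h
    | step P i l hi hM hl ih =>
      intro hP
      have hiR : Reach (Mov H U f) a P i := .step P i l hi hM hl
      have hP' : P ⊆ K := hP.trans (Finset.erase_subset _ _)
      have hiA : i ∈ A := (hA i).2 (hiR.mono _ hP')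
      have hlA : l ∈ A := (hA l).2 (hl.mono _ ((Finset.erase_subset _ _).trans hP'))
      have hiW : i ≠ W := (Finset.mem_erase.1 (hP hi)).1
      have hlW : l ≠ W := (Finset.mem_erase.1 (hP (Finset.mem_of_mem_erase hl.mem))).1
      refine .step P i l hi ?_ (ih ((Finset.erase_subset _ _).trans hP))
      obtain ⟨v, hv, hvi, hvn⟩ := hM
      exact ⟨v, hv, (hsame i hiA hiW v hv).2 hvi,
        fun w hw hwl => hvn w hw ((hsame l hlA hlW w hw).1 hwl)⟩
  have hReachA : ∀ i ∈ A, i ≠ W → Reach (Mov H U f4) a (K.erase W) i := by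
    intro i hi hiW
    exact htrans _ _ (hterm W hzT i hi hiW) (Finset.Subset.refl _)
  have hWa : W ≠ a := fun h => haT (h ▸ hzT)
  have hReachW : Reach (Mov H U f4) a K W := by
    obtain ⟨l, hi, hM, hl⟩ := ((hA W).1 hzA).cases' hWa
    · have hlA : l ∈ A := (hA l).2 (hl.mono _ (Finset.erase_subset _ _))
      have hlW : l ≠ W := (Finset.mem_erase.1 hl.mem).1
      refine .step _ _ l hi ?_ (hReachA l hlA hlW)
      obtain ⟨v, hv, hvi, hvn⟩ := hM
      have hvz : v ≠ z := by
        rintro rfl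
        have h1 := hsol v hz hzT y₁ hy₁ hs1 l hlA hlW
        unfold nbc at h1
        obtain ⟨w, hw⟩ := Finset.card_pos.1 h1
        simp only [cl, Finset.mem_filter] at hw
        exact hvn w hw.1.1 hw.1.2 hw.2
      refine ⟨v, hv, ?_, fun w hw hwl => hvn w hw ((hsame l hlA hlW w hw).1 hwl)⟩
      have hvB : v ∉ B := fun h => (hmB.1 h).2 (hvi ▸ hzA)
      rw [hf4o v hvz, hf3o v (fun h => hvB (Finset.mem_of_mem_erase h)),
        hf2o v (fun h => hvB (h ▸ hy₁)), hvi]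
  have hy2B : y₂ ∈ B.erase y₁ := Finset.mem_erase.2 ⟨hyne.symm, hy₂⟩
  have hy2z : y₂ ≠ z := fun h => hzB (h ▸ hy₂)
  have hf4y2 : f4 y₂ = g y₂ := by rw [hf4o _ hy2z, hf3B _ hy2B]
  have hReachY : Reach (Mov H U f4) a K (g y₂) := by
    refine hReachW.cons (Finset.sdiff_subset (hgK _ hy2B)) ⟨y₂, hBU hy₂, hf4y2, ?_⟩
    intro w hw hwW
    by_cases h1 : w = z
    · rw [h1, hf4z] at hwW
      exact absurd (hwW ▸ hzA) hj.2
    · rw [hf4o w h1] at hwW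
      by_cases h2 : w ∈ B.erase y₁
      · rw [hf3B w h2] at hwW
        exact absurd (hwW ▸ hzA) (hgA w h2)
      · rw [hf3o w h2] at hwW
        by_cases h3 : w = y₁
        · rw [h3]; exact fun h => hynadj h.symm
        · rw [hf2o w h3] at hwW
          exact hysolo y₂ hs2 w hw hwW h1
  have hlt : A.card < (acc H U K f4 a).card := by
    apply Finset.card_lt_card
    rw [Finset.ssubset_iff_of_subset]
    · refine ⟨g y₂, ?_, hgA _ hy2B⟩
      simp only [acc, Finset.mem_filter]
      exact ⟨hReachY.mem, hReachY⟩
    · intro i hi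
      simp only [acc, Finset.mem_filter]
      refine ⟨hAK hi, ?_⟩
      by_cases h : i = W
      · rw [h]; exact hReachW
      · exact (hReachA i hi h).mono _ (Finset.erase_subset _ _)
  have hle : (acc H U K f4 a).card ≤ K.card := Finset.card_le_card (Finset.filter_subset _ _)
  exact ihd (K.card - (acc H U K f4 a).card) (by omega) f4 a j hNE rfl

end
end CH

namespace CH
section
open scoped Classical
variable {V : Type*}

theorem exists_part (s : ℕ) (K : Finset ℕ) : ∀ U : Finset V, U.card = K.card * s →
    ∃ f : V → ℕ, (∀ v ∈ U, f v ∈ K) ∧ ∀ i ∈ K, (cl U f i).card = s := by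
  induction K using Finset.induction_on with
  | empty =>
    intro U hU
    have : U = ∅ := by simpa using hU
    subst this
    exact ⟨fun _ => 0, by simp, by simp⟩
  | insert i K hi ih =>
    intro U hU
    rw [Finset.card_insert_of_notMem hi, add_mul, one_mul] at hU
    obtain ⟨S, hSU, hS⟩ := Finset.exists_subset_card_eq (s := U) (n := s) (by omega)
    obtain ⟨f, hf, hc⟩ := ih (U \ S) (by
      have := Finset.card_sdiff_add_card_eq_card hSU
      omega)
    refine ⟨fun v => if v ∈ S then i else f v, ?_, ?_⟩
    · intro v hv
      by_cases h : v ∈ S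
      · simp [h]
      · simp [h, hf v (by simp [h, hv])]
    · intro l hl
      by_cases hli : l = i
      · subst hli
        rw [← hS]
        congr 1
        ext v
        simp only [cl, Finset.mem_filter]
        constructor
        · rintro ⟨h1, h2⟩
          by_contra h
          rw [if_neg h] at h2
          exact hi (h2 ▸ hf v (by simp [h, h1]))
        · intro h
          exact ⟨hSU h, by simp [h]⟩
      · rw [← hc l (Finset.mem_of_mem_insert_of_ne hl hli)]
        congr 1
        ext v
        simp only [cl, Finset.mem_filter, Finset.mem_sdiff]
        constructor
        · rintro ⟨h1, h2⟩
          by_cases h : v ∈ S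
          · rw [if_pos h] at h2; exact absurd h2.symm hli
          · rw [if_neg h] at h2; exact ⟨⟨h1, h⟩, h2⟩
        · rintro ⟨⟨h1, h⟩, h2⟩
          exact ⟨h1, by simp [h, h2]⟩

def restr (H : SimpleGraph V) (W : Finset V) : SimpleGraph V where
  Adj u v := H.Adj u v ∧ u ∈ W ∧ v ∈ W
  symm := ⟨fun _ _ h => ⟨h.1.symm, h.2.2, h.2.1⟩⟩
  loopless := ⟨fun _ h => h.1.ne rfl⟩

theorem HS (s : ℕ) : ∀ (n : ℕ) (H : SimpleGraph V) (U : Finset V) (K : Finset ℕ), K.card = n →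
    U.card = K.card * s → (∀ v ∈ U, nbc H U v + 1 ≤ K.card) → ∃ f, Equit H U K s f := by
  intro n
  induction n using Nat.strong_induction_on with
  | _ n ih =>
  intro H U K hK hU hdeg
  have key : ∀ W : Finset V, W ⊆ U → ∃ f, Equit (restr H W) U K s f := by
    intro W
    induction W using Finset.induction_on with
    | empty =>
      intro _
      obtain ⟨f, hf, hc⟩ := exists_part s K U hU
      exact ⟨f, hf, fun v _ w _ h => by simp [restr] at h, hc⟩
    | insert v W hv ihW =>
      intro hW
      have hvU : v ∈ U := hW (Finset.mem_insert_self _ _)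
      obtain ⟨f, hf, hp, hc⟩ := ihW ((Finset.subset_insert _ _).trans hW)
      have hdeg' : ∀ u ∈ U, nbc (restr H (insert v W)) U u + 1 ≤ K.card := by
        intro u hu
        refine le_trans ?_ (hdeg u hu)
        have : nbc (restr H (insert v W)) U u ≤ nbc H U u := by
          apply Finset.card_le_card
          intro w hw
          simp only [Finset.mem_filter] at hw ⊢
          exact ⟨hw.1, hw.2.1⟩
        omega
      have hex : ∃ c ∈ K, nbc (restr H (insert v W)) (cl U f c) v = 0 := by
        by_contra hno
        push Not at hno
        have h1 := nbc_fiber (restr H (insert v W)) U f K v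
        have h2 : K.card ≤ ∑ i ∈ K, nbc (restr H (insert v W)) (cl U f i) v := by
          rw [Finset.card_eq_sum_ones]
          exact Finset.sum_le_sum (fun i hi => Nat.one_le_iff_ne_zero.2 (hno i hi))
        have := hdeg' v hvU
        omega
      obtain ⟨c, hcK, hc0⟩ := hex
      refine ne_main (restr H (insert v W)) U K s hdeg' ?_ _ (Function.update f v c) (f v) c ?_ rfl
      · intro K' U' hlt hU' hd
        exact ih K'.card (hK ▸ hlt) _ U' K' rfl hU' hd
      · refine ⟨hf v hvU, hcK, ?_, ?_, ?_⟩
        · intro u hu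
          by_cases h : u = v
          · subst h; simpa using hcK
          · rw [Function.update_of_ne h]; exact hf u hu
        · apply proper_update
          · intro x hx y hy hxy
            rw [Finset.mem_erase] at hx hy
            apply hp x hx.2 y hy.2
            refine ⟨hxy.1, ?_, ?_⟩
            · exact Finset.mem_of_mem_insert_of_ne hxy.2.1 hx.1
            · exact Finset.mem_of_mem_insert_of_ne hxy.2.2 hy.1
          · intro w hw _ hwc
            exact nbc_eq_zero hc0 w (by simp [cl, hw, hwc])
        · intro l hl
          rw [card_cl_update U f v hvU c l, hc l hl]
  obtain ⟨f, hf, hp, hc⟩ := key U (Finset.Subset.refl _)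
  exact ⟨f, hf, fun v hv w hw h => hp v hv w hw ⟨h, hv, hw⟩, hc⟩

end
end CH

namespace CH
section
open scoped Classical
variable {V : Type*}

def Core (G : SimpleGraph V) (T : Finset V) : Prop := T.Nonempty ∧ ∀ v ∈ T, 2 ≤ nbc G T v

noncomputable def ds (G : SimpleGraph V) (U : Finset V) : ℕ := ∑ v ∈ U, nbc G U v

noncomputable def ad (G : SimpleGraph V) (u v : V) : ℕ := if G.Adj u v then 1 else 0

theorem ad_le (G : SimpleGraph V) (u v : V) : ad G u v ≤ 1 := by unfold ad; split_ifs <;> omega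

theorem ad_comm (G : SimpleGraph V) (u v : V) : ad G u v = ad G v u := by
  unfold ad; simp only [G.adj_comm]

theorem ad_pos {G : SimpleGraph V} {u v : V} : 1 ≤ ad G u v ↔ G.Adj u v := by
  unfold ad; split_ifs <;> simp_all

theorem ad_one {G : SimpleGraph V} {u v : V} (h : G.Adj u v) : ad G u v = 1 := if_pos h

theorem nbc_sum (G : SimpleGraph V) (U : Finset V) (w : V) : nbc G U w = ∑ v ∈ U, ad G w v := by
  unfold nbc ad; rw [Finset.card_filter]

theorem nbc_le_card (G : SimpleGraph V) (U : Finset V) (w : V) : nbc G U w ≤ U.card :=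
  Finset.card_filter_le _ _

theorem nbc_erase (G : SimpleGraph V) {U : Finset V} {v : V} (h : v ∈ U) (w : V) :
    nbc G U w = nbc G (U.erase v) w + ad G w v := by
  rw [nbc_sum, nbc_sum, Finset.sum_erase_add _ _ h]

theorem nbc_insert (G : SimpleGraph V) {U : Finset V} {v : V} (h : v ∉ U) (w : V) :
    nbc G (insert v U) w = nbc G U w + ad G w v := by
  rw [nbc_sum, nbc_sum, Finset.sum_insert h, add_comm]

theorem nbc_erase_self (G : SimpleGraph V) (U : Finset V) (v : V) :
    nbc G (U.erase v) v = nbc G U v := by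
  by_cases h : v ∈ U
  · rw [nbc_erase G h]; simp [ad]
  · rw [Finset.erase_eq_of_notMem h]

theorem nbc_union (G : SimpleGraph V) {X Y : Finset V} (h : Disjoint X Y) (w : V) :
    nbc G (X ∪ Y) w = nbc G X w + nbc G Y w := by
  rw [nbc_sum, nbc_sum, nbc_sum, Finset.sum_union h]

theorem nbc_single (G : SimpleGraph V) (X : Finset V) (v : V) :
    ∑ w ∈ X, ad G w v = nbc G X v := by
  rw [nbc_sum]; exact Finset.sum_congr rfl (fun w _ => ad_comm G w v)

theorem ds_erase (G : SimpleGraph V) {U : Finset V} {v : V} (h : v ∈ U) :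
    ds G U = ds G (U.erase v) + 2 * nbc G U v := by
  unfold ds
  rw [← Finset.sum_erase_add _ _ h]
  simp_rw [nbc_erase G h]
  rw [Finset.sum_add_distrib, nbc_single, nbc_erase_self]
  have := nbc_erase_self G U v
  rw [nbc_erase G h] at this
  omega

theorem ds_insert (G : SimpleGraph V) {U : Finset V} {v : V} (h : v ∉ U) :
    ds G (insert v U) = ds G U + 2 * nbc G U v := by
  rw [ds_erase G (Finset.mem_insert_self v U), Finset.erase_insert h, ← nbc_erase_self G (insert v U),
    Finset.erase_insert h]

theorem ds_union (G : SimpleGraph V) {X Y : Finset V} (h : Disjoint X Y) :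
    ds G (X ∪ Y) = ds G X + ds G Y + 2 * ∑ x ∈ X, nbc G Y x := by
  unfold ds
  rw [Finset.sum_union h]
  simp_rw [nbc_union G h]
  rw [Finset.sum_add_distrib, Finset.sum_add_distrib, nbc_comm G Y X]
  omega

theorem ds_even (G : SimpleGraph V) (U : Finset V) : ∃ m, ds G U = 2 * m := by
  induction U using Finset.induction_on with
  | empty => exact ⟨0, by simp [ds]⟩
  | insert v U hv ih =>
    obtain ⟨m, hm⟩ := ih
    exact ⟨m + nbc G U v, by rw [ds_insert G hv]; omega⟩

theorem Core.ds {G : SimpleGraph V} {T : Finset V} (h : Core G T) : 2 * T.card ≤ ds G T := by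
  unfold CH.ds
  rw [mul_comm, ← smul_eq_mul, ← Finset.sum_const]
  exact Finset.sum_le_sum h.2

theorem erase_nonempty_of {G : SimpleGraph V} {U : Finset V} {v : V} (hv : v ∈ U)
    (h : 2 * U.card ≤ ds G U) : (U.erase v).Nonempty := by
  rw [Finset.nonempty_iff_ne_empty]
  intro h0
  rw [ds_erase G hv, ← nbc_erase_self, h0] at h
  have := Finset.card_pos.2 ⟨v, hv⟩
  simp [CH.ds, nbc] at h
  simp [h] at hv

theorem X1 {G : SimpleGraph V} : ∀ (n : ℕ) (U : Finset V), U.card = n → U.Nonempty →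
    2 * U.card ≤ ds G U → ∃ T ⊆ U, Core G T := by
  intro n
  induction n with
  | zero =>
    intro U h hne
    have := Finset.card_pos.2 hne
    omega
  | succ n ih =>
    intro U h hne hd
    by_cases hc : ∀ v ∈ U, 2 ≤ nbc G U v
    · exact ⟨U, Finset.Subset.refl _, hne, hc⟩
    · push Not at hc
      obtain ⟨v, hv, h1⟩ := hc
      have he := Finset.card_erase_add_one hv
      have h2 := ds_erase G hv
      obtain ⟨T, hT, hC⟩ := ih (U.erase v) (by omega) (erase_nonempty_of hv hd) (by omega)
      exact ⟨T, hT.trans (Finset.erase_subset _ _), hC⟩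

theorem X1' {G : SimpleGraph V} (U : Finset V) (hne : U.Nonempty)
    (h : 2 * U.card ≤ ds G U) : ∃ T ⊆ U, Core G T := X1 _ U rfl hne h

theorem X2 {G : SimpleGraph V} (U : Finset V) (hne : U.Nonempty)
    (h : 2 * U.card + 2 ≤ ds G U) : ∃ T ⊆ U, Core G T ∧ T.card < U.card := by
  have key : ∃ v ∈ U, ∃ T ⊆ U.erase v, Core G T := by
    by_cases hc : ∃ v ∈ U, nbc G U v ≤ 2
    · obtain ⟨v, hv, h1⟩ := hc
      have he := Finset.card_erase_add_one hv
      have h2 := ds_erase G hv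
      exact ⟨v, hv, X1' (G := G) (U.erase v) (erase_nonempty_of (G := G) hv (by omega)) (by omega)⟩
    · push Not at hc
      obtain ⟨v, hv⟩ := hne
      refine ⟨v, hv, U.erase v, Finset.Subset.refl _, erase_nonempty_of (G := G) hv (by omega), ?_⟩
      intro w hw
      have h1 := hc w (Finset.mem_of_mem_erase hw)
      have h2 := nbc_erase G hv w
      have h3 := ad_le G w v
      omega
  obtain ⟨v, hv, T, hT, hC⟩ := key
  refine ⟨T, hT.trans (Finset.erase_subset _ _), hC, ?_⟩
  have := Finset.card_le_card hT
  have := Finset.card_erase_add_one hv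
  omega

theorem core_two {G : SimpleGraph V} {C : Finset V} (hC : Core G C)
    (h : ∀ T ⊆ C, Core G T → C.card ≤ T.card) : ∀ v ∈ C, nbc G C v = 2 := by
  by_contra hcon
  push Not at hcon
  obtain ⟨v, hv, hne⟩ := hcon
  have h1 : ∑ v ∈ C, 2 < ds G C :=
    Finset.sum_lt_sum hC.2 ⟨v, hv, by have := hC.2 v hv; omega⟩
  obtain ⟨m, hm⟩ := ds_even G C
  simp at h1
  obtain ⟨T, hT, hTC, hlt⟩ := X2 (G := G) C hC.1 (by omega)
  have := h T hT hTC
  omega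

theorem ds_two {G : SimpleGraph V} {C : Finset V} (h : ∀ v ∈ C, nbc G C v = 2) :
    ds G C = 2 * C.card := by
  unfold ds
  rw [Finset.sum_congr rfl h]; simp [mul_comm]

theorem core_tri {G : SimpleGraph V} {a b c : V} (hab : G.Adj a b) (hbc : G.Adj b c)
    (hac : G.Adj a c) : Core G {a, b, c} ∧ ({a, b, c} : Finset V).card = 3 := by
  have h1 := hab.ne
  have h2 := hbc.ne
  have h3 := hac.ne
  have hs : ∀ v, nbc G {a, b, c} v = ad G v a + (ad G v b + ad G v c) := by
    intro v
    rw [nbc_sum, Finset.sum_insert (by simp [h1, h3]), Finset.sum_insert (by simp [h2]),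
      Finset.sum_singleton]
  refine ⟨⟨⟨a, by simp⟩, ?_⟩, Finset.card_eq_three.2 ⟨a, b, c, h1, h3, h2, rfl⟩⟩
  have e1 := ad_one hab
  have e2 := ad_one hbc
  have e3 := ad_one hac
  have e1' := ad_one hab.symm
  have e2' := ad_one hbc.symm
  have e3' := ad_one hac.symm
  intro v hv
  rw [hs]
  simp only [Finset.mem_insert, Finset.mem_singleton] at hv
  rcases hv with rfl | rfl | rfl <;> omega

theorem adj_all {G : SimpleGraph V} {X : Finset V} {v : V} (h : X.card ≤ nbc G X v) :
    ∀ u ∈ X, G.Adj v u := by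
  intro u hu
  have := Finset.eq_of_subset_of_card_le (Finset.filter_subset (G.Adj v) X) h
  rw [← this] at hu
  exact (Finset.mem_filter.1 hu).2

theorem F2 {G : SimpleGraph V} {C : Finset V} (hC : Core G C) (h2 : ∀ v ∈ C, nbc G C v = 2)
    (v : V) (hv : v ∉ C) (hmin : ∀ T ⊆ insert v C, Core G T → C.card ≤ T.card)
    (h4 : 4 ≤ C.card) : nbc G C v ≤ 2 := by
  by_contra hcon
  have hU := Finset.card_insert_of_notMem hv
  have hd := ds_insert G hv
  have hdC := ds_two h2
  by_cases hex : ∃ u ∈ insert v C, nbc G (insert v C) u ≤ 2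
  · obtain ⟨u, hu, hu2⟩ := hex
    have he := Finset.card_erase_add_one hu
    have hde := ds_erase G hu
    obtain ⟨T, hT, hTC, hlt⟩ := X2 (G := G) ((insert v C).erase u) (erase_nonempty_of (G := G) hu (by omega)) (by omega)
    have := hmin T (hT.trans (Finset.erase_subset _ _)) hTC
    omega
  · push Not at hex
    have hadj : ∀ u ∈ C, G.Adj u v := by
      intro u hu
      have h1 := hex u (by simp [hu])
      rw [nbc_insert G hv, h2 u hu] at h1
      exact ad_pos.1 (by omega)
    obtain ⟨u, hu⟩ := hC.1
    have : 0 < (C.filter (G.Adj u)).card := by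
      have := h2 u hu
      unfold nbc at this; omega
    obtain ⟨w, hw⟩ := Finset.card_pos.1 this
    rw [Finset.mem_filter] at hw
    obtain ⟨hc, h3⟩ := core_tri hw.2 (hadj w hw.1) (hadj u hu)
    have := hmin _ (by
      intro x hx
      simp only [Finset.mem_insert, Finset.mem_singleton] at hx ⊢
      rcases hx with rfl | rfl | rfl
      · exact Or.inr hu
      · exact Or.inr hw.1
      · exact Or.inl rfl) hc
    omega

theorem pairA {G : SimpleGraph V} {D C : Finset V} (hdis : Disjoint D C)
    (hD : ∀ v ∈ D, nbc G D v = 2) (hC : ∀ v ∈ C, nbc G C v = 2)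
    (M : ∀ T₁ T₂, T₁ ⊆ D ∪ C → T₂ ⊆ D ∪ C → Core G T₁ → Core G T₂ → Disjoint T₁ T₂ →
      D.card + C.card ≤ T₁.card + T₂.card)
    {d c : V} (hd : d ∈ D) (hc : c ∈ C) (h3 : 3 ≤ nbc G C d) :
    nbc G (D.erase d) c ≤ 2 ∧ (nbc G (D.erase d) c = 2 → Core G (insert c (D.erase d))) := by
  have hdC : d ∉ C := Finset.disjoint_left.1 hdis hd
  have hcD : c ∉ D := Finset.disjoint_right.1 hdis hc
  have hdC' : d ∉ C.erase c := fun h => hdC (Finset.mem_of_mem_erase h)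
  have hcD' : c ∉ D.erase d := fun h => hcD (Finset.mem_of_mem_erase h)
  have e1 := Finset.card_erase_add_one hc
  have e2 := Finset.card_erase_add_one hd
  have e3 := Finset.card_insert_of_notMem hdC'
  have e4 := Finset.card_insert_of_notMem hcD'
  have f1 := ds_insert G hdC'
  have f2 := ds_insert G hcD'
  have g1 := ds_erase G hc
  have g2 := ds_erase G hd
  rw [hC c hc, ds_two hC] at g1
  rw [hD d hd, ds_two hD] at g2
  have k1 := nbc_erase G hc d
  have k2 := ad_le G d c
  obtain ⟨S, hS, hSC⟩ := X1' (G := G) (insert d (C.erase c)) (Finset.insert_nonempty _ _) (by omega)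
  have hSc := Finset.card_le_card hS
  have hdisj : Disjoint (insert c (D.erase d)) (insert d (C.erase c)) := by
    rw [Finset.disjoint_left]
    intro x hx hx'
    rw [Finset.mem_insert, Finset.mem_erase] at hx hx'
    rcases hx with rfl | hx <;> rcases hx' with rfl | hx'
    · exact hcD hd
    · exact hx'.1 rfl
    · exact hx.1 rfl
    · exact Finset.disjoint_left.1 hdis hx.2 hx'.2
  have hs1 : insert c (D.erase d) ⊆ D ∪ C := by
    intro x hx
    rw [Finset.mem_insert, Finset.mem_erase] at hx
    rw [Finset.mem_union]
    rcases hx with rfl | hx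
    · exact Or.inr hc
    · exact Or.inl hx.2
  have hs2 : insert d (C.erase c) ⊆ D ∪ C := by
    intro x hx
    rw [Finset.mem_insert, Finset.mem_erase] at hx
    rw [Finset.mem_union]
    rcases hx with rfl | hx
    · exact Or.inl hd
    · exact Or.inr hx.2
  have main : ∀ T ⊆ insert c (D.erase d), Core G T → D.card ≤ T.card := by
    intro T hT hTC
    have := M T S (hT.trans hs1) (hS.trans hs2) hTC hSC
      (Finset.disjoint_of_subset_left hT (Finset.disjoint_of_subset_right hS hdisj))
    omega
  constructor
  · by_contra hcon
    obtain ⟨T, hT, hTC, hlt⟩ := X2 (G := G) (insert c (D.erase d)) (Finset.insert_nonempty _ _) (by omega)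
    have := main T hT hTC
    omega
  · intro h
    obtain ⟨T, hT, hTC⟩ := X1' (G := G) (insert c (D.erase d)) (Finset.insert_nonempty _ _) (by omega)
    have := main T hT hTC
    rw [← Finset.eq_of_subset_of_card_le hT (by omega)]
    exact hTC

theorem pair {G : SimpleGraph V} {D C : Finset V} (hdis : Disjoint D C)
    (hD : ∀ v ∈ D, nbc G D v = 2) (hC : ∀ v ∈ C, nbc G C v = 2)
    (M : ∀ T₁ T₂, T₁ ⊆ D ∪ C → T₂ ⊆ D ∪ C → Core G T₁ → Core G T₂ → Disjoint T₁ T₂ →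
      D.card + C.card ≤ T₁.card + T₂.card) (hle : C.card ≤ D.card) (h4 : 4 ≤ D.card) :
    ∑ d ∈ D, nbc G C d ≤ 2 * D.card := by
  by_contra hcon
  push Not at hcon
  obtain ⟨d₀, hd₀, hd3⟩ : ∃ d ∈ D, 3 ≤ nbc G C d := by
    by_contra h
    push Not at h
    have : ∑ d ∈ D, nbc G C d ≤ ∑ d ∈ D, 2 :=
      Finset.sum_le_sum (fun d hd => by have := h d hd; omega)
    simp at this
    omega
  obtain ⟨c₀, hc₀, hc3⟩ : ∃ c ∈ C, 3 ≤ nbc G D c := by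
    by_contra h
    push Not at h
    rw [nbc_comm] at hcon
    have : ∑ d ∈ C, nbc G D d ≤ ∑ d ∈ C, 2 :=
      Finset.sum_le_sum (fun d hd => by have := h d hd; omega)
    simp at this
    omega
  have hC0 : Core G C := ⟨⟨c₀, hc₀⟩, fun v hv => (hC v hv).ge⟩
  have M' : ∀ T₁ T₂, T₁ ⊆ C ∪ D → T₂ ⊆ C ∪ D → Core G T₁ → Core G T₂ → Disjoint T₁ T₂ →
      C.card + D.card ≤ T₁.card + T₂.card := by
    rw [Finset.union_comm, add_comm]; exact M
  -- property of high d
  have high : ∀ d ∈ D, 3 ≤ nbc G C d → nbc G D c₀ = 3 ∧ G.Adj c₀ d ∧ ∀ d' ∈ D, G.Adj d d' → G.Adj c₀ d' := by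
    intro d hd h3
    obtain ⟨h1, h2⟩ := pairA hdis hD hC M hd hc₀ h3
    have h5 := nbc_erase G hd c₀
    have h6 := ad_le G c₀ d
    have hcore := h2 (by omega)
    refine ⟨by omega, ad_pos.1 (by omega), ?_⟩
    intro d' hd' hadj
    have h7 := hcore.2 d' (by simp [hd', hadj.ne'])
    have hcD : c₀ ∉ D.erase d := fun h => Finset.disjoint_right.1 hdis hc₀ (Finset.mem_of_mem_erase h)
    rw [nbc_insert G hcD] at h7
    have h8 := nbc_erase G hd d'
    rw [hD d' hd', ad_one hadj.symm] at h8
    exact (ad_pos.1 (by omega)).symm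
  obtain ⟨hc33, hadj0, hnb0⟩ := high d₀ hd₀ hd3
  have hd33 : nbc G C d₀ = 3 := by
    have h1 := (pairA hdis.symm hC hD M' hc₀ hd₀ hc3).1
    have h5 := nbc_erase G hc₀ d₀
    have h6 := ad_le G d₀ c₀
    omega
  obtain ⟨d₁, d₂, h12, hN⟩ := Finset.card_eq_two.1 (hD d₀ hd₀)
  have hm1 : d₁ ∈ D.filter (G.Adj d₀) := by rw [hN]; simp
  have hm2 : d₂ ∈ D.filter (G.Adj d₀) := by rw [hN]; simp
  rw [Finset.mem_filter] at hm1 hm2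
  have hc1 := hnb0 d₁ hm1.1 hm1.2
  have hc2 := hnb0 d₂ hm2.1 hm2.2
  have hN3 : D.filter (G.Adj c₀) = {d₀, d₁, d₂} := by
    symm
    apply Finset.eq_of_subset_of_card_le
    · intro x hx
      simp only [Finset.mem_insert, Finset.mem_singleton] at hx
      rw [Finset.mem_filter]
      rcases hx with rfl | rfl | rfl
      · exact ⟨hd₀, hadj0⟩
      · exact ⟨hm1.1, hc1⟩
      · exact ⟨hm2.1, hc2⟩
    · have : (D.filter (G.Adj c₀)).card = 3 := hc33
      rw [this]
      exact (Finset.card_eq_three.2 ⟨d₀, d₁, d₂, hm1.2.ne, hm2.2.ne, h12, rfl⟩).ge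
  have hd1 : nbc G C d₁ ≤ 2 := by
    by_contra hcon2
    obtain ⟨-, -, hnb1⟩ := high d₁ hm1.1 (by omega)
    have h1 := nbc_erase G hd₀ d₁
    rw [hD d₁ hm1.1, ad_one hm1.2.symm] at h1
    have h2 : 0 < ((D.erase d₀).filter (G.Adj d₁)).card := by
      unfold nbc at h1; omega
    obtain ⟨x, hx⟩ := Finset.card_pos.1 h2
    rw [Finset.mem_filter, Finset.mem_erase] at hx
    have h3 := hnb1 x hx.1.2 hx.2
    have h4 : x ∈ D.filter (G.Adj c₀) := by simp [hx.1.2, h3]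
    rw [hN3] at h4
    simp only [Finset.mem_insert, Finset.mem_singleton] at h4
    rcases h4 with rfl | rfl | rfl
    · exact hx.1.1 rfl
    · exact hx.2.ne rfl
    · obtain ⟨hcore, hcard⟩ := core_tri hm1.2 hx.2 hm2.2
      have hsub : ({d₀, d₁, x} : Finset V) ⊆ D := by
        intro y hy
        simp only [Finset.mem_insert, Finset.mem_singleton] at hy
        rcases hy with rfl | rfl | rfl
        · exact hd₀
        · exact hm1.1
        · exact hm2.1
      have := M _ C (hsub.trans Finset.subset_union_left) Finset.subset_union_right hcore hC0
        (Finset.disjoint_of_subset_left hsub hdis)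
      omega
  have hd1m : d₁ ∈ D.erase d₀ := by simp [hm1.1, hm1.2.ne']
  set D' := (D.erase d₀).erase d₁ with hD'
  set C' := C.erase c₀ with hC'
  have hD'D : D' ⊆ D := (Finset.erase_subset _ _).trans (Finset.erase_subset _ _)
  have hC'C : C' ⊆ C := Finset.erase_subset _ _
  have hdis' : Disjoint D' C' :=
    Finset.disjoint_of_subset_left hD'D (Finset.disjoint_of_subset_right hC'C hdis)
  obtain ⟨hcore, hcard⟩ := core_tri hm1.2 hc1.symm hadj0.symm
  have a1 := Finset.card_erase_add_one hd₀
  have a2 := Finset.card_erase_add_one hd1m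
  have a3 := Finset.card_erase_add_one hc₀
  have a4 := Finset.card_union_of_disjoint hdis'
  have b1 := ds_erase G hd₀
  have b2 := ds_erase G hd1m
  have b3 := ds_erase G hc₀
  have b4 := ds_union G hdis'
  rw [ds_two hD, hD d₀ hd₀] at b1
  rw [ds_two hC, hC c₀ hc₀] at b3
  have b5 := nbc_erase G hd₀ d₁
  rw [hD d₁ hm1.1, ad_one hm1.2.symm] at b5
  have s1 := Finset.sum_erase_add D (fun d => nbc G C d) hd₀
  have s2 := Finset.sum_erase_add (D.erase d₀) (fun d => nbc G C d) hd1m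
  have s3 : ∑ d ∈ D', nbc G C d = ∑ d ∈ D', nbc G C' d + nbc G D' c₀ := by
    rw [← nbc_single, ← Finset.sum_add_distrib]
    exact Finset.sum_congr rfl (fun d _ => nbc_erase G hc₀ d)
  have s4 := nbc_erase G hd₀ c₀
  have s5 := nbc_erase G hd1m c₀
  rw [ad_one hadj0] at s4
  rw [ad_one hc1] at s5
  rw [← hD'] at a2 b2 s2 s5
  rw [← hC'] at a3 b3
  have hU1 : 0 < (D' ∪ C').card := by omega
  obtain ⟨T, hT, hTC, hlt⟩ := X2 (G := G) (D' ∪ C') (Finset.card_pos.1 hU1) (by omega)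
  have hfin := M T {d₀, d₁, c₀} (hT.trans (Finset.union_subset_union hD'D hC'C)) (by
    intro y hy
    simp only [Finset.mem_insert, Finset.mem_singleton] at hy
    rw [Finset.mem_union]
    rcases hy with rfl | rfl | rfl
    · exact Or.inl hd₀
    · exact Or.inl hm1.1
    · exact Or.inr hc₀) hTC hcore (by
      apply Finset.disjoint_of_subset_left hT
      rw [Finset.disjoint_right]
      intro y hy hy'
      have hc₀D := Finset.disjoint_right.1 hdis hc₀
      have hd₀C := Finset.disjoint_left.1 hdis hd₀
      have hd₁C := Finset.disjoint_left.1 hdis hm1.1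
      simp only [Finset.mem_insert, Finset.mem_singleton] at hy
      simp only [hD', hC', Finset.mem_union, Finset.mem_erase] at hy'
      rcases hy with rfl | rfl | rfl <;> tauto)
  omega

end
end CH

namespace CH
section
open scoped Classical
variable {V : Type*}

def Pk (G : SimpleGraph V) {j : ℕ} (C : Fin j → Finset V) : Prop :=
  (∀ i, Core G (C i)) ∧ ∀ i l, i ≠ l → Disjoint (C i) (C l)

noncomputable def rest [Fintype V] {j : ℕ} (C : Fin j → Finset V) : Finset V :=
  Finset.univ.filter (fun v => ∀ i, v ∉ C i)

theorem mem_rest [Fintype V] {j : ℕ} {C : Fin j → Finset V} {v : V} :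
    v ∈ rest C ↔ ∀ i, v ∉ C i := by simp [rest]

structure Opt [Fintype V] (G : SimpleGraph V) {j : ℕ} (C : Fin j → Finset V) : Prop where
  pk : Pk G C
  min : ∀ C' : Fin j → Finset V, Pk G C' → ∑ i, (C i).card ≤ ∑ i, (C' i).card
  max : ∀ C' : Fin j → Finset V, Pk G C' → ∑ i, (C' i).card = ∑ i, (C i).card →
    ds G (rest C') ≤ ds G (rest C)
  nocore : ∀ T ⊆ rest C, ¬ Core G T

theorem sum_update {j : ℕ} (C : Fin j → Finset V) (i : Fin j) (T : Finset V) :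
    ∑ l, (Function.update C i T l).card + (C i).card = ∑ l, (C l).card + T.card := by
  rw [← Finset.sum_erase_add _ _ (Finset.mem_univ i),
    ← Finset.sum_erase_add Finset.univ (fun l => (C l).card) (Finset.mem_univ i)]
  have : ∑ l ∈ Finset.univ.erase i, (Function.update C i T l).card
      = ∑ l ∈ Finset.univ.erase i, (C l).card := by
    apply Finset.sum_congr rfl
    intro l hl
    rw [Function.update_of_ne (Finset.ne_of_mem_erase hl)]
  rw [this, Function.update_self]
  omega

theorem pk_update {G : SimpleGraph V} {j : ℕ} {C : Fin j → Finset V} (h : Pk G C) (i : Fin j)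
    {T : Finset V} (hT : Core G T) (hd : ∀ l, l ≠ i → Disjoint T (C l)) :
    Pk G (Function.update C i T) := by
  constructor
  · intro l
    by_cases hl : l = i
    · subst hl; simpa using hT
    · rw [Function.update_of_ne hl]; exact h.1 l
  · intro l m hlm
    by_cases hl : l = i
    · subst hl
      rw [Function.update_self, Function.update_of_ne hlm.symm]
      exact hd m hlm.symm
    · rw [Function.update_of_ne hl]
      by_cases hm : m = i
      · subst hm
        rw [Function.update_self]
        exact (hd l hl).symm
      · rw [Function.update_of_ne hm]
        exact h.2 l m hlm

theorem pk_update2 {G : SimpleGraph V} {j : ℕ} {C : Fin j → Finset V} (h : Pk G C) {i l : Fin j}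
    (hil : i ≠ l) {T₁ T₂ : Finset V} (hT₁ : Core G T₁) (hT₂ : Core G T₂) (h12 : Disjoint T₁ T₂)
    (hd₁ : ∀ m, m ≠ i → m ≠ l → Disjoint T₁ (C m)) (hd₂ : ∀ m, m ≠ i → m ≠ l → Disjoint T₂ (C m)) :
    Pk G (Function.update (Function.update C i T₁) l T₂) := by
  have e1 : Function.update (Function.update C i T₁) l T₂ l = T₂ := by simp
  have e2 : Function.update (Function.update C i T₁) l T₂ i = T₁ := by
    rw [Function.update_of_ne hil, Function.update_self]
  have e3 : ∀ m, m ≠ i → m ≠ l → Function.update (Function.update C i T₁) l T₂ m = C m := by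
    intro m h1 h2
    rw [Function.update_of_ne h2, Function.update_of_ne h1]
  generalize Function.update (Function.update C i T₁) l T₂ = F at e1 e2 e3
  constructor
  · intro m
    by_cases h1 : m = l
    · subst h1; rw [e1]; exact hT₂
    · by_cases h2 : m = i
      · subst h2; rw [e2]; exact hT₁
      · rw [e3 m h2 h1]; exact h.1 m
  · intro m p hmp
    by_cases h1 : m = l
    · subst h1
      rw [e1]
      by_cases h2 : p = i
      · subst h2; rw [e2]; exact h12.symm
      · rw [e3 p h2 hmp.symm]; exact hd₂ p h2 hmp.symm
    · by_cases h2 : m = i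
      · subst h2
        rw [e2]
        by_cases h3 : p = l
        · subst h3; rw [e1]; exact h12
        · rw [e3 p hmp.symm h3]; exact hd₁ p hmp.symm h3
      · rw [e3 m h2 h1]
        by_cases h3 : p = l
        · subst h3; rw [e1]; exact (hd₂ m h2 h1).symm
        · by_cases h4 : p = i
          · subst h4; rw [e2]; exact (hd₁ m h2 h1).symm
          · rw [e3 p h4 h3]; exact h.2 m p hmp

theorem core_card {G : SimpleGraph V} {T : Finset V} (h : Core G T) : 3 ≤ T.card := by
  obtain ⟨v, hv⟩ := h.1
  have h1 := h.2 v hv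
  rw [← nbc_erase_self] at h1
  have h2 := nbc_le_card G (T.erase v) v
  have := Finset.card_erase_add_one hv
  omega

theorem nbc_two {G : SimpleGraph V} {X : Finset V} {v u w : V} (hu : u ∈ X) (hw : w ∈ X)
    (huw : u ≠ w) : ad G v u + ad G v w ≤ nbc G X v := by
  have h1 := nbc_erase G hu v
  have h2 := nbc_erase G (show w ∈ X.erase u by simp [hw, huw.symm]) v
  omega

theorem nbc_three {G : SimpleGraph V} {X : Finset V} {v u w z : V} (hu : u ∈ X) (hw : w ∈ X)
    (hz : z ∈ X) (huw : u ≠ w) (huz : u ≠ z) (hwz : w ≠ z) :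
    ad G v u + ad G v w + ad G v z ≤ nbc G X v := by
  have h1 := nbc_erase G hu v
  have h2 := nbc_two (G := G) (v := v) (show w ∈ X.erase u by simp [hw, huw.symm])
    (show z ∈ X.erase u by simp [hz, huz.symm]) hwz
  omega

section
variable [Fintype V] {G : SimpleGraph V} {j : ℕ} {C : Fin j → Finset V}

theorem sum_split {M : Type*} [AddCommMonoid M] (h : Pk G C) (f : V → M) :
    ∑ v, f v = ∑ v ∈ rest C, f v + ∑ i, ∑ v ∈ C i, f v := by
  rw [← Finset.sum_biUnion (fun i _ l _ hil => h.2 i l hil), ← Finset.sum_union]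
  · apply Finset.sum_congr _ (fun _ _ => rfl)
    ext v
    simp [mem_rest, Finset.mem_union, Finset.mem_biUnion]
    by_cases h : ∃ i, v ∈ C i
    · exact Or.inr h
    · left; push Not at h; exact h
  · rw [Finset.disjoint_left]
    intro v hv hv'
    obtain ⟨i, -, hi⟩ := Finset.mem_biUnion.1 hv'
    exact mem_rest.1 hv i hi

theorem nbc_split (h : Pk G C) (v : V) :
    nbc G Finset.univ v = nbc G (rest C) v + ∑ i, nbc G (C i) v := by
  simp_rw [nbc_sum]
  exact sum_split h _

theorem card_split (h : Pk G C) : Fintype.card V = (rest C).card + ∑ i, (C i).card := by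
  have := sum_split h (fun _ => 1)
  simpa using this

namespace Opt

theorem pk1 (h : Opt G C) (i : Fin j) (T : Finset V) (hT : Core G T) (hs : T ⊆ C i ∪ rest C) :
    Pk G (Function.update C i T) := by
  apply pk_update h.pk i hT
  intro l hl
  apply Finset.disjoint_of_subset_left hs
  rw [Finset.disjoint_union_left]
  refine ⟨h.pk.2 i l hl.symm, ?_⟩
  rw [Finset.disjoint_left]
  intro v hv
  exact mem_rest.1 hv l

theorem O1 (h : Opt G C) (i : Fin j) (T : Finset V) (hT : Core G T) (hs : T ⊆ C i ∪ rest C) :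
    (C i).card ≤ T.card := by
  have h1 := h.min _ (h.pk1 i T hT hs)
  have h2 := sum_update C i T
  omega

theorem two (h : Opt G C) (i : Fin j) : ∀ v ∈ C i, nbc G (C i) v = 2 :=
  core_two (h.pk.1 i) (fun T hT hc => h.O1 i T hc (hT.trans Finset.subset_union_left))

theorem O2 (h : Opt G C) {i l : Fin j} (hil : i ≠ l) (T₁ T₂ : Finset V)
    (hs₁ : T₁ ⊆ C i ∪ C l) (hs₂ : T₂ ⊆ C i ∪ C l) (hT₁ : Core G T₁) (hT₂ : Core G T₂)
    (h12 : Disjoint T₁ T₂) : (C i).card + (C l).card ≤ T₁.card + T₂.card := by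
  have hd : ∀ T ⊆ C i ∪ C l, ∀ m, m ≠ i → m ≠ l → Disjoint T (C m) := by
    intro T hs m h1 h2
    apply Finset.disjoint_of_subset_left hs
    rw [Finset.disjoint_union_left]
    exact ⟨h.pk.2 i m h1.symm, h.pk.2 l m h2.symm⟩
  have h1 := h.min _ (pk_update2 h.pk hil hT₁ hT₂ h12 (hd _ hs₁) (hd _ hs₂))
  have h2 := sum_update C i T₁
  have h3 := sum_update (Function.update C i T₁) l T₂
  rw [Function.update_of_ne hil.symm] at h3
  omega

theorem f2 (h : Opt G C) (i : Fin j) (v : V) (hv : v ∈ rest C) (h4 : 4 ≤ (C i).card) :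
    nbc G (C i) v ≤ 2 := by
  apply F2 (h.pk.1 i) (h.two i) v (mem_rest.1 hv i) _ h4
  intro T hT hc
  refine h.O1 i T hc (hT.trans ?_)
  apply Finset.insert_subset
  · exact Finset.mem_union_right _ hv
  · exact Finset.subset_union_left

theorem swap (h : Opt G C) (l : Fin j) (u : V) (hu : u ∈ rest C) (e : V) (he : e ∈ C l)
    (hadj : ∀ c ∈ C l, c ≠ e → G.Adj u c) : nbc G ((rest C).erase u) e ≤ nbc G (rest C) u := by
  have huC := mem_rest.1 hu
  have hu' : u ∉ (C l).erase e := fun hh => huC l (Finset.mem_of_mem_erase hh)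
  have hc3 := core_card (h.pk.1 l)
  have hce := Finset.card_erase_add_one he
  have hfull : nbc G ((C l).erase e) u = ((C l).erase e).card := by
    unfold nbc
    rw [Finset.filter_true_of_mem]
    intro c hc
    rw [Finset.mem_erase] at hc
    exact hadj c hc.2 hc.1
  have hcore : Core G (insert u ((C l).erase e)) := by
    refine ⟨Finset.insert_nonempty _ _, ?_⟩
    intro v hv
    rw [nbc_insert G hu']
    rw [Finset.mem_insert] at hv
    rcases hv with rfl | hv
    · omega
    · rw [Finset.mem_erase] at hv
      have h1 := h.two l v hv.2
      rw [nbc_erase G he, ] at h1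
      have h2 := ad_le G v e
      rw [ad_one (hadj v hv.2 hv.1).symm]
      omega
  have hcard : (insert u ((C l).erase e)).card = (C l).card := by
    rw [Finset.card_insert_of_notMem hu']; omega
  have hsub : insert u ((C l).erase e) ⊆ C l ∪ rest C := by
    apply Finset.insert_subset
    · exact Finset.mem_union_right _ hu
    · exact (Finset.erase_subset _ _).trans Finset.subset_union_left
  have hpk := h.pk1 l _ hcore hsub
  have hm := h.max _ hpk (by have := sum_update C l (insert u ((C l).erase e)); omega)
  have her : e ∉ rest C := fun hh => mem_rest.1 hh l he
  have hue : u ≠ e := fun hh => huC l (hh ▸ he)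
  have hrest : rest (Function.update C l (insert u ((C l).erase e))) = insert e ((rest C).erase u) := by
    ext v
    rw [mem_rest, Finset.mem_insert, Finset.mem_erase, mem_rest]
    constructor
    · intro hv
      have h1 := hv l
      rw [Function.update_self, Finset.mem_insert, Finset.mem_erase] at h1
      push Not at h1
      by_cases hve : v = e
      · exact Or.inl hve
      · right
        refine ⟨h1.1, ?_⟩
        intro m
        by_cases hm : m = l
        · subst hm; exact h1.2 hve
        · have := hv m
          rwa [Function.update_of_ne hm] at this
    · intro hv m
      by_cases hml : m = l
      · subst hml
        rw [Function.update_self, Finset.mem_insert, Finset.mem_erase]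
        rcases hv with rfl | hv
        · simp [hue.symm]
        · simp [hv.1, hv.2 m]
      · rw [Function.update_of_ne hml]
        rcases hv with rfl | hv
        · exact fun hh => Finset.disjoint_left.1 (h.pk.2 m l hml) hh he
        · exact hv.2 m
  rw [hrest, ds_insert G (fun hh => her (Finset.mem_of_mem_erase hh)), ds_erase G hu] at hm
  omega

theorem four (h : Opt G C) (hn : 3 * (j + 1) < Fintype.card V)
    (hδ : ∀ v, 2 * (j + 1) ≤ nbc G Finset.univ v) : 4 ≤ (rest C).card := by
  by_cases hex : ∃ i, 4 ≤ (C i).card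
  · obtain ⟨i₀, hi₀⟩ := hex
    obtain ⟨i, -, hi⟩ := Finset.exists_max_image Finset.univ (fun i => (C i).card) ⟨i₀, Finset.mem_univ _⟩
    have h4 : 4 ≤ (C i).card := hi₀.trans (hi i₀ (Finset.mem_univ _))
    have h1 : ∀ l, ∑ d ∈ C i, nbc G (C l) d ≤ 2 * (C i).card := by
      intro l
      by_cases hl : i = l
      · subst hl
        exact (ds_two (h.two i)).le
      · exact pair (h.pk.2 i l hl) (h.two i) (h.two l) (h.O2 hl) (hi l (Finset.mem_univ _)) h4
    have h2 : ∑ d ∈ C i, 2 * (j + 1) ≤ ∑ d ∈ C i, nbc G Finset.univ d :=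
      Finset.sum_le_sum (fun d _ => hδ d)
    simp_rw [nbc_split h.pk] at h2
    rw [Finset.sum_add_distrib, Finset.sum_comm (s := C i)] at h2
    have h3 : ∑ l, ∑ d ∈ C i, nbc G (C l) d ≤ ∑ l : Fin j, 2 * (C i).card :=
      Finset.sum_le_sum (fun l _ => h1 l)
    rw [nbc_comm] at h2
    have h5 : ∑ v ∈ rest C, nbc G (C i) v ≤ ∑ v ∈ rest C, 2 :=
      Finset.sum_le_sum (fun v hv => h.f2 i v hv h4)
    simp at h2 h3 h5
    nlinarith
  · push Not at hex
    have h1 := card_split h.pk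
    have h2 : ∑ i, (C i).card ≤ ∑ i : Fin j, 3 :=
      Finset.sum_le_sum (fun i _ => by have := hex i; omega)
    simp at h2
    omega

theorem dsR (h : Opt G C) (hn : (rest C).Nonempty) : ds G (rest C) + 2 ≤ 2 * (rest C).card := by
  by_contra hcon
  obtain ⟨m, hm⟩ := ds_even G (rest C)
  obtain ⟨T, hT, hc⟩ := X1' (G := G) (rest C) hn (by omega)
  exact h.nocore T hT hc

theorem low (h : Opt G C) (h4 : 4 ≤ (rest C).card) : ∃ x ∈ rest C, ∃ y ∈ rest C, x ≠ y ∧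
    nbc G (rest C) x ≤ 1 ∧ nbc G (rest C) y ≤ 1 := by
  have hne : (rest C).Nonempty := Finset.card_pos.1 (by omega)
  have hd := h.dsR hne
  have hx : ∃ x ∈ rest C, nbc G (rest C) x ≤ 1 := by
    by_contra hcon
    push Not at hcon
    exact h.nocore _ (Finset.Subset.refl _) ⟨hne, hcon⟩
  obtain ⟨x, hx, hx1⟩ := hx
  by_contra hcon
  push Not at hcon
  have hce := Finset.card_erase_add_one hx
  have h2 : ∑ y ∈ (rest C).erase x, 2 ≤ ∑ y ∈ (rest C).erase x, nbc G (rest C) y := by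
    apply Finset.sum_le_sum
    intro y hy
    rw [Finset.mem_erase] at hy
    exact hcon x hx y hy.2 (Ne.symm hy.1) hx1
  have h3 := Finset.sum_erase_add (rest C) (fun y => nbc G (rest C) y) hx
  have h5 := ds_erase G hx
  simp at h2
  unfold ds at hd h5
  obtain ⟨T, hT, hc⟩ := X1' (G := G) ((rest C).erase x) (Finset.card_pos.1 (by omega)) (by
    unfold ds
    omega)
  exact h.nocore T (hT.trans (Finset.erase_subset _ _)) hc

theorem f6a (h : Opt G C) {x y : V} (hx : x ∈ rest C) (hy : y ∈ rest C) (hxy : x ≠ y)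
    (hx1 : nbc G (rest C) x ≤ 1) (hy1 : nbc G (rest C) y ≤ 1) {l : Fin j} (hl : (C l).card = 3)
    (h3 : 3 ≤ nbc G (C l) x) (h2 : 2 ≤ nbc G (C l) y) :
    nbc G (rest C) x = 1 ∧ nbc G (rest C) y = 1 ∧
      ∀ z ∈ rest C, z ≠ x → z ≠ y → nbc G (C l) z = 0 := by
  have hxa : ∀ c ∈ C l, G.Adj x c := adj_all (by omega)
  have hxs : ∀ e ∈ C l, nbc G ((rest C).erase x) e ≤ nbc G (rest C) x :=
    fun e he => h.swap l x hx e he (fun c hc _ => hxa c hc)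
  have hyx : y ∈ (rest C).erase x := by simp [hy, hxy.symm]
  have hxy' : x ∈ (rest C).erase y := by simp [hx, hxy]
  obtain ⟨e, he, hey⟩ : ∃ e ∈ C l, ∀ c ∈ C l, c ≠ e → G.Adj y c := by
    by_cases hex : ∃ e ∈ C l, ¬ G.Adj y e
    · obtain ⟨e, he, hn⟩ := hex
      refine ⟨e, he, fun c hc hce => ?_⟩
      apply adj_all (X := (C l).erase e) _ c (by simp [hc, hce])
      have h1 := nbc_erase G he y
      have h2 := Finset.card_erase_add_one he
      have h3 : ad G y e = 0 := if_neg hn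
      omega
    · push Not at hex
      obtain ⟨e, he⟩ := (h.pk.1 l).1
      exact ⟨e, he, fun c hc _ => hex c hc⟩
  have hys := h.swap l y hy e he hey
  have hyR : nbc G (rest C) y = 1 := by
    have := nbc_pos hxy' (hxa e he).symm
    omega
  have hxR : nbc G (rest C) x = 1 := by
    have : 0 < ((C l).erase e).card := by
      have := Finset.card_erase_add_one he
      omega
    obtain ⟨c, hc⟩ := Finset.card_pos.1 this
    rw [Finset.mem_erase] at hc
    have h1 := nbc_pos hyx (hey c hc.2 hc.1).symm
    have := hxs c hc.2
    omega
  refine ⟨hxR, hyR, ?_⟩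
  intro z hz hzx hzy
  by_contra hcon
  have : 0 < ((C l).filter (G.Adj z)).card := by unfold nbc at hcon; omega
  obtain ⟨c, hc⟩ := Finset.card_pos.1 this
  rw [Finset.mem_filter] at hc
  by_cases hce : c = e
  · subst hce
    have h1 := nbc_two (G := G) (v := c) hxy' (show z ∈ (rest C).erase y by simp [hz, hzy]) hzx.symm
    rw [ad_one (hxa c he).symm, ad_one hc.2.symm] at h1
    omega
  · have h1 := nbc_two (G := G) (v := c) hyx (show z ∈ (rest C).erase x by simp [hz, hzx]) hzy.symm
    rw [ad_one (hey c hc.1 hce).symm, ad_one hc.2.symm] at h1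
    have := hxs c hc.1
    omega

theorem five (h : Opt G C) {x y : V} (hx : x ∈ rest C) (hy : y ∈ rest C) {l : Fin j}
    (h5 : 5 ≤ nbc G (C l) x + nbc G (C l) y) : (C l).card = 3 := by
  have h1 := core_card (h.pk.1 l)
  by_contra hcon
  have h2 := h.f2 l x hx (by omega)
  have h3 := h.f2 l y hy (by omega)
  omega

theorem f6 (h : Opt G C) {x y : V} (hx : x ∈ rest C) (hy : y ∈ rest C) (hxy : x ≠ y)
    (hx1 : nbc G (rest C) x ≤ 1) (hy1 : nbc G (rest C) y ≤ 1) {l : Fin j}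
    (h5 : 5 ≤ nbc G (C l) x + nbc G (C l) y) :
    (C l).card = 3 ∧ nbc G (rest C) x = 1 ∧ nbc G (rest C) y = 1 ∧
      ∀ z ∈ rest C, z ≠ x → z ≠ y → nbc G (C l) z = 0 := by
  have hl := h.five hx hy h5
  refine ⟨hl, ?_⟩
  have h1 := nbc_le_card G (C l) x
  have h2 := nbc_le_card G (C l) y
  by_cases h3 : 3 ≤ nbc G (C l) x
  · exact h.f6a hx hy hxy hx1 hy1 hl h3 (by omega)
  · obtain ⟨a, b, c⟩ := h.f6a hy hx hxy.symm hy1 hx1 hl (by omega) (by omega)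
    exact ⟨b, a, fun z hz hzx hzy => c z hz hzy hzx⟩

end Opt

theorem pigeon_sum (g : Fin j → ℕ) (c : ℕ) (h : c * j < ∑ l, g l) : ∃ l, c < g l := by
  by_contra hcon
  push Not at hcon
  have : ∑ l, g l ≤ ∑ l : Fin j, c := Finset.sum_le_sum (fun l _ => hcon l)
  simp at this
  rw [mul_comm] at this
  omega

theorem fin12 (x1 x2 x3 y1 y2 y3 z1 z2 z3 w1 w2 w3 : ℕ) (l1 : x1 ≤ 1) (l2 : x2 ≤ 1) (l3 : x3 ≤ 1)
    (l4 : y1 ≤ 1) (l5 : y2 ≤ 1) (l6 : y3 ≤ 1) (l7 : z1 ≤ 1) (l8 : z2 ≤ 1) (l9 : z3 ≤ 1)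
    (l10 : w1 ≤ 1) (l11 : w2 ≤ 1) (l12 : w3 ≤ 1)
    (m1 : (x2 + x3 ≤ 1 ∨ z1 + w1 ≤ 1) ∧ (y2 + y3 ≤ 1 ∨ z1 + w1 ≤ 1) ∧
      (z2 + z3 ≤ 1 ∨ x1 + y1 + w1 ≤ 2) ∧ (w2 + w3 ≤ 1 ∨ x1 + y1 + z1 ≤ 2))
    (m2 : (x1 + x3 ≤ 1 ∨ z2 + w2 ≤ 1) ∧ (y1 + y3 ≤ 1 ∨ z2 + w2 ≤ 1) ∧
      (z1 + z3 ≤ 1 ∨ x2 + y2 + w2 ≤ 2) ∧ (w1 + w3 ≤ 1 ∨ x2 + y2 + z2 ≤ 2))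
    (m3 : (x1 + x2 ≤ 1 ∨ z3 + w3 ≤ 1) ∧ (y1 + y2 ≤ 1 ∨ z3 + w3 ≤ 1) ∧
      (z1 + z2 ≤ 1 ∨ x3 + y3 + w3 ≤ 2) ∧ (w1 + w2 ≤ 1 ∨ x3 + y3 + z3 ≤ 2))
    (h4 : x1 + (x2 + x3) + (y1 + (y2 + y3)) ≤ 4)
    (h9 : 9 ≤ x1 + (x2 + x3) + (y1 + (y2 + y3)) + (z1 + (z2 + z3)) + (w1 + (w2 + w3))) : False := by
  have hD : (z1 = 1 ∧ z2 = 1 ∧ z3 = 1 ∧ w1 = 1 ∧ w2 = 1 ∧ w3 = 1) ∨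
      (z1 = 0 ∧ z2 = 1 ∧ z3 = 1 ∧ w1 = 1 ∧ w2 = 1 ∧ w3 = 1) ∨
      (z1 = 1 ∧ z2 = 0 ∧ z3 = 1 ∧ w1 = 1 ∧ w2 = 1 ∧ w3 = 1) ∨
      (z1 = 1 ∧ z2 = 1 ∧ z3 = 0 ∧ w1 = 1 ∧ w2 = 1 ∧ w3 = 1) ∨
      (z1 = 1 ∧ z2 = 1 ∧ z3 = 1 ∧ w1 = 0 ∧ w2 = 1 ∧ w3 = 1) ∨
      (z1 = 1 ∧ z2 = 1 ∧ z3 = 1 ∧ w1 = 1 ∧ w2 = 0 ∧ w3 = 1) ∨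
      (z1 = 1 ∧ z2 = 1 ∧ z3 = 1 ∧ w1 = 1 ∧ w2 = 1 ∧ w3 = 0) := by
    clear m1 m2 m3
    omega
  obtain ⟨a1, a2, a3, a4⟩ := m1
  obtain ⟨b1, b2, b3, b4⟩ := m2
  obtain ⟨c1, c2, c3, c4⟩ := m3
  rcases hD with h | h | h | h | h | h | h <;> obtain ⟨rfl, rfl, rfl, rfl, rfl, rfl⟩ := h <;>
    clear l7 l8 l9 l10 l11 l12 <;> norm_num at a1 a2 a3 a4 b1 b2 b3 b4 c1 c2 c3 c4 h4 h9 <;>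
    omega

theorem Opt.false (h : Opt G C) (hn : 3 * (j + 1) < Fintype.card V)
    (hδ : ∀ v, 2 * (j + 1) ≤ nbc G Finset.univ v) : False := by
  have h4 := h.four hn hδ
  have hne : (rest C).Nonempty := Finset.card_pos.1 (by omega)
  have hd := h.dsR hne
  obtain ⟨x, hx, y, hy, hxy, hx1, hy1⟩ := h.low h4
  have hdeg : ∀ v, 2 * (j + 1) ≤ nbc G (rest C) v + ∑ i, nbc G (C i) v := by
    intro v
    rw [← nbc_split h.pk]; exact hδ v
  have hdx := hdeg x
  have hdy := hdeg y
  have hone : nbc G (rest C) x = 1 ∧ nbc G (rest C) y = 1 := by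
    obtain ⟨l, hl⟩ := pigeon_sum (fun l => nbc G (C l) x + nbc G (C l) y) 4 (by
      rw [Finset.sum_add_distrib]; omega)
    obtain ⟨-, a, b, -⟩ := h.f6 hx hy hxy hx1 hy1 (l := l) hl
    exact ⟨a, b⟩
  have hthird : ∀ z ∈ rest C, z ≠ x → z ≠ y → 2 ≤ nbc G (rest C) z := by
    intro z hz hzx hzy
    by_contra hcon
    have hdz := hdeg z
    obtain ⟨l, hl⟩ := pigeon_sum (fun l => nbc G (C l) x + nbc G (C l) y + nbc G (C l) z) 6 (by
      rw [Finset.sum_add_distrib, Finset.sum_add_distrib]; omega)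
    have k1 := nbc_le_card G (C l) x
    have k2 := nbc_le_card G (C l) y
    have k3 := nbc_le_card G (C l) z
    by_cases p1 : 5 ≤ nbc G (C l) x + nbc G (C l) y
    · obtain ⟨a, -, -, b⟩ := h.f6 hx hy hxy hx1 hy1 p1
      have := b z hz hzx hzy
      omega
    by_cases p2 : 5 ≤ nbc G (C l) x + nbc G (C l) z
    · obtain ⟨a, -, -, b⟩ := h.f6 hx hz hzx.symm hx1 (by omega) p2
      have := b y hy hxy.symm hzy.symm
      omega
    by_cases p3 : 5 ≤ nbc G (C l) y + nbc G (C l) z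
    · obtain ⟨a, -, -, b⟩ := h.f6 hy hz hzy.symm hy1 (by omega) p3
      have := b x hx hxy hzx.symm
      omega
    omega
  have hyx : y ∈ (rest C).erase x := by simp [hy, hxy.symm]
  have c1 := Finset.card_erase_add_one hx
  have c2 := Finset.card_erase_add_one hyx
  have s1 := Finset.sum_erase_add (rest C) (fun v => nbc G (rest C) v) hx
  have s2 := Finset.sum_erase_add ((rest C).erase x) (fun v => nbc G (rest C) v) hyx
  have hS : ∀ z ∈ ((rest C).erase x).erase y, z ∈ rest C ∧ z ≠ x ∧ z ≠ y := by
    intro z hz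
    rw [Finset.mem_erase, Finset.mem_erase] at hz
    exact ⟨hz.2.2, hz.2.1, hz.1⟩
  have htwo : ∀ z ∈ ((rest C).erase x).erase y, nbc G (rest C) z = 2 := by
    by_contra hcon
    push Not at hcon
    obtain ⟨z, hz, hz2⟩ := hcon
    have hge : ∀ z ∈ ((rest C).erase x).erase y, 2 ≤ nbc G (rest C) z :=
      fun z hz => hthird z (hS z hz).1 (hS z hz).2.1 (hS z hz).2.2
    have h1 : ∑ z ∈ ((rest C).erase x).erase y, 2 < ∑ z ∈ ((rest C).erase x).erase y, nbc G (rest C) z :=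
      Finset.sum_lt_sum hge ⟨z, hz, lt_of_le_of_ne (hge z hz) (Ne.symm hz2)⟩
    rw [Finset.sum_const, smul_eq_mul] at h1
    unfold ds at hd
    omega
  obtain ⟨z, hz, w, hw, hzw⟩ := Finset.one_lt_card.1 (show 1 < (((rest C).erase x).erase y).card by omega)
  have hz2 := htwo z hz
  have hw2 := htwo w hw
  obtain ⟨hz, hzx, hzy⟩ := hS z hz
  obtain ⟨hw, hwx, hwy⟩ := hS w hw
  have hdz := hdeg z
  have hdw := hdeg w
  obtain ⟨l, hl⟩ := pigeon_sum (fun l => nbc G (C l) x + nbc G (C l) y + nbc G (C l) z + nbc G (C l) w) 8 (by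
      rw [Finset.sum_add_distrib, Finset.sum_add_distrib, Finset.sum_add_distrib]; omega)
  have hxy4 : nbc G (C l) x + nbc G (C l) y ≤ 4 := by
    by_contra hcon
    obtain ⟨a, -, -, b⟩ := h.f6 hx hy hxy hx1 hy1 (l := l) (by omega)
    have k1 := nbc_le_card G (C l) x
    have k2 := nbc_le_card G (C l) y
    have := b z hz hzx hzy
    have := b w hw hwx hwy
    omega
  have h3 := h.five hz hw (l := l) (by omega)
  -- linear forms of swap
  have sw : ∀ u ∈ rest C, ∀ a b c, C l = {a, b, c} → ad G u b + ad G u c ≤ 1 ∨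
      nbc G ((rest C).erase u) a ≤ nbc G (rest C) u := by
    intro u hu a b c hC
    by_cases hb : G.Adj u b
    · by_cases hc : G.Adj u c
      · right
        apply h.swap l u hu a (by rw [hC]; simp)
        intro v hv hva
        rw [hC] at hv
        simp only [Finset.mem_insert, Finset.mem_singleton] at hv
        rcases hv with rfl | rfl | rfl
        · exact absurd rfl hva
        · exact hb
        · exact hc
      · left
        have : ad G u c = 0 := if_neg hc
        have := ad_le G u b
        omega
    · left
      have : ad G u b = 0 := if_neg hb
      have := ad_le G u c
      omega
  have main : ∀ a b c, C l = {a, b, c} →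
      (ad G x b + ad G x c ≤ 1 ∨ ad G z a + ad G w a ≤ 1) ∧
      (ad G y b + ad G y c ≤ 1 ∨ ad G z a + ad G w a ≤ 1) ∧
      (ad G z b + ad G z c ≤ 1 ∨ ad G x a + ad G y a + ad G w a ≤ 2) ∧
      (ad G w b + ad G w c ≤ 1 ∨ ad G x a + ad G y a + ad G z a ≤ 2) := by
    intro a b c hC
    have m : ∀ u v, v ∈ rest C → v ≠ u → v ∈ (rest C).erase u := by
      intro u v hv hvu; simp [hv, hvu]
    rw [ad_comm G x a, ad_comm G y a, ad_comm G z a, ad_comm G w a]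
    refine ⟨?_, ?_, ?_, ?_⟩
    · refine (sw x hx a b c hC).imp_right (fun hh => ?_)
      have := nbc_two (G := G) (v := a) (m x z hz hzx) (m x w hw hwx) hzw
      exact this.trans (hh.trans hx1)
    · refine (sw y hy a b c hC).imp_right (fun hh => ?_)
      have := nbc_two (G := G) (v := a) (m y z hz hzy) (m y w hw hwy) hzw
      exact this.trans (hh.trans hy1)
    · refine (sw z hz a b c hC).imp_right (fun hh => ?_)
      have := nbc_three (G := G) (v := a) (m z x hx hzx.symm) (m z y hy hzy.symm) (m z w hw hzw.symm)
        hxy hwx.symm hwy.symm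
      exact this.trans (hh.trans hz2.le)
    · refine (sw w hw a b c hC).imp_right (fun hh => ?_)
      have := nbc_three (G := G) (v := a) (m w x hx hwx.symm) (m w y hy hwy.symm) (m w z hz hzw)
        hxy hzx.symm hzy.symm
      exact this.trans (hh.trans hw2.le)
  obtain ⟨a, b, c, hab, hac, hbc, hC⟩ := Finset.card_eq_three.1 h3
  have hs : ∀ v, nbc G (C l) v = ad G v a + (ad G v b + ad G v c) := by
    intro v
    rw [hC, nbc_sum, Finset.sum_insert (by simp [hab, hac]), Finset.sum_insert (by simp [hbc]),
      Finset.sum_singleton]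
  have m1 := main a b c hC
  have m2 := main b a c (by rw [hC, Finset.insert_comm])
  have m3 := main c a b (by
    rw [hC, Finset.pair_comm b c, Finset.insert_comm a c])
  have q1 := hs x
  have q2 := hs y
  have q3 := hs z
  have q4 := hs w
  have l1 := ad_le G x a
  have l2 := ad_le G x b
  have l3 := ad_le G x c
  have l4 := ad_le G y a
  have l5 := ad_le G y b
  have l6 := ad_le G y c
  have l7 := ad_le G z a
  have l8 := ad_le G z b
  have l9 := ad_le G z c
  have l10 := ad_le G w a
  have l11 := ad_le G w b
  have l12 := ad_le G w c
  rw [q1, q2] at hxy4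
  rw [q1, q2, q3, q4] at hl
  exact fin12 _ _ _ _ _ _ _ _ _ _ _ _ l1 l2 l3 l4 l5 l6 l7 l8 l9 l10 l11 l12 m1 m2 m3 hxy4
    (Nat.succ_le_of_lt hl)

end
end
end CH

namespace CH
section
open scoped Classical
variable {V : Type*}

theorem core_cycle {G : SimpleGraph V} {T : Finset V} (h : Core G T) :
    ∃ p : Σ v : V, G.Walk v v, p.2.IsCycle ∧ ∀ v ∈ p.2.support, v ∈ T := by
  have hna : ¬ (G.induce (T : Set V)).IsAcyclic := by
    intro hac
    have : Nonempty (T : Set V) := h.1.to_subtype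
    obtain ⟨u, v, p, hp, hmax⟩ :=
      SimpleGraph.Walk.exists_isPath_forall_isPath_length_le_length (G.induce (T : Set V))
    have hsnd : ∀ w, (G.induce (T : Set V)).Adj u w → w = p.snd := by
      intro w hw
      apply hac.eq_snd_of_adj_start hp hw
      by_contra hns
      have := hmax _ _ (SimpleGraph.Walk.cons hw.symm p)
        ((SimpleGraph.Walk.cons_isPath_iff _ _).2 ⟨hp, hns⟩)
      simp at this
    have h2 : 1 < (T.filter (G.Adj u)).card := h.2 u u.2
    obtain ⟨a, ha, b, hb, hab⟩ := Finset.one_lt_card.1 h2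
    rw [Finset.mem_filter] at ha hb
    have e1 := hsnd ⟨a, ha.1⟩ ha.2
    have e2 := hsnd ⟨b, hb.1⟩ hb.2
    exact hab (congrArg Subtype.val (e1.trans e2.symm))
  unfold SimpleGraph.IsAcyclic at hna
  push Not at hna
  obtain ⟨v, c, hc⟩ := hna
  refine ⟨⟨_, c.map (SimpleGraph.Embedding.induce (T : Set V)).toHom⟩, ?_, ?_⟩
  · exact hc.map (SimpleGraph.Embedding.induce (G := G) (T : Set V)).injective
  · intro x hx
    simp only [SimpleGraph.Walk.support_map, List.mem_map] at hx
    obtain ⟨y, _, rfl⟩ := hx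
    exact y.2

theorem pk_hs [Fintype V] (G : SimpleGraph V) (k : ℕ) (hn : Fintype.card V = 3 * k)
    (hδ : ∀ v, 2 * k ≤ nbc G Finset.univ v) : ∃ C : Fin k → Finset V, Pk G C := by
  obtain ⟨f, hf, hp, hc⟩ := HS 3 k Gᶜ Finset.univ (Finset.range k) (by simp) (by simp [hn, mul_comm]) (by
    intro v _
    have h1 : nbc Gᶜ Finset.univ v + nbc G Finset.univ v ≤ (Finset.univ.erase v).card := by
      unfold nbc
      rw [← Finset.card_union_of_disjoint]
      · apply Finset.card_le_card
        intro w hw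
        simp only [Finset.mem_union, Finset.mem_filter] at hw
        simp only [Finset.mem_erase, Finset.mem_univ, and_true]
        rcases hw with hw | hw
        · exact hw.2.ne'
        · exact hw.2.ne'
      · rw [Finset.disjoint_left]
        intro w hw hw'
        simp only [Finset.mem_filter] at hw hw'
        exact ((SimpleGraph.compl_adj _ _ _).1 hw.2).2 hw'.2
    have h2 := Finset.card_erase_add_one (Finset.mem_univ v)
    rw [Finset.card_univ] at h2
    have := hδ v
    simp only [Finset.card_range]
    omega)
  refine ⟨fun i => cl Finset.univ f i, ?_, ?_⟩
  · intro i
    change Core G (cl Finset.univ f i)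
    have h3 := hc i (by simp)
    refine ⟨Finset.card_pos.1 (by omega), ?_⟩
    intro v hv
    have h4 := Finset.card_erase_add_one hv
    have h5 : (cl Finset.univ f i).erase v ⊆ (cl Finset.univ f i).filter (G.Adj v) := by
      intro w hw
      rw [Finset.mem_erase] at hw
      rw [Finset.mem_filter]
      refine ⟨hw.2, ?_⟩
      by_contra hna
      simp only [cl, Finset.mem_filter] at hv hw
      exact hp v (Finset.mem_univ _) w (Finset.mem_univ _)
        ((SimpleGraph.compl_adj _ _ _).2 ⟨hw.1.symm, hna⟩) (hv.2.trans hw.2.2.symm)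
    have h6 := Finset.card_le_card h5
    unfold nbc
    omega
  · intro i l hil
    rw [Finset.disjoint_left]
    intro v hv hv'
    simp only [cl, Finset.mem_filter] at hv hv'
    exact hil (Fin.ext (hv.2.symm.trans hv'.2))

theorem exists_opt [Fintype V] (G : SimpleGraph V) (j : ℕ) (h : ∃ C : Fin j → Finset V, Pk G C)
    (hno : ¬ ∃ C : Fin (j + 1) → Finset V, Pk G C) : ∃ C : Fin j → Finset V, Opt G C := by
  obtain ⟨C0, h0⟩ := h
  obtain ⟨C1, h1, hm1⟩ := Finset.exists_min_image
    (Finset.univ.filter (fun C : Fin j → Finset V => Pk G C)) (fun C => ∑ i, (C i).card)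
    ⟨C0, by simp [h0]⟩
  simp only [Finset.mem_filter, Finset.mem_univ, true_and] at h1 hm1
  obtain ⟨C, h2, hm2⟩ := Finset.exists_max_image
    (Finset.univ.filter (fun C : Fin j → Finset V => Pk G C ∧
      ∑ i, (C i).card = ∑ i, (C1 i).card)) (fun C => ds G (rest C))
    ⟨C1, by simp [h1]⟩
  simp only [Finset.mem_filter, Finset.mem_univ, true_and] at h2 hm2
  refine ⟨C, h2.1, ?_, ?_, ?_⟩
  · intro C' hC'
    rw [h2.2]; exact hm1 C' hC'
  · intro C' hC' he
    exact hm2 C' ⟨hC', he.trans h2.2⟩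
  · intro T hT hc
    apply hno
    have hd : ∀ i, Disjoint T (C i) := by
      intro i
      rw [Finset.disjoint_left]
      intro v hv
      exact mem_rest.1 (hT hv) i
    refine ⟨Fin.cons T C, ?_, ?_⟩
    · intro i
      refine Fin.cases ?_ (fun i => ?_) i
      · exact hc
      · exact h2.1.1 i
    · intro i l
      refine Fin.cases ?_ (fun i => ?_) i
      · refine Fin.cases ?_ (fun l => ?_) l
        · intro h; exact absurd rfl h
        · intro _; exact hd l
      · refine Fin.cases ?_ (fun l => ?_) l
        · intro _; exact (hd i).symm
        · intro h; exact h2.1.2 i l (fun hh => h (congrArg Fin.succ hh))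

theorem pk_main [Fintype V] (G : SimpleGraph V) : ∀ k : ℕ, 3 * k ≤ Fintype.card V →
    (∀ v, 2 * k ≤ nbc G Finset.univ v) → ∃ C : Fin k → Finset V, Pk G C := by
  intro k
  induction k with
  | zero => intro _ _; exact ⟨fun _ => ∅, fun i => i.elim0, fun i => i.elim0⟩
  | succ j ih =>
    intro hn hδ
    by_cases he : Fintype.card V = 3 * (j + 1)
    · exact pk_hs G (j + 1) he hδ
    · by_contra hno
      obtain ⟨C, hC⟩ := exists_opt G j (ih (by omega) (fun v => by have := hδ v; omega)) hno
      exact hC.false (by omega) hδ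

end
end CH

/-- **Corrádi–Hajnal theorem.** For `k ≥ 1`, every graph on at least `3k` vertices with
minimum degree at least `2k` contains `k` pairwise vertex-disjoint cycles. -/
theorem corradi_hajnal {V : Type*} [Fintype V] (G : SimpleGraph V) [DecidableRel G.Adj]
    (k : ℕ) (hk : 1 ≤ k) (hcard : 3 * k ≤ Fintype.card V)
    (hmin : 2 * k ≤ G.minDegree) :
    G.HasNDisjointCycles k := by
  obtain ⟨C, hC, hd⟩ := CH.pk_main G k hcard (by
    intro v
    refine hmin.trans ((G.minDegree_le_degree v).trans ?_)
    unfold CH.nbc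
    rw [← SimpleGraph.card_neighborFinset_eq_degree]
    apply Finset.card_le_card
    intro w hw
    simpa using hw)
  choose f hf hs using fun i => CH.core_cycle (hC i)
  exact ⟨f, hf, fun i j hij v hv hv' =>
    Finset.disjoint_left.1 (hd i j hij) (hs i v hv) (hs j v hv')⟩
end

section
/- Let k ≥ 1 be an integer. Every finite simple graph G with |G| ≥ 3k vertices and σ₂(G) ≥ 4k−1 contains k pairwise vertex-disjoint cycles. -/
/-- The minimum Ore degree `σ₂(G)`: the minimum of `d(x) + d(y)` over distinct nonadjacent
vertices `x, y`, with value `∞` if `G` is complete. -/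
noncomputable def SimpleGraph.sigma2 {V : Type*} [Fintype V] (G : SimpleGraph V)
    [DecidableRel G.Adj] : ℕ∞ :=
  ⨅ (x : V) (y : V) (_ : x ≠ y) (_ : ¬ G.Adj x y), ((G.degree x + G.degree y : ℕ) : ℕ∞)


namespace EW
set_option linter.unusedSectionVars false
open Finset
open scoped Classical

variable {V : Type*} [Fintype V] {G : SimpleGraph V}

/-- number of neighbours of `v` in `S` -/
noncomputable def nb (G : SimpleGraph V) (S : Finset V) (v : V) : ℕ :=
  (S.filter (fun w => G.Adj v w)).card

def Cyc (G : SimpleGraph V) (S : Finset V) : Prop :=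
  S.Nonempty ∧ ∀ v ∈ S, 2 ≤ nb G S v

def HasC (G : SimpleGraph V) (S : Finset V) : Prop := ∃ T ⊆ S, Cyc G T

theorem HasC.mono {S T : Finset V} (h : HasC G S) (hs : S ⊆ T) : HasC G T := by
  obtain ⟨U, hU, hc⟩ := h
  exact ⟨U, hU.trans hs, hc⟩

theorem Cyc.hasC {S : Finset V} (h : Cyc G S) : HasC G S := ⟨S, Subset.refl _, h⟩

theorem nb_insert {S : Finset V} {a : V} (ha : a ∉ S) (v : V) :
    nb G (insert a S) v = nb G S v + if G.Adj v a then 1 else 0 := by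
  unfold nb
  rw [filter_insert]
  split_ifs
  · rw [card_insert_of_notMem (by simp [ha])]
  · simp

theorem nb_mono {S T : Finset V} (h : S ⊆ T) (v : V) : nb G S v ≤ nb G T v :=
  card_le_card (filter_subset_filter _ h)

theorem nb_le_card (S : Finset V) (v : V) : nb G S v ≤ S.card := card_filter_le _ _

theorem nb_union {S T : Finset V} (h : Disjoint S T) (v : V) :
    nb G (S ∪ T) v = nb G S v + nb G T v := by
  unfold nb
  rw [filter_union, card_union_of_disjoint (disjoint_filter_filter h)]

theorem nb_erase {S : Finset V} {a : V} (ha : a ∈ S) (v : V) :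
    nb G S v = nb G (S.erase a) v + if G.Adj v a then 1 else 0 := by
  rw [← nb_insert (notMem_erase a S), insert_erase ha]

theorem nb_self_erase {S : Finset V} {a : V} (ha : a ∈ S) :
    nb G S a = nb G (S.erase a) a := by
  rw [nb_erase ha]; simp

theorem sum_nb_comm (S T : Finset V) : ∑ v ∈ S, nb G T v = ∑ v ∈ T, nb G S v := by
  unfold nb
  simp only [card_filter]
  rw [sum_comm]
  simp only [G.adj_comm]

theorem sum_ite_nb (S : Finset V) (a : V) :
    ∑ v ∈ S, (if G.Adj v a then 1 else 0) = nb G S a := by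
  unfold nb
  rw [card_filter]
  simp only [G.adj_comm]

theorem sum_insert_nb {S : Finset V} {a : V} (ha : a ∉ S) :
    ∑ v ∈ insert a S, nb G (insert a S) v = ∑ v ∈ S, nb G S v + 2 * nb G S a := by
  rw [sum_insert ha]
  simp only [nb_insert ha]
  rw [sum_add_distrib, sum_ite_nb]
  simp
  ring

theorem acyc_sum : ∀ (n : ℕ) (S : Finset V), S.card = n → S.Nonempty → ¬ HasC G S →
    ∑ v ∈ S, nb G S v + 2 ≤ 2 * S.card := by
  intro n
  induction n with
  | zero => intro S h h1; simp at h; simp [h] at h1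
  | succ n ih =>
    intro S hS hne hC
    have : ∃ v ∈ S, nb G S v ≤ 1 := by
      by_contra! h
      exact hC ⟨S, Subset.refl _, hne, fun v hv => h v hv⟩
    obtain ⟨v, hv, h1⟩ := this
    have e : insert v (S.erase v) = S := insert_erase hv
    have hs := sum_insert_nb (G := G) (notMem_erase v S)
    rw [e] at hs
    rw [hs]
    have hc : (S.erase v).card = n := by rw [card_erase_of_mem hv]; omega
    have h2 : nb G (S.erase v) v ≤ 1 := (nb_mono (erase_subset v S) v).trans h1
    rcases (S.erase v).eq_empty_or_nonempty with h0 | h0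
    · have : nb G (S.erase v) v = 0 := by rw [h0]; simp [nb]
      rw [this, h0]; simp; omega
    · have := ih _ hc h0 (fun h => hC (h.mono (erase_subset v S)))
      omega

theorem hasC_of_sum {S : Finset V} (hne : S.Nonempty) (h : 2 * S.card ≤ ∑ v ∈ S, nb G S v) :
    HasC G S := by
  by_contra hc
  have := acyc_sum _ S rfl hne hc
  omega

theorem cyc_card {S : Finset V} (h : Cyc G S) : 3 ≤ S.card := by
  obtain ⟨⟨v, hv⟩, h2⟩ := h
  have := h2 v hv
  rw [nb_self_erase hv] at this
  have h3 := nb_le_card (G := G) (S.erase v) v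
  rw [card_erase_of_mem hv] at h3
  omega

theorem minC_deg {S : Finset V} (h : Cyc G S) (hm : ∀ T ⊆ S, Cyc G T → S.card ≤ T.card) :
    ∀ v ∈ S, nb G S v = 2 := by
  have h3 := cyc_card h
  obtain ⟨u, hu, hmin⟩ := S.exists_min_image (fun v => nb G S v) h.1
  have e : insert u (S.erase u) = S := insert_erase hu
  have hs := sum_insert_nb (G := G) (notMem_erase u S)
  rw [e, ← nb_self_erase hu] at hs
  have hc : (S.erase u).card + 1 = S.card := by rw [card_erase_of_mem hu]; omega
  have hC : ¬ HasC G (S.erase u) := by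
    rintro ⟨T, hT, hcT⟩
    have := hm T (hT.trans (erase_subset u S)) hcT
    have := card_le_card hT
    omega
  have ha := acyc_sum _ (S.erase u) rfl (card_pos.1 (by omega)) hC
  have hlow : S.card * nb G S u ≤ ∑ v ∈ S, nb G S v := by
    have := card_nsmul_le_sum S (fun v => nb G S v) _ hmin
    simpa using this
  have hd := h.2 u hu
  have hu2 : nb G S u = 2 := by
    by_contra hne
    have : 3 ≤ nb G S u := by omega
    nlinarith
  intro v hv
  by_contra hne
  have hv2 := h.2 v hv
  have : ∑ v ∈ S, 2 < ∑ v ∈ S, nb G S v := sum_lt_sum h.2 ⟨v, hv, by omega⟩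
  simp at this
  omega

theorem chord {S : Finset V} (hS : ∀ v ∈ S, nb G S v = 2) (h4 : 4 ≤ S.card) {v : V} (hv : v ∉ S)
    (h3 : 3 ≤ nb G S v) : ∃ T ⊆ insert v S, Cyc G T ∧ T.card < S.card := by
  have hu : ∃ u ∈ S, 4 ≤ nb G S v ∨ ¬ G.Adj v u := by
    by_cases h : ∀ u ∈ S, G.Adj v u
    · have : nb G S v = S.card := by unfold nb; rw [filter_true_of_mem h]
      obtain ⟨u, hu⟩ := card_pos.1 (by omega : 0 < S.card)
      exact ⟨u, hu, Or.inl (by omega)⟩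
    · push Not at h
      obtain ⟨u, hu, h⟩ := h
      exact ⟨u, hu, Or.inr h⟩
  obtain ⟨u, hu, hu4⟩ := hu
  have hw : ∃ w ∈ S, G.Adj u w := by
    have := hS u hu
    have : 0 < nb G S u := by omega
    obtain ⟨w, hw⟩ := card_pos.1 this
    simp at hw
    exact ⟨w, hw⟩
  obtain ⟨w, hw, huw⟩ := hw
  have hwe : w ∈ S.erase u := mem_erase.2 ⟨huw.ne', hw⟩
  have s1 := sum_insert_nb (G := G) (notMem_erase u S)
  rw [insert_erase hu, ← nb_self_erase hu, hS u hu] at s1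
  have s2 := sum_insert_nb (G := G) (notMem_erase w (S.erase u))
  rw [insert_erase hwe] at s2
  have e1 := nb_erase (G := G) hu w
  rw [hS w hw, if_pos huw.symm, nb_self_erase hwe] at e1
  have hv0 : v ∉ (S.erase u).erase w := fun h => hv (mem_of_mem_erase (mem_of_mem_erase h))
  have s3 := sum_insert_nb (G := G) hv0
  have e2 := nb_erase (G := G) hu v
  have e3 := nb_erase (G := G) hwe v
  have c1 := card_erase_of_mem hu
  have c2 := card_erase_of_mem hwe
  have c3 := card_insert_of_notMem hv0
  have hsum : ∑ v ∈ S, nb G S v = S.card * 2 := by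
    rw [sum_congr rfl hS]; simp
  have : HasC G (insert v ((S.erase u).erase w)) := by
    apply hasC_of_sum (insert_nonempty _ _)
    rw [s3, c3]
    rcases hu4 with h | h
    · split_ifs at e2 e3 <;> omega
    · rw [if_neg h] at e2
      split_ifs at e3 <;> omega
  obtain ⟨T, hT, hc⟩ := this
  refine ⟨T, hT.trans (insert_subset_insert _ ((erase_subset _ _).trans (erase_subset _ _))), hc, ?_⟩
  have := card_le_card hT
  omega

def IsP (G : SimpleGraph V) (l : List V) : Prop := l.Nodup ∧ l.IsChain G.Adj

theorem IsP.reverse {l : List V} (h : IsP G l) : IsP G l.reverse := by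
  refine ⟨List.nodup_reverse.2 h.1, ?_⟩
  rw [List.isChain_reverse]
  exact h.2.imp fun a b h => h.symm

theorem IsP.tail {a : V} {l : List V} (h : IsP G (a :: l)) : IsP G l :=
  ⟨(List.nodup_cons.1 h.1).2, h.2.tail⟩

theorem IsP.cons {a b : V} {l : List V} (h : IsP G (b :: l)) (hab : G.Adj a b) (ha : a ∉ b :: l) :
    IsP G (a :: b :: l) :=
  ⟨List.nodup_cons.2 ⟨ha, h.1⟩, List.isChain_cons_cons.2 ⟨hab, h.2⟩⟩

theorem IsP.sum {l : List V} (h : IsP G l) (hne : l ≠ []) :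
    2 * l.length ≤ ∑ v ∈ l.toFinset, nb G l.toFinset v + 2 := by
  induction l with
  | nil => simp at hne
  | cons a l ih =>
    cases l with
    | nil => simp
    | cons b l =>
      have := ih h.tail (by simp)
      have ha : a ∉ (b :: l).toFinset := by
        have := (List.nodup_cons.1 h.1).1
        simpa using this
      rw [List.toFinset_cons (a := a), sum_insert_nb ha]
      have hab := (List.isChain_cons_cons.1 h.2).1
      have : 0 < nb G (b :: l).toFinset a := card_pos.2 ⟨b, by simp [hab]⟩
      simp only [List.length_cons] at *
      omega

theorem pathplus {l : List V} (h : IsP G l) {a : V} (ha : a ∉ l) (h2 : 2 ≤ nb G l.toFinset a) :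
    HasC G (insert a l.toFinset) := by
  have hne : l ≠ [] := by rintro rfl; simp [nb] at h2
  have ha' : a ∉ l.toFinset := by simpa using ha
  apply hasC_of_sum (insert_nonempty _ _)
  rw [sum_insert_nb ha', card_insert_of_notMem ha', List.toFinset_card_of_nodup h.1]
  have := h.sum hne
  omega

theorem nb_three {a b c : V} (n1 : a ≠ b) (n2 : a ≠ c) (n3 : b ≠ c) (v : V) :
    nb G {a, b, c} v = (if G.Adj v a then 1 else 0) + (if G.Adj v b then 1 else 0) +
      (if G.Adj v c then 1 else 0) := by
  rw [nb_insert (by simp [n1, n2]), nb_insert (by simp [n3])]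
  have : nb G {c} v = if G.Adj v c then 1 else 0 := by
    unfold nb; rw [filter_singleton]; split_ifs <;> simp
  rw [this]; ring

theorem cyc3 {a b c : V} (h1 : G.Adj a b) (h2 : G.Adj a c) (h3 : G.Adj b c) :
    Cyc G {a, b, c} := by
  refine ⟨insert_nonempty _ _, ?_⟩
  intro v hv
  rw [nb_three h1.ne h2.ne h3.ne]
  simp only [mem_insert, mem_singleton] at hv
  rcases hv with rfl | rfl | rfl
  · simp [h1, h2]
  · simp [h1.symm, h3]
  · simp [h2.symm, h3.symm]

def Pk (G : SimpleGraph V) (F : Finset (Finset V)) : Prop :=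
  (∀ C ∈ F, Cyc G C) ∧ ∀ C ∈ F, ∀ D ∈ F, C ≠ D → Disjoint C D

noncomputable def R (F : Finset (Finset V)) : Finset V := univ \ F.biUnion id

theorem mem_R {F : Finset (Finset V)} {v : V} : v ∈ R F ↔ ∀ C ∈ F, v ∉ C := by
  simp [R]

def tot (F : Finset (Finset V)) : ℕ := ∑ C ∈ F, C.card

theorem exch {F A B : Finset (Finset V)} (h : Pk G F) (hA : A ⊆ F) (hB : Pk G B)
    (hd : ∀ b ∈ B, ∀ v ∈ b, v ∈ R F ∨ ∃ C ∈ A, v ∈ C) :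
    Pk G (F \ A ∪ B) ∧ (F \ A ∪ B).card + A.card = F.card + B.card ∧
      tot (F \ A ∪ B) + tot A = tot F + tot B := by
  have key : ∀ C ∈ F \ A, ∀ b ∈ B, Disjoint C b := by
    intro C hC b hb
    rw [Finset.mem_sdiff] at hC
    rw [Finset.disjoint_left]
    intro v hv hvb
    rcases hd b hb v hvb with h1 | ⟨D, hD, hvD⟩
    · exact mem_R.1 h1 C hC.1 hv
    · have := h.2 C hC.1 D (hA hD) (by rintro rfl; exact hC.2 hD)
      exact Finset.disjoint_left.1 this hv hvD
  have dj : Disjoint (F \ A) B := by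
    rw [Finset.disjoint_left]
    intro C hC hCB
    have := key C hC C hCB
    rw [disjoint_self] at this
    have := (hB.1 C hCB).1
    simp_all
  refine ⟨⟨?_, ?_⟩, ?_, ?_⟩
  · intro C hC
    rcases Finset.mem_union.1 hC with h1 | h1
    · exact h.1 C (Finset.mem_sdiff.1 h1).1
    · exact hB.1 C h1
  · intro C hC D hD hne
    rcases Finset.mem_union.1 hC with h1 | h1 <;> rcases Finset.mem_union.1 hD with h2 | h2
    · exact h.2 C (Finset.mem_sdiff.1 h1).1 D (Finset.mem_sdiff.1 h2).1 hne
    · exact key C h1 D h2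
    · exact (key D h2 C h1).symm
    · exact hB.2 C h1 D h2 hne
  · rw [card_union_of_disjoint dj]
    have := card_sdiff_add_card_eq_card hA
    omega
  · unfold tot
    rw [sum_union dj]
    have := sum_sdiff (f := fun C : Finset V => C.card) hA
    omega

theorem Pk_one {S : Finset V} (h : Cyc G S) : Pk G {S} := by
  constructor
  · simp [h]
  · intro C hC D hD hne
    simp at hC hD
    simp_all

theorem exists_two {S T : Finset V} (hS : HasC G S) (hT : HasC G T) (d : Disjoint S T) :
    ∃ B, Pk G B ∧ B.card = 2 ∧ ∀ b ∈ B, ∀ v ∈ b, v ∈ S ∨ v ∈ T := by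
  obtain ⟨S', h1, c1⟩ := hS
  obtain ⟨T', h2, c2⟩ := hT
  have d' : Disjoint S' T' := disjoint_of_subset_left h1 (disjoint_of_subset_right h2 d)
  have hne : S' ≠ T' := by
    rintro rfl
    rw [disjoint_self] at d'
    have := c1.1
    simp_all
  refine ⟨{S', T'}, ⟨?_, ?_⟩, card_pair hne, ?_⟩
  · simp [c1, c2]
  · intro C hC D hD hn
    simp at hC hD
    rcases hC with rfl | rfl <;> rcases hD with rfl | rfl
    · exact absurd rfl hn
    · exact d'
    · exact d'.symm
    · exact absurd rfl hn
  · intro b hb v hv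
    simp at hb
    rcases hb with rfl | rfl
    · exact Or.inl (h1 hv)
    · exact Or.inr (h2 hv)

theorem exists_three {S T U : Finset V} (hS : HasC G S) (hT : HasC G T) (hU : HasC G U)
    (d1 : Disjoint S T) (d2 : Disjoint S U) (d3 : Disjoint T U) :
    ∃ B, Pk G B ∧ B.card = 3 ∧ ∀ b ∈ B, ∀ v ∈ b, v ∈ S ∨ v ∈ T ∨ v ∈ U := by
  obtain ⟨B, hB, hc, hs⟩ := exists_two hS hT d1
  obtain ⟨U', h3, c3⟩ := hU
  have hx := exch (A := ∅) hB (by simp) (Pk_one c3) (by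
    intro b hb v hv
    left
    simp at hb
    subst hb
    rw [mem_R]
    intro C hC hvC
    rcases hs C hC v hvC with h | h
    · exact Finset.disjoint_left.1 d2 h (h3 hv)
    · exact Finset.disjoint_left.1 d3 h (h3 hv))
  refine ⟨_, hx.1, ?_, ?_⟩
  · have := hx.2.1
    simp only [card_empty, card_singleton] at this
    omega
  · intro b hb v hv
    simp only [sdiff_empty, mem_union, mem_singleton] at hb
    rcases hb with hb | rfl
    · have := hs b hb v hv
      tauto
    · exact Or.inr (Or.inr (h3 hv))

structure Opt (G : SimpleGraph V) (k : ℕ) (F : Finset (Finset V)) : Prop where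
  pk : Pk G F
  card : F.card + 1 = k
  min : ∀ F', Pk G F' → F'.card + 1 = k → tot F ≤ tot F'
  no : ∀ F', Pk G F' → F'.card ≠ k

variable {k : ℕ} {F : Finset (Finset V)}

theorem Opt.acyc (o : Opt G k F) : ¬ HasC G (R F) := by
  rintro ⟨T, hT, hc⟩
  have := exch (A := ∅) o.pk (by simp) (Pk_one hc) (by
    intro b hb v hv
    simp at hb
    subst hb
    exact Or.inl (hT hv))
  apply o.no _ this.1
  have h2 := this.2.1
  have := o.card
  simp only [card_empty, card_singleton] at h2
  omega

theorem Opt.two (o : Opt G k F) {C S T : Finset V} (hC : C ∈ F) (hS : HasC G S) (hT : HasC G T)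
    (d : Disjoint S T) (hs : ∀ v ∈ S, v ∈ R F ∨ v ∈ C) (ht : ∀ v ∈ T, v ∈ R F ∨ v ∈ C) : False := by
  obtain ⟨B, hB, hc, hb⟩ := exists_two hS hT d
  have := exch (A := {C}) o.pk (by simpa using hC) hB (by
    intro b hb' v hv
    simp only [mem_singleton, exists_eq_left]
    rcases hb b hb' v hv with h | h
    · exact hs v h
    · exact ht v h)
  apply o.no _ this.1
  have h2 := this.2.1
  have := o.card
  simp only [card_singleton] at h2
  omega

theorem Opt.three (o : Opt G k F) {C D S T U : Finset V} (hC : C ∈ F) (hD : D ∈ F) (hne : C ≠ D)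
    (hS : HasC G S) (hT : HasC G T) (hU : HasC G U)
    (d1 : Disjoint S T) (d2 : Disjoint S U) (d3 : Disjoint T U)
    (hs : ∀ v ∈ S, v ∈ R F ∨ v ∈ C ∨ v ∈ D) (ht : ∀ v ∈ T, v ∈ R F ∨ v ∈ C ∨ v ∈ D)
    (hu : ∀ v ∈ U, v ∈ R F ∨ v ∈ C ∨ v ∈ D) : False := by
  obtain ⟨B, hB, hc, hb⟩ := exists_three hS hT hU d1 d2 d3
  have := exch (A := {C, D}) o.pk (by
      intro x hx
      simp at hx
      rcases hx with rfl | rfl <;> assumption) hB (by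
    intro b hb' v hv
    simp only [mem_insert, mem_singleton, exists_eq_or_imp, exists_eq_left]
    rcases hb b hb' v hv with h | h | h
    · exact hs v h
    · exact ht v h
    · exact hu v h)
  apply o.no _ this.1
  have h2 := this.2.1
  have := o.card
  rw [card_pair hne] at h2
  omega

theorem exch1 (o : Opt G k F) {C T : Finset V} (hC : C ∈ F) (hT : Cyc G T)
    (ht : ∀ v ∈ T, v ∈ R F ∨ v ∈ C) :
    Pk G (F \ {C} ∪ {T}) ∧ (F \ {C} ∪ {T}).card + 1 = k ∧
      tot (F \ {C} ∪ {T}) + C.card = tot F + T.card := by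
  have := exch (A := {C}) o.pk (by simpa using hC) (Pk_one hT) (by
    intro b hb v hv
    simp at hb
    subst hb
    simpa using ht v hv)
  have hc := o.card
  obtain ⟨h1, h2, h3⟩ := this
  simp only [card_singleton, tot, sum_singleton] at h2 h3
  exact ⟨h1, by omega, h3⟩

theorem Opt.le (o : Opt G k F) {C T : Finset V} (hC : C ∈ F) (hT : Cyc G T)
    (ht : ∀ v ∈ T, v ∈ R F ∨ v ∈ C) : C.card ≤ T.card := by
  obtain ⟨h1, h2, h3⟩ := exch1 o hC hT ht
  have := o.min _ h1 h2
  omega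

theorem Opt.swap (o : Opt G k F) {C T : Finset V} (hC : C ∈ F) (hT : Cyc G T)
    (ht : ∀ v ∈ T, v ∈ R F ∨ v ∈ C) (hcard : T.card = C.card) : Opt G k (F \ {C} ∪ {T}) := by
  obtain ⟨h1, h2, h3⟩ := exch1 o hC hT ht
  refine ⟨h1, h2, ?_, o.no⟩
  intro F' hF hk
  have := o.min _ hF hk
  omega

theorem mem_R_swap {C T : Finset V} {v : V} (hv : v ∈ R F ∨ v ∈ C) (h : Pk G F) (hC : C ∈ F)
    (hT : v ∉ T) : v ∈ R (F \ {C} ∪ {T}) := by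
  rw [mem_R]
  intro D hD
  simp only [mem_union, Finset.mem_sdiff, mem_singleton] at hD
  rcases hD with ⟨h1, h2⟩ | rfl
  · rcases hv with hv | hv
    · exact mem_R.1 hv D h1
    · exact fun h3 => Finset.disjoint_left.1 (h.2 D h1 C hC h2) h3 hv
  · exact hT

theorem Opt.deg2 (o : Opt G k F) {C : Finset V} (hC : C ∈ F) : ∀ v ∈ C, nb G C v = 2 :=
  minC_deg (o.pk.1 C hC) fun _ hT hc => o.le hC hc fun _ hv => Or.inr (hT hv)

theorem Opt.nb2 (o : Opt G k F) {C : Finset V} (hC : C ∈ F) {v : V} (hv : v ∈ R F)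
    (h4 : C.card ≠ 3) : nb G C v ≤ 2 := by
  by_contra! h
  have h3 := cyc_card (o.pk.1 C hC)
  obtain ⟨T, hT, hc, hlt⟩ := chord (o.deg2 hC) (by omega) (mem_R.1 hv C hC) h
  have := o.le hC hc (by
    intro w hw
    rcases mem_insert.1 (hT hw) with rfl | h
    · exact Or.inl hv
    · exact Or.inr h)
  omega

theorem Opt.nb3 (o : Opt G k F) {C : Finset V} (hC : C ∈ F) {v : V} (hv : v ∈ R F) :
    nb G C v ≤ 3 := by
  by_cases h : C.card = 3
  · rw [← h]; exact nb_le_card _ _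
  · have := o.nb2 hC hv h; omega

theorem Opt.tri (o : Opt G k F) {C : Finset V} (hC : C ∈ F) (h3 : C.card = 3) :
    ∃ a b c, C = {a, b, c} ∧ G.Adj a b ∧ G.Adj a c ∧ G.Adj b c := by
  have h2 := o.deg2 hC
  obtain ⟨a, b, c, n1, n2, n3, rfl⟩ := card_eq_three.1 h3
  refine ⟨a, b, c, rfl, ?_⟩
  have ha := h2 a (by simp)
  have hb := h2 b (by simp)
  rw [nb_three n1 n2 n3] at ha hb
  simp only [SimpleGraph.irrefl, if_false] at ha hb
  refine ⟨?_, ?_, ?_⟩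
  · by_contra h; simp [h] at ha; split_ifs at ha <;> omega
  · by_contra h; simp [h] at ha; split_ifs at ha <;> omega
  · by_contra h; simp [h] at hb; split_ifs at hb <;> omega

theorem rot1 (a b c : V) : ({a, b, c} : Finset V) = {b, c, a} := by
  ext; simp; tauto

theorem five_aux {a b c x y : V} (h1 : G.Adj a b) (h2 : G.Adj a c) (h3 : G.Adj b c)
    (hx : G.Adj x a ∧ G.Adj x b ∧ G.Adj x c) (hy : 2 ≤ nb G {a, b, c} y) :
    ∃ a' b' c', ({a, b, c} : Finset V) = {a', b', c'} ∧ G.Adj a' b' ∧ G.Adj a' c' ∧ G.Adj b' c' ∧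
      G.Adj x a' ∧ G.Adj x b' ∧ G.Adj x c' ∧ G.Adj y a' ∧ G.Adj y b' := by
  rw [nb_three h1.ne h2.ne h3.ne] at hy
  obtain ⟨x1, x2, x3⟩ := hx
  by_cases ya : G.Adj y a
  · by_cases yb : G.Adj y b
    · exact ⟨a, b, c, rfl, h1, h2, h3, x1, x2, x3, ya, yb⟩
    · by_cases yc : G.Adj y c
      · exact ⟨c, a, b, (rot1 c a b).symm, h2.symm, h3.symm, h1, x3, x1, x2, yc, ya⟩
      · simp [yb, yc] at hy; split_ifs at hy <;> omega
  · by_cases yb : G.Adj y b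
    · by_cases yc : G.Adj y c
      · exact ⟨b, c, a, rot1 a b c, h3, h1.symm, h2.symm, x2, x3, x1, yb, yc⟩
      · simp [ya, yc] at hy; split_ifs at hy <;> omega
    · simp [ya, yb] at hy; split_ifs at hy <;> omega

theorem nb_three_full {a b c x : V} (h1 : G.Adj a b) (h2 : G.Adj a c) (h3 : G.Adj b c)
    (h : 3 ≤ nb G {a, b, c} x) : G.Adj x a ∧ G.Adj x b ∧ G.Adj x c := by
  rw [nb_three h1.ne h2.ne h3.ne] at h
  split_ifs at h <;> first | omega | tauto

theorem Opt.five (o : Opt G k F) {C : Finset V} (hC : C ∈ F) {x y : V} (hx : x ∈ R F)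
    (hy : y ∈ R F) (h5 : 5 ≤ nb G C x + nb G C y) :
    ∃ a b c, C = {a, b, c} ∧ G.Adj a b ∧ G.Adj a c ∧ G.Adj b c ∧
      ((G.Adj x a ∧ G.Adj x b ∧ G.Adj x c ∧ G.Adj y a ∧ G.Adj y b) ∨
       (G.Adj y a ∧ G.Adj y b ∧ G.Adj y c ∧ G.Adj x a ∧ G.Adj x b)) := by
  have h3 : C.card = 3 := by
    by_contra h
    have := o.nb2 hC hx h
    have := o.nb2 hC hy h
    omega
  have b1 := o.nb3 hC hx
  have b2 := o.nb3 hC hy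
  obtain ⟨a, b, c, rfl, e1, e2, e3⟩ := o.tri hC h3
  by_cases hf : 3 ≤ nb G {a, b, c} x
  · obtain ⟨a', b', c', h⟩ := five_aux e1 e2 e3 (nb_three_full e1 e2 e3 hf)
      (by omega : 2 ≤ nb G {a, b, c} y)
    exact ⟨a', b', c', by tauto⟩
  · obtain ⟨a', b', c', h⟩ := five_aux e1 e2 e3
      (nb_three_full e1 e2 e3 (by omega : 3 ≤ nb G {a, b, c} y)) (by omega : 2 ≤ nb G {a, b, c} x)
    exact ⟨a', b', c', by tauto⟩

theorem nb_biUnion {F : Finset (Finset V)} (h : Pk G F) (v : V) :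
    nb G (F.biUnion id) v = ∑ C ∈ F, nb G C v := by
  unfold nb
  rw [filter_biUnion, card_biUnion]
  · rfl
  · intro C hC D hD hne
    exact disjoint_filter_filter (h.2 C hC D hD hne)

theorem deg_eq {F : Finset (Finset V)} (h : Pk G F) (v : V) :
    nb G univ v = nb G (R F) v + ∑ C ∈ F, nb G C v := by
  rw [← nb_biUnion h, ← nb_union]
  · congr 1
    ext; simp [R]
  · exact sdiff_disjoint

theorem card_R {F : Finset (Finset V)} (h : Pk G F) : (R F).card + tot F = Fintype.card V := by
  unfold R tot
  have : (F.biUnion id).card = ∑ C ∈ F, C.card := by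
    rw [card_biUnion]
    · rfl
    · exact h.2
  rw [← this, card_sdiff_add_card_eq_card (subset_univ _), card_univ]


theorem R_ne (F : Finset (Finset V)) {C : Finset V} (hC : C ∈ F) {x y : V} (hx : x ∈ R F)
    (hy : y ∈ C) : x ≠ y := by
  rintro rfl
  exact mem_R.1 hx C hC hy

theorem two_le_nb {S : Finset V} {a x y : V} (hx : x ∈ S) (hy : y ∈ S) (hne : x ≠ y)
    (h1 : G.Adj a x) (h2 : G.Adj a y) : 2 ≤ nb G S a := by
  unfold nb
  rw [← card_pair hne]
  apply card_le_card
  intro z hz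
  simp at hz
  rcases hz with rfl | rfl <;> simp [*]

theorem interior_aux (o : Opt G k F) {p q a b c : V} {m : List V}
    (hl : IsP G (p :: (m ++ [q]))) (hR : ∀ v ∈ p :: (m ++ [q]), v ∈ R F)
    (hC : {a, b, c} ∈ F) (h1 : G.Adj a b) (h2 : G.Adj a c) (h3 : G.Adj b c)
    (p1 : G.Adj p a) (p2 : G.Adj p b) (p3 : G.Adj p c) (q1 : G.Adj q a) (q2 : G.Adj q b)
    {x : V} (hx : x ∈ m) : nb G {a, b, c} x = 0 := by
  have hnd := hl.1
  have ca : ∀ v ∈ R F, v ≠ a := fun v hv => R_ne F hC hv (by simp)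
  have cb : ∀ v ∈ R F, v ≠ b := fun v hv => R_ne F hC hv (by simp)
  have cc : ∀ v ∈ R F, v ≠ c := fun v hv => R_ne F hC hv (by simp)
  simp only [List.nodup_cons, List.mem_append, List.mem_singleton, List.nodup_append] at hnd
  simp only [List.mem_cons, List.mem_append, List.mem_singleton, List.not_mem_nil, or_false] at hR
  have n1 := h1.ne
  have n2 := h2.ne
  have n3 := h3.ne
  have P1 : IsP G (p :: m) := by
    have : IsP G ((p :: m) ++ [q]) := hl
    exact ⟨(List.nodup_append.1 this.1).1, this.2.left_of_append⟩
  have P2 : IsP G (m ++ [q]) := hl.tail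
  have hc : ¬ G.Adj x c := by
    intro h
    refine o.two hC (pathplus P1 (a := c) ?_ (two_le_nb (x := p) (y := x) ?_ ?_ ?_ p3.symm h.symm))
      (cyc3 q1 q2 h1).hasC ?_ ?_ ?_
    · intro h'; simp only [List.mem_cons] at h'; grind
    · simp
    · simp [hx]
    · grind
    · rw [Finset.disjoint_left]
      intro v
      simp only [mem_insert, mem_singleton, List.mem_toFinset, List.mem_cons]
      grind
    · intro v
      simp only [mem_insert, mem_singleton, List.mem_toFinset, List.mem_cons]
      grind
    · intro v
      simp only [mem_insert, mem_singleton]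
      grind
  have key : ∀ d e, G.Adj d e → G.Adj p d → G.Adj p e → ∀ f, f ≠ d → f ≠ e → f ∈ ({a, b, c} : Finset V) →
      d ∈ ({a, b, c} : Finset V) → e ∈ ({a, b, c} : Finset V) → G.Adj q f → ¬ G.Adj x f := by
    intro d e hde hpd hpe f hfd hfe mf md me hqf h
    have cf : ∀ v ∈ R F, v ≠ f := fun v hv => R_ne F hC hv mf
    have cd : ∀ v ∈ R F, v ≠ d := fun v hv => R_ne F hC hv md
    have ce : ∀ v ∈ R F, v ≠ e := fun v hv => R_ne F hC hv me
    refine o.two hC (pathplus P2 (a := f) ?_ (two_le_nb (x := q) (y := x) ?_ ?_ ?_ hqf.symm h.symm))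
      (cyc3 hpd hpe hde).hasC ?_ ?_ ?_
    · intro h'; simp only [List.mem_append, List.mem_singleton] at h'; grind
    · simp
    · simp [hx]
    · grind
    · rw [Finset.disjoint_left]
      intro v
      simp only [mem_insert, mem_singleton, List.mem_toFinset, List.mem_append, List.mem_singleton]
      grind
    · intro v
      simp only [mem_insert, List.mem_toFinset, List.mem_append, List.mem_singleton]
      grind
    · intro v hv
      simp only [mem_insert, mem_singleton] at hv
      grind
  have ha := key b c h3 p2 p3 a n1 n2 (by simp) (by simp) (by simp) q1
  have hb := key a c h2 p1 p3 b n1.symm n3 (by simp) (by simp) (by simp) q2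
  rw [nb_three n1 n2 n3]
  simp [ha, hb, hc]

theorem interior (o : Opt G k F) {p q : V} {m : List V} {C : Finset V}
    (hl : IsP G (p :: (m ++ [q]))) (hR : ∀ v ∈ p :: (m ++ [q]), v ∈ R F)
    (hC : C ∈ F) (h5 : 5 ≤ nb G C p + nb G C q)
    {x : V} (hx : x ∈ m) : nb G C x = 0 := by
  obtain ⟨a, b, c, rfl, h1, h2, h3, h | h⟩ := o.five hC (hR p (by simp)) (hR q (by simp)) h5
  · obtain ⟨x1, x2, x3, y1, y2⟩ := h
    exact interior_aux o hl hR hC h1 h2 h3 x1 x2 x3 y1 y2 hx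
  · obtain ⟨x1, x2, x3, y1, y2⟩ := h
    have e : (p :: (m ++ [q])).reverse = q :: (m.reverse ++ [p]) := by simp
    refine interior_aux (m := m.reverse) o (e ▸ hl.reverse) ?_ hC h1 h2 h3 x1 x2 x3 y1 y2 (by simpa using hx)
    intro v hv
    apply hR
    rw [← e] at hv
    exact List.mem_reverse.1 hv

theorem exists_five (o : Opt G k F)
    (hdeg : ∀ x y, x ≠ y → ¬ G.Adj x y → 4 * k ≤ nb G univ x + nb G univ y + 1)
    {x y : V} (hne : x ≠ y) (hadj : ¬ G.Adj x y)
    (h2 : nb G (R F) x + nb G (R F) y ≤ 2) : ∃ C ∈ F, 5 ≤ nb G C x + nb G C y := by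
  by_contra! h
  have hd := hdeg x y hne hadj
  rw [deg_eq o.pk, deg_eq o.pk] at hd
  have : ∑ C ∈ F, (nb G C x + nb G C y) ≤ ∑ C ∈ F, 4 :=
    sum_le_sum fun C hC => by have := h C hC; omega
  rw [sum_add_distrib] at this
  simp at this
  have := o.card
  omega

theorem end_deg (o : Opt G k F) {p : V} {l : List V} (hl : IsP G (p :: l))
    (hR : ∀ v ∈ p :: l, v ∈ R F)
    (hmax : ∀ l', IsP G l' → (∀ v ∈ l', v ∈ R F) → l'.length ≤ (p :: l).length) :
    (∀ v ∈ R F, G.Adj v p → v ∈ l) ∧ nb G (R F) p ≤ 1 := by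
  have h1 : ∀ v ∈ R F, G.Adj v p → v ∈ l := by
    intro v hv hvp
    by_contra hvl
    have hn : v ∉ p :: l := by
      simp only [List.mem_cons, not_or]
      exact ⟨hvp.ne, hvl⟩
    have := hmax _ (hl.cons hvp hn) (by
      intro w hw
      rcases List.mem_cons.1 hw with rfl | hw
      · exact hv
      · exact hR w hw)
    simp at this
  refine ⟨h1, ?_⟩
  by_contra! h
  apply o.acyc
  have : nb G (R F) p ≤ nb G l.toFinset p := by
    unfold nb
    apply card_le_card
    intro v hv
    simp at hv ⊢
    exact ⟨h1 v hv.1 hv.2.symm, hv.2⟩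
  refine (pathplus hl.tail (List.nodup_cons.1 hl.1).1 (by omega)).mono ?_
  intro v hv
  simp at hv
  exact hR v (by simpa using hv)

theorem exists_leaf (o : Opt G k F) {l : List V} (hl : IsP G l) (hne : l ≠ [])
    (hR : ∀ v ∈ l, v ∈ R F) {w : V} (hw : w ∈ R F) (hwl : w ∉ l) :
    ∃ v ∈ R F, v ∉ l ∧ nb G (R F) v ≤ 1 := by
  by_contra! h
  have hsub : l.toFinset ⊆ R F := by
    intro v hv; exact hR v (by simpa using hv)
  set P := l.toFinset with hP
  set W := R F \ P with hW
  have hPW : P ∪ W = R F := union_sdiff_of_subset hsub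
  have hd : Disjoint P W := disjoint_sdiff
  have hac := acyc_sum _ (R F) rfl ⟨w, hw⟩ o.acyc
  rw [← hPW] at hac
  rw [sum_union hd, card_union_of_disjoint hd] at hac
  have s1 := hl.sum hne
  rw [← hP] at s1
  have hc : P.card = l.length := List.toFinset_card_of_nodup hl.1
  have e1 : ∑ v ∈ P, nb G (P ∪ W) v = ∑ v ∈ P, nb G P v + ∑ v ∈ P, nb G W v := by
    rw [← sum_add_distrib]
    exact sum_congr rfl fun v _ => nb_union hd v
  have hWm : ∀ v ∈ W, 2 ≤ nb G (P ∪ W) v := by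
    intro v hv
    rw [hPW]
    rw [hW, Finset.mem_sdiff] at hv
    exact h v hv.1 (by simpa [hP] using hv.2)
  have s2 : ∑ v ∈ W, 2 ≤ ∑ v ∈ W, nb G (P ∪ W) v := sum_le_sum hWm
  simp at s2
  have z : ∑ v ∈ P, nb G W v = 0 := by omega
  rw [sum_nb_comm, sum_eq_zero_iff] at z
  apply o.acyc
  refine ⟨W, sdiff_subset, ⟨w, by simp [hW, hP, hw, hwl]⟩, ?_⟩
  intro v hv
  have := hWm v hv
  rw [nb_union hd, z v hv] at this
  omega

theorem card_three {a b c : V} (h1 : G.Adj a b) (h2 : G.Adj a c) (h3 : G.Adj b c) :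
    ({a, b, c} : Finset V).card = 3 := card_eq_three.2 ⟨a, b, c, h1.ne, h2.ne, h3.ne, rfl⟩

/-- longer path via a swap -/
theorem longer (o : Opt G k F) {p v a b c : V} {l : List V} (hl : IsP G (p :: l))
    (hR : ∀ v ∈ p :: l, v ∈ R F) (hv : v ∈ R F) (hvl : v ∉ p :: l) (hC : {a, b, c} ∈ F)
    (h1 : G.Adj a b) (h2 : G.Adj a c) (h3 : G.Adj b c)
    (va : G.Adj v a) (vb : G.Adj v b) (pc : G.Adj p c)
    (hmax : ∀ F' l', Opt G k F' → IsP G l' → (∀ v ∈ l', v ∈ R F') →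
      l'.length ≤ (p :: l).length) : False := by
  have cv : ∀ w ∈ R F, ∀ x ∈ ({a, b, c} : Finset V), w ≠ x := fun w hw x hx => R_ne F hC hw hx
  simp only [mem_insert, mem_singleton] at cv
  have o' := o.swap hC (cyc3 va vb h1) (by
    intro w hw; simp at hw ⊢; grind) (by rw [card_three va vb h1, card_three h1 h2 h3])
  have := hmax _ (c :: p :: l) o' (hl.cons pc.symm (by grind)) (by
    intro w hw
    apply mem_R_swap _ o.pk hC
    · simp only [mem_insert, mem_singleton]
      have := h1.ne
      have := h2.ne
      have := h3.ne
      grind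
    · simp only [mem_insert, mem_singleton]
      grind)
  simp at this

theorem spanning (o : Opt G k F)
    (hdeg : ∀ x y, x ≠ y → ¬ G.Adj x y → 4 * k ≤ nb G univ x + nb G univ y + 1)
    {p : V} {l : List V} (hl : IsP G (p :: l))
    (hR : ∀ v ∈ p :: l, v ∈ R F)
    (hmax : ∀ F' l', Opt G k F' → IsP G l' → (∀ v ∈ l', v ∈ R F') →
      l'.length ≤ (p :: l).length) : ∀ v ∈ R F, v ∈ p :: l := by
  by_contra! h
  obtain ⟨w, hw, hwl⟩ := h
  obtain ⟨v, hv, hvl, hv1⟩ := exists_leaf o hl (by simp) hR hw hwl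
  obtain ⟨e1, e2⟩ := end_deg o hl hR (fun l' => hmax F l' o)
  have hpv : ¬ G.Adj p v := fun h => hvl (List.mem_cons_of_mem _ (e1 v hv h.symm))
  have hpR := hR p (by simp)
  obtain ⟨C, hC, h5⟩ := exists_five o hdeg (x := p) (y := v) (by rintro rfl; simp at hvl) hpv (by omega)
  obtain ⟨a, b, c, rfl, h1, h2, h3, h | h⟩ := o.five hC hpR hv h5
  · obtain ⟨x1, x2, x3, y1, y2⟩ := h
    exact longer o hl hR hv hvl hC h1 h2 h3 y1 y2 x3 hmax
  · obtain ⟨x1, x2, x3, y1, y2⟩ := h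
    rw [rot1] at hC
    exact longer o hl hR hv hvl hC h3 h1.symm h2.symm x2 x3 y1 hmax


theorem nine_nat (a b c d e f g h i j k l : ℕ) (ha : a ≤ 1) (hb : b ≤ 1) (hc : c ≤ 1) (hd : d ≤ 1)
    (he : e ≤ 1) (hf : f ≤ 1) (hg : g ≤ 1) (hh : h ≤ 1) (hi : i ≤ 1) (hj : j ≤ 1) (hk : k ≤ 1)
    (hl : l ≤ 1) (H : 9 ≤ (a+b+c)+(d+e+f)+(g+h+i)+(j+k+l))
    (c1 : a + d + h + i ≤ 3) (c2 : b + e + g + i ≤ 3) (c3 : c + f + g + h ≤ 3)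
    (c4 : a + d + k + l ≤ 3) (c5 : b + e + j + l ≤ 3) (c6 : c + f + j + k ≤ 3)
    (c7 : g + j + b + c ≤ 3) (c8 : h + k + a + c ≤ 3) (c9 : i + l + a + b ≤ 3)
    (d7 : g + j + e + f ≤ 3) (d8 : h + k + d + f ≤ 3) (d9 : i + l + d + e ≤ 3) : False := by
  omega

theorem nine (o : Opt G k F) {p p' q q' : V} {C : Finset V} (hC : C ∈ F)
    (hp : p ∈ R F) (hp' : p' ∈ R F) (hq : q ∈ R F) (hq' : q' ∈ R F)
    (h1 : G.Adj p p') (h2 : G.Adj q q') (n1 : p ≠ q) (n2 : p ≠ q') (n3 : p' ≠ q) (n4 : p' ≠ q')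
    (h9 : 9 ≤ nb G C p + nb G C p' + nb G C q + nb G C q') : False := by
  have h3 : C.card = 3 := by
    by_contra h
    have := o.nb2 hC hp h
    have := o.nb2 hC hp' h
    have := o.nb2 hC hq h
    have := o.nb2 hC hq' h
    omega
  obtain ⟨a, b, c, rfl, e1, e2, e3⟩ := o.tri hC h3
  have key : ∀ p p' q, p ∈ R F → p' ∈ R F → q ∈ R F → G.Adj p p' → q ≠ p → q ≠ p' →
      ∀ x y z, x ∈ ({a, b, c} : Finset V) → y ∈ ({a, b, c} : Finset V) →
      z ∈ ({a, b, c} : Finset V) → x ≠ y → x ≠ z → G.Adj y z →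
      (if G.Adj p x then 1 else 0) + (if G.Adj p' x then 1 else 0) +
      (if G.Adj q y then 1 else 0) + (if G.Adj q z then 1 else 0) ≤ 3 := by
    intro p p' q hp hp' hq hpp hqp hqp' x y z hx hy hz hxy hxz hyz
    by_contra! hcon
    have : G.Adj p x ∧ G.Adj p' x ∧ G.Adj q y ∧ G.Adj q z := by
      split_ifs at hcon <;> first | omega | tauto
    obtain ⟨a1, a2, a3, a4⟩ := this
    have cx := fun v hv => R_ne F hC (x := v) hv hx
    have cy := fun v hv => R_ne F hC (x := v) hv hy
    have cz := fun v hv => R_ne F hC (x := v) hv hz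
    refine o.two hC (cyc3 hpp a1 a2).hasC (cyc3 a3 a4 hyz).hasC ?_ ?_ ?_
    · rw [Finset.disjoint_left]
      intro v h h'
      simp only [mem_insert, mem_singleton] at h h'
      grind
    · intro v h
      simp only [mem_insert, mem_singleton] at h
      grind
    · intro v h
      simp only [mem_insert, mem_singleton] at h
      grind
  simp only [nb_three e1.ne e2.ne e3.ne] at h9
  have ma : a ∈ ({a, b, c} : Finset V) := by simp
  have mb : b ∈ ({a, b, c} : Finset V) := by simp
  have mc : c ∈ ({a, b, c} : Finset V) := by simp
  have le1 : ∀ v w, (if G.Adj v w then 1 else 0) ≤ 1 := by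
    intro v w; split_ifs <;> omega
  have A := fun q hq h h' => key p p' q hp hp' hq h1 h h' a b c ma mb mc e1.ne e2.ne e3
  have B := fun q hq h h' => key p p' q hp hp' hq h1 h h' b a c mb ma mc e1.ne' e3.ne e2
  have D := fun q hq h h' => key p p' q hp hp' hq h1 h h' c a b mc ma mb e2.ne' e3.ne' e1
  have A' := fun p hp h h' => key q q' p hq hq' hp h2 h h' a b c ma mb mc e1.ne e2.ne e3
  have B' := fun p hp h h' => key q q' p hq hq' hp h2 h h' b a c mb ma mc e1.ne' e3.ne e2
  have D' := fun p hp h h' => key q q' p hq hq' hp h2 h h' c a b mc ma mb e2.ne' e3.ne' e1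
  exact nine_nat _ _ _ _ _ _ _ _ _ _ _ _ (le1 p a) (le1 p b) (le1 p c) (le1 p' a) (le1 p' b)
    (le1 p' c) (le1 q a) (le1 q b) (le1 q c) (le1 q' a) (le1 q' b) (le1 q' c) h9
    (A q hq n1.symm n3.symm) (B q hq n1.symm n3.symm) (D q hq n1.symm n3.symm)
    (A q' hq' n2.symm n4.symm) (B q' hq' n2.symm n4.symm) (D q' hq' n2.symm n4.symm)
    (A' p hp n1 n2) (B' p hp n1 n2) (D' p hp n1 n2)
    (A' p' hp' n3 n4) (B' p' hp' n3 n4) (D' p' hp' n3 n4)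

theorem path_deg (o : Opt G k F) {p p' : V} {l : List V} (hl : IsP G (p :: p' :: l))
    (hR : R F = (p :: p' :: l).toFinset) :
    nb G (R F) p ≤ 1 ∧ nb G (R F) p' ≤ 2 ∧ ∀ x ∈ l, ¬ G.Adj p x := by
  have hnd := hl.1
  simp only [List.nodup_cons] at hnd
  have hadj : G.Adj p p' := (List.isChain_cons_cons.1 hl.2).1
  have hp1 : nb G (R F) p ≤ 1 := by
    by_contra! h
    rw [hR, List.toFinset_cons, nb_insert (by simpa using hnd.1)] at h
    simp only [SimpleGraph.irrefl, if_false] at h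
    have := pathplus hl.tail hnd.1 h
    apply o.acyc
    rw [hR, List.toFinset_cons]
    exact this
  refine ⟨hp1, ?_, ?_⟩
  · by_contra! h
    rw [hR, List.toFinset_cons, nb_insert (by simpa using hnd.1), List.toFinset_cons,
      nb_insert (by simpa using hnd.2.1)] at h
    simp only [SimpleGraph.irrefl, if_false] at h
    have := pathplus hl.tail.tail hnd.2.1 (by split_ifs at h <;> omega)
    apply o.acyc
    rw [hR, List.toFinset_cons, List.toFinset_cons]
    exact this.mono (subset_insert _ _)
  · intro x hx h
    have : 2 ≤ nb G (R F) p := by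
      apply two_le_nb (x := p') (y := x) _ _ _ hadj h
      · simp [hR]
      · simp [hR, hx]
      · rintro rfl; exact hnd.2.1 hx
    omega

theorem final4 (o : Opt G k F)
    (hdeg : ∀ x y, x ≠ y → ¬ G.Adj x y → 4 * k ≤ nb G univ x + nb G univ y + 1)
    {p p' q q' : V} {m : List V} (hl : IsP G (p :: p' :: (m ++ [q', q])))
    (hR : R F = (p :: p' :: (m ++ [q', q])).toFinset) : False := by
  have er : (p :: p' :: (m ++ [q', q])).reverse = q :: q' :: (m.reverse ++ [p', p]) := by simp
  have hl' : IsP G (q :: q' :: (m.reverse ++ [p', p])) := er ▸ hl.reverse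
  have hR' : R F = (q :: q' :: (m.reverse ++ [p', p])).toFinset := by
    rw [hR, ← er, List.toFinset_reverse]
  obtain ⟨d1, d2, d3⟩ := path_deg o hl hR
  obtain ⟨f1, f2, f3⟩ := path_deg o hl' hR'
  have hnd := hl.1
  have a1 : G.Adj p p' := (List.isChain_cons_cons.1 hl.2).1
  have a2 : G.Adj q q' := (List.isChain_cons_cons.1 hl'.2).1
  have hm : ∀ v, v ∈ R F ↔ v ∈ p :: p' :: (m ++ [q', q]) := by intro v; rw [hR, List.mem_toFinset]
  have npq : p ≠ q ∧ p ≠ q' ∧ p' ≠ q ∧ p' ≠ q' := by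
    simp at hnd; tauto
  obtain ⟨n1, n2, n3, n4⟩ := npq
  have mp : p ∈ R F := by simp [hm]
  have mp' : p' ∈ R F := by simp [hm]
  have mq : q ∈ R F := by simp [hm]
  have mq' : q' ∈ R F := by simp [hm]
  have b1 : ¬ G.Adj p q := d3 q (by simp)
  have b2 : ¬ G.Adj p q' := d3 q' (by simp)
  have b3 : ¬ G.Adj p' q := fun h => f3 p' (by simp) h.symm
  obtain ⟨C, hC, h5⟩ := exists_five o hdeg n1 b1 (by omega)
  have hi := fun x => interior o (p := p) (q := q) (m := p' :: (m ++ [q'])) (C := C) (x := x)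
    (by simpa using hl) (by intro v hv; rw [hm]; simpa using hv) hC h5
  have z1 := hi p' (by simp)
  have z2 := hi q' (by simp)
  have u1 := o.nb3 hC mp
  have u2 := o.nb3 hC mq
  have g1 := hdeg p q' n2 b2
  have g2 := hdeg p' q n3 b3
  simp only [deg_eq o.pk] at g1 g2
  have hs : ∑ D ∈ F, (nb G D p + nb G D p' + nb G D q + nb G D q') < ∑ D ∈ F, 8 := by
    apply sum_lt_sum
    · intro D hD
      by_contra! h
      exact nine o hD mp mp' mq mq' a1 a2 n1 n2 n3 n4 (by omega)
    · exact ⟨C, hC, by omega⟩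
  simp only [sum_add_distrib, sum_const, smul_eq_mul] at hs
  have := o.card
  omega

set_option maxHeartbeats 2000000 in
theorem final3 (o : Opt G k F)
    (hdeg : ∀ x y, x ≠ y → ¬ G.Adj x y → 4 * k ≤ nb G univ x + nb G univ y + 1)
    {p q r a b c : V} (hl : IsP G [p, q, r]) (hR : R F = {p, q, r}) (hC : {a, b, c} ∈ F)
    (h1 : G.Adj a b) (h2 : G.Adj a c) (h3 : G.Adj b c)
    (pa : G.Adj p a) (pb : G.Adj p b) (pc : G.Adj p c) (ra : G.Adj r a) (rb : G.Adj r b) :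
    False := by
  have hnd := hl.1
  simp only [List.nodup_cons, List.mem_cons, List.not_mem_nil, or_false, not_or] at hnd
  obtain ⟨⟨npq, npr⟩, nqr, -⟩ := hnd
  have hch := hl.2
  simp only [List.isChain_cons_cons] at hch
  obtain ⟨apq, aqr, -⟩ := hch
  have mp : p ∈ R F := by simp [hR]
  have mq : q ∈ R F := by simp [hR]
  have mr : r ∈ R F := by simp [hR]
  have apr : ¬ G.Adj p r := fun h => o.acyc (hR ▸ (cyc3 apq h aqr).hasC)
  have mc : c ∈ ({a, b, c} : Finset V) := by simp
  have hca := fun v hv => R_ne F hC (x := v) hv (y := a) (by simp)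
  have hcb := fun v hv => R_ne F hC (x := v) hv (y := b) (by simp)
  have hcc := fun v hv => R_ne F hC (x := v) hv (y := c) (by simp)
  have hint : ∀ D ∈ F, 5 ≤ nb G D p + nb G D r → nb G D q = 0 := by
    intro D hD h5
    exact interior o (p := p) (q := r) (m := [q]) hl (by simp [hR]) hD h5 (by simp)
  have ep : nb G {a, b, c} p = 3 := by rw [nb_three h1.ne h2.ne h3.ne]; simp [pa, pb, pc]
  have er : 2 ≤ nb G {a, b, c} r := by rw [nb_three h1.ne h2.ne h3.ne]; simp [ra, rb]
  have er3 := o.nb3 hC mr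
  have eq0 := hint _ hC (by omega)
  have aqc : ¬ G.Adj q c := by
    intro h
    rw [nb_three h1.ne h2.ne h3.ne] at eq0
    simp [h] at eq0
  -- the swapped packing
  have o' := o.swap hC (cyc3 ra rb h1) (by
    intro w hw
    simp only [mem_insert, mem_singleton] at hw ⊢
    grind) (by rw [card_three ra rb h1, card_three h1 h2 h3])
  have mR' : ∀ v ∈ [c, p, q], v ∈ R (F \ {{a, b, c}} ∪ {{r, a, b}}) := by
    intro v hv
    have := h2.ne
    have := h3.ne
    apply mem_R_swap _ o.pk hC
    · simp only [mem_insert, mem_singleton]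
      grind
    · simp only [mem_insert, mem_singleton]
      grind
  have hl' : IsP G [c, p, q] := by
    have : IsP G [p, q] := ⟨by simp [npq], by simp [apq]⟩
    refine this.cons pc.symm ?_
    simp only [List.mem_cons, List.not_mem_nil, or_false, not_or]
    exact ⟨(hcc p mp).symm, (hcc q mq).symm⟩
  have bound : ∀ D ∈ F.erase {a, b, c},
      (nb G D p + nb G D r) + 2 * (nb G D q + nb G D c) ≤ 12 := by
    intro D hD
    obtain ⟨hDne, hDF⟩ := mem_erase.1 hD
    have hD' : D ∈ F \ {{a, b, c}} ∪ {{r, a, b}} := by simp [hDne, hDF]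
    have up := o.nb3 hDF mp
    have ur := o.nb3 hDF mr
    have uq := o.nb3 hDF mq
    have uc := o'.nb3 hD' (mR' c (by simp))
    by_cases c1 : 5 ≤ nb G D p + nb G D r
    · have := hint D hDF c1
      omega
    by_cases c2 : nb G D q + nb G D c ≤ 4
    · omega
    have hp0 := interior o' (p := c) (q := q) (m := [p]) (x := p) hl' mR' hD' (by omega) (by simp)
    obtain ⟨d, e, f, rfl, k1, k2, k3, hh⟩ := o'.five hD' (mR' q (by simp)) (mR' c (by simp))
      (by omega)
    have dCD : Disjoint ({a, b, c} : Finset V) {d, e, f} := o.pk.2 _ hC _ hDF hDne.symm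
    have key : ∀ x y z, x ∈ ({d, e, f} : Finset V) → y ∈ ({d, e, f} : Finset V) →
        z ∈ ({d, e, f} : Finset V) → x ≠ y → x ≠ z → G.Adj y z → G.Adj q x → G.Adj c y →
        G.Adj c z → ¬ G.Adj r x := by
      intro x y z hx hy hz hxy hxz hyz hqx hcy hcz hrx
      have cx := fun v hv => R_ne F hDF (x := v) hv hx
      have cy := fun v hv => R_ne F hDF (x := v) hv hy
      have cz := fun v hv => R_ne F hDF (x := v) hv hz
      have dj : ∀ v ∈ ({d, e, f} : Finset V), v ≠ a ∧ v ≠ b ∧ v ≠ c := by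
        intro v hv
        have := Finset.disjoint_right.1 dCD hv
        simpa only [mem_insert, mem_singleton, not_or] using this
      have dx := dj x hx
      have dy := dj y hy
      have dz := dj z hz
      have := h2.ne
      have := h3.ne
      refine o.three hC hDF hDne.symm (cyc3 aqr hqx hrx).hasC (cyc3 hcy hcz hyz).hasC
        (cyc3 pa pb h1).hasC ?_ ?_ ?_ ?_ ?_ ?_
      · rw [Finset.disjoint_left]
        intro v h h'
        simp only [mem_insert, mem_singleton] at h h'
        grind
      · rw [Finset.disjoint_left]
        intro v h h'
        simp only [mem_insert, mem_singleton] at h h'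
        grind
      · rw [Finset.disjoint_left]
        intro v h h'
        simp only [mem_insert, mem_singleton] at h h'
        grind
      · intro v h
        simp only [mem_insert, mem_singleton] at h
        rcases h with rfl | rfl | rfl
        · exact Or.inl mq
        · exact Or.inl mr
        · exact Or.inr (Or.inr hx)
      · intro v h
        simp only [mem_insert, mem_singleton] at h
        rcases h with rfl | rfl | rfl
        · exact Or.inr (Or.inl mc)
        · exact Or.inr (Or.inr hy)
        · exact Or.inr (Or.inr hz)
      · intro v h
        rw [mem_insert, mem_insert, mem_singleton] at h
        rcases h with rfl | rfl | rfl
        · exact Or.inl mp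
        · right; left; simp
        · right; left; simp
    have K1 := key d e f (by simp) (by simp) (by simp) k1.ne k2.ne k3
    have K2 := key e d f (by simp) (by simp) (by simp) k1.ne' k3.ne k2
    have K3 := key f d e (by simp) (by simp) (by simp) k2.ne' k3.ne' k1
    rw [hp0]
    rcases hh with ⟨x1, x2, x3, y1, y2⟩ | ⟨x1, x2, x3, y1, y2⟩
    · have R3 := K3 x3 y1 y2
      by_cases y3 : G.Adj c f
      · have R1 := K1 x1 y2 y3
        have R2 := K2 x2 y1 y3
        have : nb G {d, e, f} r = 0 := by
          rw [nb_three k1.ne k2.ne k3.ne]; simp [R1, R2, R3]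
        omega
      · have e1 : nb G {d, e, f} r ≤ 2 := by
          rw [nb_three k1.ne k2.ne k3.ne]; simp only [R3, if_false]; split_ifs <;> omega
        have e2 : nb G {d, e, f} c ≤ 2 := by
          rw [nb_three k1.ne k2.ne k3.ne]; simp only [y3, if_false]; split_ifs <;> omega
        omega
    · have R1 := K1 y1 x2 x3
      have R2 := K2 y2 x1 x3
      by_cases y3 : G.Adj q f
      · have R3 := K3 y3 x1 x2
        have : nb G {d, e, f} r = 0 := by
          rw [nb_three k1.ne k2.ne k3.ne]; simp [R1, R2, R3]
        omega
      · have e1 : nb G {d, e, f} r ≤ 2 := by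
          rw [nb_three k1.ne k2.ne k3.ne]; simp only [R1, if_false]; split_ifs <;> omega
        have e2 : nb G {d, e, f} q ≤ 2 := by
          rw [nb_three k1.ne k2.ne k3.ne]; simp only [y3, if_false]; split_ifs <;> omega
        omega
  have hsum := sum_le_sum bound
  have g1 := hdeg p r npr apr
  have g2 := hdeg q c (hcc q mq) aqc
  simp only [deg_eq o.pk, ← add_sum_erase F _ hC] at g1 g2
  simp only [sum_add_distrib, ← mul_sum, sum_const, smul_eq_mul, card_erase_of_mem hC] at hsum
  have hk := o.card
  have hF : 0 < F.card := card_pos.2 ⟨_, hC⟩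
  have arp : ¬ G.Adj r p := fun h => apr h.symm
  have acq : ¬ G.Adj c q := fun h => aqc h.symm
  have r1 : nb G (R F) p ≤ 1 := by
    rw [hR, nb_three npq npr nqr]; simp only [apr, SimpleGraph.irrefl, if_false]; split_ifs <;> omega
  have r2 : nb G (R F) r ≤ 1 := by
    rw [hR, nb_three npq npr nqr]; simp only [arp, SimpleGraph.irrefl, if_false]; split_ifs <;> omega
  have r3 : nb G (R F) q ≤ 2 := by
    rw [hR, nb_three npq npr nqr]; simp only [SimpleGraph.irrefl, if_false]; split_ifs <;> omega
  have r4 : nb G (R F) c ≤ 2 := by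
    rw [hR, nb_three npq npr nqr]; simp only [acq, if_false]; split_ifs <;> omega
  have r5 := o.deg2 hC c mc
  omega

theorem core (hdeg : ∀ x y, x ≠ y → ¬ G.Adj x y → 4 * k ≤ nb G univ x + nb G univ y + 1)
    (hno : ∀ F', Pk G F' → F'.card ≠ k) {F0 : Finset (Finset V)} (h0 : Pk G F0)
    (hk0 : F0.card + 1 = k) (hR0 : 3 ≤ (R F0).card) : False := by
  obtain ⟨F1, hF1, hmin⟩ := (univ.filter fun F : Finset (Finset V) => Pk G F ∧ F.card + 1 = k).exists_min_image
    tot ⟨F0, by simp [h0, hk0]⟩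
  simp only [mem_filter, mem_univ, true_and] at hF1 hmin
  have o1 : Opt G k F1 := ⟨hF1.1, hF1.2, fun F' h h' => hmin F' ⟨h, h'⟩, hno⟩
  have hcard : ∀ F, Opt G k F → 3 ≤ (R F).card := by
    intro F o
    have := o.min F0 h0 hk0
    have := card_R h0
    have := card_R o.pk
    omega
  let Q : ℕ → Prop := fun n => ∃ F l, Opt G k F ∧ IsP G l ∧ (∀ v ∈ l, v ∈ R F) ∧ l.length = n
  have hQb : ∀ n, Q n → n ≤ Fintype.card V := by
    rintro n ⟨F, l, -, hl, -, rfl⟩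
    exact hl.1.length_le_card
  have hQ0 : Q 0 := ⟨F1, [], o1, ⟨by simp, by simp⟩, by simp, rfl⟩
  obtain ⟨F, l, o, hl, hlR, hlen⟩ := Nat.findGreatest_spec (P := Q) (Nat.zero_le (Fintype.card V)) hQ0
  have hmax : ∀ F' l', Opt G k F' → IsP G l' → (∀ v ∈ l', v ∈ R F') → l'.length ≤ l.length := by
    intro F' l' o' hl' hR'
    rw [hlen]
    have hq : Q l'.length := ⟨F', l', o', hl', hR', rfl⟩
    exact Nat.le_findGreatest (hQb _ hq) hq
  clear hlen
  have hc := hcard F o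
  cases l with
  | nil =>
    obtain ⟨v, hv⟩ := card_pos.1 (by omega : 0 < (R F).card)
    have := hmax F [v] o ⟨by simp, by simp⟩ (by simpa using hv)
    simp at this
  | cons p l =>
    have hsp := spanning o hdeg hl hlR hmax
    have hR : R F = (p :: l).toFinset := by
      ext v
      rw [List.mem_toFinset]
      exact ⟨hsp v, hlR v⟩
    rw [hR, List.toFinset_card_of_nodup hl.1] at hc
    clear hmax hsp
    match l, hl, hlR, hR, hc with
    | [], _, _, _, hc => simp at hc
    | [_], _, _, _, hc => simp at hc
    | [q, r], hl, hlR, hR, _ =>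
      have hR1 : R F = {p, q, r} := by rw [hR]; ext; simp
      have hR2 : R F = {r, q, p} := by rw [hR]; ext; simp; tauto
      obtain ⟨d1, -, d3⟩ := path_deg o hl hR
      have hlr : IsP G [r, q, p] := hl.reverse
      obtain ⟨f1, -, -⟩ := path_deg o hlr (by rw [hR2]; ext; simp)
      have hne : p ≠ r := by
        have := hl.1
        simp at this
        tauto
      obtain ⟨C, hC, h5⟩ := exists_five o hdeg hne (d3 r (by simp)) (by omega)
      obtain ⟨a, b, c, rfl, h1, h2, h3, h | h⟩ := o.five hC (hlR p (by simp)) (hlR r (by simp)) h5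
      · obtain ⟨x1, x2, x3, y1, y2⟩ := h
        exact final3 o hdeg hl hR1 hC h1 h2 h3 x1 x2 x3 y1 y2
      · obtain ⟨x1, x2, x3, y1, y2⟩ := h
        exact final3 o hdeg hlr hR2 hC h1 h2 h3 x1 x2 x3 y1 y2
    | p' :: x :: y :: m, hl, _, hR, _ =>
      obtain ⟨n, q, e1⟩ : ∃ n q, x :: y :: m = n ++ [q] :=
        ⟨_, _, (List.dropLast_append_getLast (l := x :: y :: m) (by simp)).symm⟩
      have hn : n ≠ [] := by
        rintro rfl
        simp at e1
      have e2 := List.dropLast_append_getLast hn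
      rw [← e2, List.append_assoc] at e1
      rw [e1] at hl hR
      exact final4 o hdeg hl hR

theorem exists_cycle {S : Finset V} (h : Cyc G S) :
    ∃ (v : V) (w : G.Walk v v), w.IsCycle ∧ ∀ x ∈ w.support, x ∈ S := by
  set H := G.induce (S : Set V) with hH
  have hna : ¬ H.IsAcyclic := by
    intro hac
    let Q : ℕ → Prop := fun n => ∃ (u v : (S : Set V)) (p : H.Walk u v), p.IsPath ∧ p.length = n
    have hQb : ∀ n, Q n → n ≤ Fintype.card (S : Set V) := by
      rintro n ⟨u, v, p, hp, rfl⟩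
      exact hp.length_lt.le
    obtain ⟨s, hs⟩ := h.1
    have hQ0 : Q 0 := ⟨⟨s, hs⟩, ⟨s, hs⟩, SimpleGraph.Walk.nil, by simp, rfl⟩
    obtain ⟨u, v, p, hp, hlen⟩ := Nat.findGreatest_spec (P := Q) (Nat.zero_le (Fintype.card (S : Set V))) hQ0
    have hmx : ∀ n, Q n → n ≤ p.length := fun n hn => by
      rw [hlen]
      exact Nat.le_findGreatest (hQb n hn) hn
    have hall : ∀ w, H.Adj u w → w = p.snd := by
      intro w hw
      apply hac.eq_snd_of_adj_start hp hw
      by_contra hn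
      have hq : Q (p.length + 1) :=
        ⟨w, v, SimpleGraph.Walk.cons hw.symm p, hp.cons hn, by simp⟩
      have := hmx _ hq
      omega
    have h2 := h.2 u u.2
    obtain ⟨x, hx, y, hy, hxy⟩ := one_lt_card.1 (show 1 < _ from h2)
    simp only [mem_filter] at hx hy
    have e1 := hall ⟨x, hx.1⟩ (by simpa [hH] using hx.2)
    have e2 := hall ⟨y, hy.1⟩ (by simpa [hH] using hy.2)
    exact hxy (congrArg Subtype.val (e1.trans e2.symm))
  unfold SimpleGraph.IsAcyclic at hna
  push Not at hna
  obtain ⟨v, w, hw⟩ := hna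
  let f : H ↪g G := SimpleGraph.Embedding.induce (S : Set V)
  refine ⟨_, w.map f.toHom, hw.map f.injective, ?_⟩
  intro x hx
  rw [SimpleGraph.Walk.support_map, List.mem_map] at hx
  obtain ⟨y, -, rfl⟩ := hx
  exact y.2

theorem Cyc.of_sup {S : Finset V} {x y : V} (h : Cyc (G ⊔ SimpleGraph.edge x y) S) (hx : x ∉ S) :
    Cyc G S := by
  refine ⟨h.1, fun v hv => (h.2 v hv).trans ?_⟩
  unfold nb
  apply card_le_card
  intro w hw
  simp only [mem_filter, SimpleGraph.sup_adj, SimpleGraph.edge_adj] at hw ⊢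
  refine ⟨hw.1, ?_⟩
  rcases hw.2 with h1 | ⟨⟨rfl, rfl⟩ | ⟨rfl, rfl⟩, -⟩
  · exact h1
  · exact absurd hv hx
  · exact absurd hw.1 hx

theorem nb_le_of_le {G G' : SimpleGraph V} (h : G ≤ G') (S : Finset V) (v : V) :
    nb G S v ≤ nb G' S v :=
  card_le_card (monotone_filter_right _ fun _ _ hw => h hw)

theorem complete_case {k : ℕ} (hcard : 3 * k ≤ Fintype.card V) (h : ∀ x y, x ≠ y → G.Adj x y) :
    ∃ F, Pk G F ∧ F.card = k := by
  obtain ⟨f⟩ := Function.Embedding.nonempty_of_card_le (α := Fin k × Fin 3) (β := V)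
    (by simp; omega)
  let S : Fin k → Finset V := fun i => {f (i, 0), f (i, 1), f (i, 2)}
  have hmem : ∀ i v, v ∈ S i → ∃ j, v = f (i, j) := by
    intro i v hv
    simp only [S, mem_insert, mem_singleton] at hv
    rcases hv with h | h | h <;> exact ⟨_, h⟩
  have hdis : ∀ i j, i ≠ j → Disjoint (S i) (S j) := by
    intro i j hij
    rw [Finset.disjoint_left]
    intro v h1 h2
    obtain ⟨a, ha⟩ := hmem i v h1
    obtain ⟨b, hb⟩ := hmem j v h2
    have := f.injective (ha.symm.trans hb)
    simp at this
    exact hij this.1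
  have hcyc : ∀ i, Cyc G (S i) := fun i => cyc3 (h _ _ (by simp)) (h _ _ (by simp)) (h _ _ (by simp))
  have hinj : Function.Injective S := by
    intro i j hij
    by_contra hne
    have := hdis i j hne
    rw [hij, disjoint_self] at this
    have h1 := (hcyc j).1
    rw [this] at h1
    simp at h1
  refine ⟨univ.image S, ⟨?_, ?_⟩, by rw [card_image_of_injective _ hinj]; simp⟩
  · intro C hC
    simp at hC
    obtain ⟨i, rfl⟩ := hC
    exact hcyc i
  · intro C hC D hD hne
    simp at hC hD
    obtain ⟨i, rfl⟩ := hC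
    obtain ⟨j, rfl⟩ := hD
    exact hdis i j (by rintro rfl; exact hne rfl)

theorem main {k : ℕ} (hcard : 3 * k ≤ Fintype.card V) (G : SimpleGraph V)
    (hdeg : ∀ x y, x ≠ y → ¬ G.Adj x y → 4 * k ≤ nb G univ x + nb G univ y + 1) :
    ∃ F, Pk G F ∧ F.card = k := by
  induction G using WellFoundedGT.induction with
  | ind G ih =>
  by_cases hc : ∀ x y, x ≠ y → G.Adj x y
  · exact complete_case hcard hc
  push Not at hc
  obtain ⟨x, y, hne, hadj⟩ := hc
  by_contra! hno
  have hle : G ≤ G ⊔ SimpleGraph.edge x y := le_sup_left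
  have hlt : G < G ⊔ SimpleGraph.edge x y := by
    refine lt_of_le_of_ne hle ?_
    intro he
    apply hadj
    rw [he]
    simp [SimpleGraph.edge_adj, hne]
  obtain ⟨F, hF, hFk⟩ := ih _ hlt (by
    intro u v huv ha
    have := hdeg u v huv (fun h => ha (hle h))
    have h1 := nb_le_of_le hle univ u
    have h2 := nb_le_of_le hle univ v
    omega)
  by_cases hx : ∃ C ∈ F, x ∈ C
  · obtain ⟨C, hC, hxC⟩ := hx
    refine core hdeg hno (F0 := F.erase C) ⟨?_, ?_⟩ ?_ ?_
    · intro D hD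
      rw [mem_erase] at hD
      exact (hF.1 D hD.2).of_sup fun h =>
        Finset.disjoint_left.1 (hF.2 D hD.2 C hC hD.1) h hxC
    · intro D hD E hE
      exact hF.2 D (mem_of_mem_erase hD) E (mem_of_mem_erase hE)
    · rw [card_erase_add_one hC, hFk]
    · refine (cyc_card (hF.1 C hC)).trans (card_le_card ?_)
      intro v hv
      rw [mem_R]
      intro D hD hvD
      rw [mem_erase] at hD
      exact Finset.disjoint_left.1 (hF.2 D hD.2 C hC hD.1) hvD hv
  · push Not at hx
    exact hno F ⟨fun C hC => (hF.1 C hC).of_sup (hx C hC), hF.2⟩ hFk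

end EW

/-- **Enomoto–Wang theorem.** For `k ≥ 1`, every graph on at least `3k` vertices with
`σ₂(G) ≥ 4k - 1` contains `k` pairwise vertex-disjoint cycles. -/
theorem enomoto_wang {V : Type*} [Fintype V] (G : SimpleGraph V) [DecidableRel G.Adj]
    (k : ℕ) (hk : 1 ≤ k) (hcard : 3 * k ≤ Fintype.card V)
    (hsigma : ((4 * k - 1 : ℕ) : ℕ∞) ≤ G.sigma2) :
    G.HasNDisjointCycles k := by
  classical
  have hdeg : ∀ x y, x ≠ y → ¬ G.Adj x y →
      4 * k ≤ EW.nb G Finset.univ x + EW.nb G Finset.univ y + 1 := by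
    intro x y hne hadj
    have h1 : ((4 * k - 1 : ℕ) : ℕ∞) ≤ ((G.degree x + G.degree y : ℕ) : ℕ∞) := by
      refine hsigma.trans ?_
      unfold SimpleGraph.sigma2
      exact iInf_le_of_le x (iInf_le_of_le y (iInf_le_of_le hne (iInf_le _ hadj)))
    have h2 : 4 * k - 1 ≤ G.degree x + G.degree y := by exact_mod_cast h1
    have e : ∀ v, EW.nb G Finset.univ v = G.degree v := by
      intro v
      unfold EW.nb
      rw [← SimpleGraph.card_neighborFinset_eq_degree]
      congr 1
      ext w
      simp
    rw [e, e]
    omega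
  obtain ⟨F, hF, hk'⟩ := EW.main hcard G hdeg
  have hcy := fun C : F => EW.exists_cycle (hF.1 C.1 C.2)
  choose v w hw hs using hcy
  let g : Fin k ≃ F := (finCongr hk'.symm).trans F.equivFin.symm
  refine ⟨fun i => ⟨v (g i), w (g i)⟩, fun i => hw (g i), ?_⟩
  intro i j hij x hx hx'
  have hne : (g i).1 ≠ (g j).1 := fun h => hij (g.injective (Subtype.ext h))
  exact Finset.disjoint_left.1 (hF.2 _ (g i).2 _ (g j).2 hne) (hs _ x hx) (hs _ x hx')
end

section
/- Let G be a finite simple graph, let C be a cycle in G, let P = v₁v₂…v_s be a path in G vertex-disjoint from C, and let 1 < i < s. Suppose that both of the following statements hold: (1) either (a) every vertex x of C has a neighbor among {v₁,…,v_{i−1}}, or (b) at least two vertices of C each have at least two neighbors among {v₁,…,v_{i−1}}; and (2) either (c) some vertex y of C has at least two neighbors among {v_i,…,v_s}, or (d) v_i has a neighbor on C and the number of edges between {v_{i+1},…,v_s} and V(C) is at least 2. Then the subgraph of G induced on V(C) ∪ V(P) contains two vertex-disjoint cycles. -/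
open SimpleGraph in
/-- `A` is internally connected by walks. -/
def TDJ {V : Type*} (G : SimpleGraph V) (A : Set V) : Prop :=
  ∀ a ∈ A, ∀ b ∈ A, ∃ p : G.Walk a b, p.IsPath ∧ ∀ v ∈ p.support, v ∈ A

theorem TDJ_singleton {V : Type*} (G : SimpleGraph V) (x : V) : TDJ G {x} := by
  rintro a rfl b rfl
  exact ⟨SimpleGraph.Walk.nil, by simp, by simp⟩

theorem TDJ_walk {V : Type*} (G : SimpleGraph V) {a b : V} (W : G.Walk a b) :
    TDJ G {v | v ∈ W.support} := by
  classical
  intro x hx y hy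
  refine ⟨((W.takeUntil x hx).reverse.append (W.takeUntil y hy)).bypass,
    SimpleGraph.Walk.bypass_isPath _, fun v hv => ?_⟩
  have hv := SimpleGraph.Walk.support_bypass_subset_support _ hv
  rw [SimpleGraph.Walk.mem_support_append_iff] at hv
  rcases hv with hv | hv
  · rw [SimpleGraph.Walk.support_reverse, List.mem_reverse] at hv
    exact SimpleGraph.Walk.support_takeUntil_subset_support _ _ hv
  · exact SimpleGraph.Walk.support_takeUntil_subset_support _ _ hv

theorem TDJ_take {V : Type*} (G : SimpleGraph V) {a b : V} (W : G.Walk a b) (n : ℕ) (hn : 0 < n) :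
    TDJ G {v | v ∈ W.support.take n} := by
  obtain ⟨m, rfl⟩ : ∃ m, n = m + 1 := ⟨n - 1, by omega⟩
  have := TDJ_walk G (W.take m)
  rwa [SimpleGraph.Walk.support_take] at this

theorem TDJ_drop {V : Type*} (G : SimpleGraph V) {a b : V} (W : G.Walk a b) (n : ℕ)
    (hn : n < W.support.length) :
    TDJ G {v | v ∈ W.support.drop n} := by
  have := TDJ_walk G (W.drop n)
  rw [SimpleGraph.Walk.drop_support_eq_support_drop_min] at this
  rw [SimpleGraph.Walk.length_support] at hn
  rwa [min_eq_left (by omega)] at this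

theorem TDJ_cycle {V : Type*} (G : SimpleGraph V) {c : V} (C : G.Walk c c) (hC : C.IsCycle)
    (x : V) (hx : x ∈ C.support) : TDJ G {v | v ∈ C.support ∧ v ≠ x} ∧
    ∃ y z, y ≠ z ∧ y ∈ C.support ∧ y ≠ x ∧ z ∈ C.support ∧ z ≠ x := by
  classical
  have hR := hC.rotate hx
  have hmem : ∀ v, v ∈ (C.rotate x hx).support ↔ v ∈ C.support := fun v => by simp
  generalize C.rotate x hx = R at hR hmem
  have h3 := hR.three_le_length
  constructor
  · have hp := hR.isPath_tail
    have hnn : ¬ R.tail.Nil := by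
      intro h
      have := SimpleGraph.Walk.nil_iff_length_eq.1 h
      have h2 := SimpleGraph.Walk.length_tail_add_one hR.not_nil
      omega
    have := TDJ_walk G R.tail.dropLast
    convert this using 1
    ext v
    simp only [Set.mem_setOf_eq]
    rw [← hmem]
    rw [SimpleGraph.Walk.support_dropLast hnn]
    have e1 : R.support = x :: R.tail.support := by
      rw [SimpleGraph.Walk.cons_support_tail hR.not_nil]
    have e2 : R.tail.support = R.tail.support.dropLast ++ [x] := by
      conv_lhs => rw [← List.dropLast_append_getLast (SimpleGraph.Walk.support_ne_nil R.tail)]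
      simp
    have hnd := hp.support_nodup
    rw [e1]
    generalize R.tail.support.dropLast = l at *
    rw [e2] at hnd ⊢
    simp [List.nodup_append] at hnd ⊢
    grind
  · refine ⟨R.snd, R.penultimate, hR.snd_ne_penultimate, ?_, ?_, ?_, ?_⟩
    · rw [← hmem]; exact SimpleGraph.Walk.getVert_mem_support _ _
    · exact (R.adj_snd hR.not_nil).ne'
    · rw [← hmem]; exact SimpleGraph.Walk.getVert_mem_support _ _
    · exact (R.adj_penultimate hR.not_nil).ne

theorem TDJ_key {V : Type*} (G : SimpleGraph V) {A B : Set V} (hA : TDJ G A) (hB : TDJ G B)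
    (hAB : ∀ v ∈ A, v ∉ B) {a₁ a₂ b₁ b₂ : V} (ha₁ : a₁ ∈ A) (ha₂ : a₂ ∈ A) (hb₁ : b₁ ∈ B)
    (hb₂ : b₂ ∈ B) (h₁ : G.Adj a₁ b₁) (h₂ : G.Adj a₂ b₂) (hne : a₁ ≠ a₂ ∨ b₁ ≠ b₂) :
    ∃ (a : V) (D : G.Walk a a), D.IsCycle ∧ ∀ v ∈ D.support, v ∈ A ∨ v ∈ B := by
  obtain ⟨p, hp, hpA⟩ := hA a₁ ha₁ a₂ ha₂
  obtain ⟨q, hq, hqB⟩ := hB b₂ hb₂ b₁ hb₁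
  refine ⟨b₁, SimpleGraph.Walk.cons h₁.symm (p.append (SimpleGraph.Walk.cons h₂ q)), ?_, ?_⟩
  · rw [SimpleGraph.Walk.cons_isCycle_iff]
    constructor
    · rw [SimpleGraph.Walk.isPath_def, SimpleGraph.Walk.support_append]
      simp only [SimpleGraph.Walk.support_cons, List.tail_cons]
      rw [List.nodup_append]
      refine ⟨hp.support_nodup, hq.support_nodup, ?_⟩
      rintro a ha b hb rfl
      exact hAB _ (hpA _ ha) (hqB _ hb)
    · rw [SimpleGraph.Walk.edges_append, SimpleGraph.Walk.edges_cons, List.mem_append,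
        List.mem_cons]
      rintro (h | h | h)
      · exact hAB _ (hpA _ (SimpleGraph.Walk.fst_mem_support_of_mem_edges _ h)) hb₁
      · rw [Sym2.eq_iff] at h
        rcases h with ⟨h, h'⟩ | ⟨h, h'⟩
        · exact hAB _ ha₂ (h ▸ hb₁)
        · rcases hne with hne | hne
          · exact hne h'
          · exact hne h
      · exact hAB _ ha₁ (hqB _ (SimpleGraph.Walk.snd_mem_support_of_mem_edges _ h))
  · intro v hv
    rw [SimpleGraph.Walk.support_cons, List.mem_cons, SimpleGraph.Walk.mem_support_append_iff,
      SimpleGraph.Walk.support_cons, List.mem_cons] at hv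
    rcases hv with rfl | hv | rfl | hv
    · exact Or.inr hb₁
    · exact Or.inl (hpA _ hv)
    · exact Or.inl ha₂
    · exact Or.inr (hqB _ hv)

theorem TDJ_two {α : Type*} {s : Set α} (h : 2 ≤ s.ncard) : ∃ a ∈ s, ∃ b ∈ s, a ≠ b :=
  (Set.one_lt_ncard_iff_nontrivial_and_finite.1 h).1

/-- Let `C` be a cycle and `P = v₁v₂…v_s` a path vertex-disjoint from `C` (here
`P.support = [v₁, …, v_s]`, so `v_j` is `P.support.get ⟨j - 1, _⟩`), and let `1 < i < s`.
If both condition (1) — (a) every vertex of `C` has a neighbor among `v₁, …, v_{i-1}`, or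
(b) at least two vertices of `C` have at least two neighbors among `v₁, …, v_{i-1}` — and
condition (2) — (c) some vertex of `C` has at least two neighbors among `v_i, …, v_s`, or
(d) `v_i` has a neighbor on `C` and there are at least two edges between `{v_{i+1}, …, v_s}`
and `C` — hold, then the induced subgraph on `V(C) ∪ V(P)` contains two vertex-disjoint
cycles. -/
theorem two_disjoint_cycles_in_cycle_path {V : Type*} (G : SimpleGraph V) {c u w : V}
    (C : G.Walk c c) (hC : C.IsCycle)
    (P : G.Walk u w) (hP : P.IsPath)
    (hdisj : ∀ v ∈ P.support, v ∉ C.support)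
    (i : ℕ) (hi1 : 1 < i) (his : i < P.support.length)
    (h1 : (∀ x ∈ C.support, ∃ z ∈ P.support.take (i - 1), G.Adj x z) ∨
          (∃ x ∈ C.support, ∃ y ∈ C.support, x ≠ y ∧
            2 ≤ {z | z ∈ P.support.take (i - 1) ∧ G.Adj x z}.ncard ∧
            2 ≤ {z | z ∈ P.support.take (i - 1) ∧ G.Adj y z}.ncard))
    (h2 : (∃ y ∈ C.support, 2 ≤ {z | z ∈ P.support.drop (i - 1) ∧ G.Adj y z}.ncard) ∨
          ((∃ z ∈ C.support, G.Adj (P.support.get ⟨i - 1, by omega⟩) z) ∧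
            2 ≤ {p : V × V | p.1 ∈ P.support.drop i ∧ p.2 ∈ C.support ∧
              G.Adj p.1 p.2}.ncard)) :
    ∃ (a b : V) (D₁ : G.Walk a a) (D₂ : G.Walk b b),
      D₁.IsCycle ∧ D₂.IsCycle ∧
      (∀ v ∈ D₁.support, v ∈ C.support ∨ v ∈ P.support) ∧
      (∀ v ∈ D₂.support, v ∈ C.support ∨ v ∈ P.support) ∧
      (∀ v ∈ D₁.support, v ∉ D₂.support) := by
  have hdCP : ∀ v ∈ C.support, v ∉ P.support := fun v h h' => hdisj v h' h
  have asm : ∀ (A₁ A₂ B₁ B₂ : Set V), (∀ v ∈ A₁, v ∈ C.support) → (∀ v ∈ A₂, v ∈ C.support) →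
      (∀ v ∈ B₁, v ∈ P.support) → (∀ v ∈ B₂, v ∈ P.support) → (∀ v ∈ A₁, v ∉ A₂) →
      (∀ v ∈ B₁, v ∉ B₂) →
      (∃ (a : V) (D : G.Walk a a), D.IsCycle ∧ ∀ v ∈ D.support, v ∈ A₁ ∨ v ∈ B₁) →
      (∃ (a : V) (D : G.Walk a a), D.IsCycle ∧ ∀ v ∈ D.support, v ∈ A₂ ∨ v ∈ B₂) →
      ∃ (a b : V) (D₁ : G.Walk a a) (D₂ : G.Walk b b),
      D₁.IsCycle ∧ D₂.IsCycle ∧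
      (∀ v ∈ D₁.support, v ∈ C.support ∨ v ∈ P.support) ∧
      (∀ v ∈ D₂.support, v ∈ C.support ∨ v ∈ P.support) ∧
      (∀ v ∈ D₁.support, v ∉ D₂.support) := by
    rintro A₁ A₂ B₁ B₂ hA₁ hA₂ hB₁ hB₂ hA hB ⟨a, D, hD, hDs⟩ ⟨b, E, hE, hEs⟩
    refine ⟨a, b, D, E, hD, hE, fun v hv => (hDs v hv).imp (hA₁ v) (hB₁ v),
      fun v hv => (hEs v hv).imp (hA₂ v) (hB₂ v), fun v hv hv' => ?_⟩
    rcases hDs v hv with h | h <;> rcases hEs v hv' with h' | h'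
    · exact hA v h h'
    · exact hdCP v (hA₁ v h) (hB₂ v h')
    · exact hdCP v (hA₂ v h') (hB₁ v h)
    · exact hB v h h'
  have sT : ∀ n, ∀ v ∈ {v | v ∈ P.support.take n}, v ∈ P.support :=
    fun n v hv => List.mem_of_mem_take hv
  have sD : ∀ n, ∀ v ∈ {v | v ∈ P.support.drop n}, v ∈ P.support :=
    fun n v hv => List.mem_of_mem_drop hv
  have sTD : ∀ n, ∀ v ∈ {v | v ∈ P.support.take n}, v ∉ {v | v ∈ P.support.drop n} :=
    fun n v hv hv' => List.disjoint_take_drop hP.support_nodup le_rfl hv hv'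
  have sX : ∀ x ∈ C.support, ∀ v ∈ ({x} : Set V), v ∈ C.support := by
    rintro x hx v rfl; exact hx
  have sY : ∀ x, ∀ v ∈ {v | v ∈ C.support ∧ v ≠ x}, v ∈ C.support := fun x v hv => hv.1
  have sXY : ∀ x, ∀ v ∈ ({x} : Set V), v ∉ {v | v ∈ C.support ∧ v ≠ x} := by
    rintro x v rfl ⟨_, h⟩; exact h rfl
  have jL := TDJ_take G P (i - 1) (by omega)
  have jL' := TDJ_take G P i (by omega)
  have jR := TDJ_drop G P (i - 1) (by omega)
  have jR' := TDJ_drop G P i (by omega)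
  have hvi : ∀ h, P.support.get ⟨i - 1, h⟩ ∈ P.support.take i := fun h => by
    rw [List.mem_take_iff_getElem]
    exact ⟨i - 1, by omega, rfl⟩
  have hvi' : ∀ h, P.support.get ⟨i - 1, h⟩ ∈ P.support.drop (i - 1) := fun h => by
    rw [List.mem_drop_iff_getElem]
    exact ⟨0, by omega, by simp⟩
  have hLL : ∀ v ∈ P.support.take (i - 1), v ∈ P.support.take i := fun v hv =>
    List.take_subset_take_left _ (by omega) hv
  have hRR : ∀ v ∈ P.support.drop i, v ∈ P.support.drop (i - 1) := fun v hv =>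
    List.drop_subset_drop_left _ (by omega) hv
  -- one vertex with two neighbours in a piece of the path
  have star : ∀ x ∈ C.support, ∀ B : Set V, TDJ G B → (∀ v ∈ B, v ∈ P.support) →
      ∀ y z, y ∈ B → z ∈ B → G.Adj x y → G.Adj x z → y ≠ z →
      ∃ (a : V) (D : G.Walk a a), D.IsCycle ∧ ∀ v ∈ D.support, v ∈ ({x} : Set V) ∨ v ∈ B := by
    intro x hx B hB hBP y z hy hz hxy hxz hne
    exact TDJ_key G (TDJ_singleton G x) hB (fun v hv hv' => hdCP v (sX x hx v hv) (hBP v hv'))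
      rfl rfl hy hz hxy hxz (Or.inr hne)
  -- the rest of the cycle with a piece of the path
  have rest : ∀ x ∈ C.support, ∀ B : Set V, TDJ G B → (∀ v ∈ B, v ∈ P.support) →
      ∀ p q y z, p ∈ C.support → p ≠ x → q ∈ C.support → q ≠ x → y ∈ B → z ∈ B →
      G.Adj p y → G.Adj q z → (p ≠ q ∨ y ≠ z) →
      ∃ (a : V) (D : G.Walk a a), D.IsCycle ∧ ∀ v ∈ D.support,
        v ∈ {v | v ∈ C.support ∧ v ≠ x} ∨ v ∈ B := by
    intro x hx B hB hBP p q y z hp hpx hq hqx hy hz hpy hqz hne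
    exact TDJ_key G (TDJ_cycle G C hC x hx).1 hB (fun v hv hv' => hdCP v hv.1 (hBP v hv'))
      ⟨hp, hpx⟩ ⟨hq, hqx⟩ hy hz hpy hqz hne
  -- case (c)
  have caseC : ∀ y ∈ C.support, ∀ z₁ z₂, z₁ ∈ P.support.drop (i - 1) →
      z₂ ∈ P.support.drop (i - 1) → G.Adj y z₁ → G.Adj y z₂ → z₁ ≠ z₂ →
      ∃ (a b : V) (D₁ : G.Walk a a) (D₂ : G.Walk b b),
      D₁.IsCycle ∧ D₂.IsCycle ∧
      (∀ v ∈ D₁.support, v ∈ C.support ∨ v ∈ P.support) ∧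
      (∀ v ∈ D₂.support, v ∈ C.support ∨ v ∈ P.support) ∧
      (∀ v ∈ D₁.support, v ∉ D₂.support) := by
    intro y hy z₁ z₂ hz₁ hz₂ a₁ a₂ hne
    have h1' := star y hy _ jR (sD _) z₁ z₂ hz₁ hz₂ a₁ a₂ hne
    refine asm _ {v | v ∈ C.support ∧ v ≠ y} _ {v | v ∈ P.support.take (i - 1)} (sX y hy)
      (sY y) (sD _) (sT _) (sXY y) (fun v h h' => sTD _ v h' h) h1' ?_
    rcases h1 with h1 | ⟨p, hp, q, hq, hpq, hp2, hq2⟩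
    · obtain ⟨p, q, hpq, hp, hpy, hq, hqy⟩ := (TDJ_cycle G C hC y hy).2
      obtain ⟨z, hz, hpz⟩ := h1 p hp
      obtain ⟨z', hz', hqz⟩ := h1 q hq
      exact rest y hy _ jL (sT _) p q z z' hp hpy hq hqy hz hz' hpz hqz (Or.inl hpq)
    · have : ∃ r ∈ C.support, r ≠ y ∧
          2 ≤ {z | z ∈ P.support.take (i - 1) ∧ G.Adj r z}.ncard := by
        by_cases h : p = y
        · exact ⟨q, hq, fun h' => hpq (h.trans h'.symm), hq2⟩
        · exact ⟨p, hp, h, hp2⟩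
      obtain ⟨r, hr, hry, hr2⟩ := this
      obtain ⟨z, ⟨hz, hz'⟩, t, ⟨ht, ht'⟩, hzt⟩ := TDJ_two hr2
      exact rest y hy _ jL (sT _) r r z t hr hry hr hry hz ht hz' ht' (Or.inr hzt)
  rcases h2 with ⟨y, hy, hy2⟩ | ⟨⟨z, hz, hadj⟩, h2⟩
  · obtain ⟨z, ⟨hz, hz'⟩, t, ⟨ht, ht'⟩, hzt⟩ := TDJ_two hy2
    exact caseC y hy z t hz ht hz' ht' hzt
  obtain ⟨⟨p₁, q₁⟩, ⟨hp₁, hq₁, e₁⟩, ⟨p₂, q₂⟩, ⟨hp₂, hq₂, e₂⟩, hne⟩ := TDJ_two h2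
  simp only at hp₁ hq₁ e₁ hp₂ hq₂ e₂
  have hvi := hvi (by omega)
  have hvi' := hvi' (by omega)
  generalize P.support.get ⟨i - 1, _⟩ = v at hvi hvi' hadj
  have hvn : ∀ p ∈ P.support.drop i, v ≠ p := by
    rintro p hp rfl
    exact sTD i v hvi hp
  by_cases hz₁ : q₁ = z
  · exact caseC z hz v p₁ hvi' (hRR _ hp₁) hadj.symm (hz₁ ▸ e₁.symm) (hvn _ hp₁)
  by_cases hz₂ : q₂ = z
  · exact caseC z hz v p₂ hvi' (hRR _ hp₂) hadj.symm (hz₂ ▸ e₂.symm) (hvn _ hp₂)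
  have hne' : q₁ ≠ q₂ ∨ p₁ ≠ p₂ := by
    by_contra! h
    exact hne (Prod.ext h.2 h.1)
  rcases h1 with h1 | ⟨x, hx, -, -, -, hx2, -⟩
  · obtain ⟨t, ht, hzt⟩ := h1 z hz
    refine asm _ _ _ _ (sX z hz) (sY z) (sT i) (sD i) (sXY z) (sTD i)
      (star z hz _ jL' (sT _) t v (hLL _ ht) hvi hzt hadj.symm ?_)
      (rest z hz _ jR' (sD _) q₁ q₂ p₁ p₂ hq₁ hz₁ hq₂ hz₂ hp₁ hp₂ e₁.symm e₂.symm hne')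
    rintro rfl
    exact sTD _ _ ht hvi'
  · by_cases hq : q₁ = q₂
    · subst hq
      exact caseC q₁ hq₁ p₁ p₂ (hRR _ hp₁) (hRR _ hp₂) e₁.symm e₂.symm (by simpa using hne')
    obtain ⟨t, ⟨ht, ht'⟩, t₂, ⟨ht₂, ht₂'⟩, htt⟩ := TDJ_two hx2
    refine asm _ {v | v ∈ C.support ∧ v ≠ x} _ {v | v ∈ P.support.drop (i - 1)} (sX x hx)
      (sY x) (sT (i - 1)) (sD _) (sXY x) (sTD _)
      (star x hx _ jL (sT _) t t₂ ht ht₂ ht' ht₂' htt) ?_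
    by_cases hx₁ : q₁ = x
    · subst hx₁
      exact rest q₁ hx _ jR (sD _) z q₂ v p₂ hz (Ne.symm hz₁) hq₂ (Ne.symm hq) hvi' (hRR _ hp₂)
        hadj.symm e₂.symm (Or.inl (Ne.symm hz₂))
    by_cases hx₂ : q₂ = x
    · subst hx₂
      exact rest q₂ hx _ jR (sD _) z q₁ v p₁ hz (Ne.symm hz₂) hq₁ hq hvi' (hRR _ hp₁)
        hadj.symm e₁.symm (Or.inl (Ne.symm hz₁))
    exact rest x hx _ jR (sD _) q₁ q₂ p₁ p₂ hq₁ hx₁ hq₂ hx₂ (hRR _ hp₁) (hRR _ hp₂)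
      e₁.symm e₂.symm hne'
end
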